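/- Equivalent form of the Glassey–Strauss theorem: Let τ > 0, let f ∈ C¹([0,τ)×ℝ³×ℝ³) and (E,B) ∈ C¹([0,τ)×ℝ³; ℝ³×ℝ³) be a solution of the relativistic Vlasov–Maxwell system with initial data f(0,·,·) = f^in, where f^in ∈ C¹(ℝ³×ℝ³) is nonnegative with compact support, and (E,B)(0,·) = (E^in, B^in) with E^in, B^in ∈ C²(ℝ³;ℝ³) compactly supported and satisfying div_x E^in = ∫_{ℝ³} f^in dξ and div_x B^in = 0. If sup_{t∈[0,τ)} R_f(t) < +∞, then sup_{t∈[0,τ)} ( ‖f(t)‖_{W^{1,∞}_{x,ξ}} + ‖E(t)‖_{W^{1,∞}_x} + ‖B(t)‖_{W^{1,∞}_x} ) < +∞. -/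

import Mathlib

open MeasureTheory Real Set Filter Metric RealInnerProductSpace
open scoped ENNReal NNReal Topology

noncomputable section

/-- Physical space `ℝ³` with its Euclidean structure. -/
abbrev E3 : Type := EuclideanSpace ℝ (Fin 3)

/-- The `i`-th standard basis vector of `ℝ³`. -/
def e3 (i : Fin 3) : E3 := EuclideanSpace.single i 1

/-- The relativistic velocity `v(ξ) = ξ/√(1+|ξ|²)`. -/
def vrel (ξ : E3) : E3 := (Real.sqrt (1 + ‖ξ‖ ^ 2))⁻¹ • ξ

/-- Cross product on `ℝ³`. -/
def cross3 (a b : E3) : E3 :=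
  (WithLp.equiv 2 (Fin 3 → ℝ)).symm
    ![a 1 * b 2 - a 2 * b 1, a 2 * b 0 - a 0 * b 2, a 0 * b 1 - a 1 * b 0]

/-- Partial derivative in the `i`-th coordinate direction. -/
def pd3 (u : E3 → ℝ) (i : Fin 3) (x : E3) : ℝ := fderiv ℝ u x (e3 i)

/-- Divergence of a vector field on `ℝ³`. -/
def divg (F : E3 → E3) (x : E3) : ℝ := ∑ i : Fin 3, pd3 (fun y => F y i) i x

/-- Curl of a vector field on `ℝ³`. -/
def curl3 (F : E3 → E3) (x : E3) : E3 :=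
  (WithLp.equiv 2 (Fin 3 → ℝ)).symm
    ![pd3 (fun y => F y 2) 1 x - pd3 (fun y => F y 1) 2 x,
      pd3 (fun y => F y 0) 2 x - pd3 (fun y => F y 2) 0 x,
      pd3 (fun y => F y 1) 0 x - pd3 (fun y => F y 0) 1 x]

/-- `W^{1,∞}_{x,ξ}` norm (as an extended real) of `f(t,·,·)`. -/
def WfNorm (f : ℝ → E3 → E3 → ℝ) (t : ℝ) : ℝ≥0∞ :=
  ⨆ p : E3 × E3,
    ((‖f t p.1 p.2‖₊ : ℝ≥0∞) + (‖fderiv ℝ (fun q : E3 × E3 => f t q.1 q.2) p‖₊ : ℝ≥0∞))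

/-- `W^{1,∞}_x` norm (as an extended real) of a field `F(t,·)`. -/
def WFieldNorm (F : ℝ → E3 → E3) (t : ℝ) : ℝ≥0∞ :=
  ⨆ x : E3, ((‖F t x‖₊ : ℝ≥0∞) + (‖fderiv ℝ (F t) x‖₊ : ℝ≥0∞))

/-- The momentum support radius
`R_f(t) = inf { r > 0 | f(t,x,ξ) = 0 for all x and all |ξ| > r }` (with value `∞` if no
such radius exists). -/
def Rsupp (f : ℝ → E3 → E3 → ℝ) (t : ℝ) : ℝ≥0∞ :=
  sInf {r : ℝ≥0∞ | 0 < r ∧ ∀ x ξ : E3, r < (‖ξ‖₊ : ℝ≥0∞) → f t x ξ = 0}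

open scoped ContDiff
abbrev Z3 : Type := E3 × E3

instance : (volume : Measure Z3).IsAddHaarMeasure := Measure.prod.instIsAddHaarMeasure _ _

/-- punctured cylinder -/
def Om (t : ℝ) : Set Z3 := {z | z.1 ≠ 0 ∧ ‖z.1‖ < t}

lemma Om_open (t : ℝ) : IsOpen (Om t) := by
  apply IsOpen.inter
  · exact isOpen_ne_fun continuous_fst continuous_const
  · exact isOpen_lt continuous_fst.norm continuous_const

def Cs (a b R : ℝ) : Set Z3 := {z | a ≤ ‖z.1‖ ∧ ‖z.1‖ ≤ b ∧ ‖z.2‖ ≤ R}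

lemma Cs_closed (a b R : ℝ) : IsClosed (Cs a b R) :=
  (isClosed_le continuous_const continuous_fst.norm).inter
    ((isClosed_le continuous_fst.norm continuous_const).inter
      (isClosed_le continuous_snd.norm continuous_const))

lemma Cs_compact (a b R : ℝ) : IsCompact (Cs a b R) := by
  apply ((isCompact_closedBall (0 : E3) b).prod (isCompact_closedBall (0 : E3) R)).of_isClosed_subset
    (Cs_closed a b R)
  rintro z ⟨_, h2, h3⟩
  simpa using ⟨h2, h3⟩

lemma Cs_sub {a b R t : ℝ} (ha : 0 < a) (hb : b < t) : Cs a b R ⊆ Om t := by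
  rintro z ⟨h1, h2, h3⟩
  refine ⟨fun h => ?_, by linarith⟩
  rw [h, norm_zero] at h1; linarith

def Adm (n : WithTop ℕ∞) (t : ℝ) (A : Z3 → ℝ) : Prop :=
  ContDiffOn ℝ n A (Om t) ∧ ∃ a b R, 0 < a ∧ b < t ∧ ∀ z, z ∉ Cs a b R → A z = 0

lemma tsupport_sub_Cs {A : Z3 → ℝ} {a b R : ℝ} (h : ∀ z, z ∉ Cs a b R → A z = 0) :
    tsupport A ⊆ Cs a b R := by
  apply closure_minimal _ (Cs_closed a b R)
  intro z hz
  by_contra hc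
  exact hz (h z hc)

lemma Adm.tsupport {n : WithTop ℕ∞} {t : ℝ} {A : Z3 → ℝ} (h : Adm n t A) :
    tsupport A ⊆ Om t := by
  obtain ⟨_, a, b, R, ha, hb, h0⟩ := h
  exact (tsupport_sub_Cs h0).trans (Cs_sub ha hb)

lemma Adm.compact {n : WithTop ℕ∞} {t : ℝ} {A : Z3 → ℝ} (h : Adm n t A) :
    HasCompactSupport A := by
  obtain ⟨_, a, b, R, ha, hb, h0⟩ := h
  exact (Cs_compact a b R).of_isClosed_subset (isClosed_tsupport _) (tsupport_sub_Cs h0)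

lemma Adm.mono {n m : WithTop ℕ∞} {t : ℝ} {A : Z3 → ℝ} (h : Adm n t A) (hm : m ≤ n) :
    Adm m t A := ⟨h.1.of_le hm, h.2⟩

lemma Adm.mul {n : WithTop ℕ∞} {t : ℝ} {A g : Z3 → ℝ} (h : Adm n t A)
    (hg : ContDiffOn ℝ n g (Om t)) : Adm n t (fun z => A z * g z) := by
  obtain ⟨h1, a, b, R, ha, hb, h0⟩ := h
  exact ⟨h1.mul hg, a, b, R, ha, hb, fun z hz => by simp [h0 z hz]⟩

lemma Adm.zero_off {n : WithTop ℕ∞} {t : ℝ} {A : Z3 → ℝ} (h : Adm n t A) {z : Z3}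
    (hz : z ∉ Om t) : A z = 0 := by
  obtain ⟨h1, a, b, R, ha, hb, h0⟩ := h
  exact h0 z (fun hc => hz (Cs_sub ha hb hc))

lemma fderiv_zero_off_Cs {A : Z3 → ℝ} {a b R : ℝ} (h : ∀ z, z ∉ Cs a b R → A z = 0) {z : Z3}
    (hz : z ∉ Cs a b R) : fderiv ℝ A z = 0 := by
  have : A =ᶠ[𝓝 z] fun _ => 0 := by
    filter_upwards [(Cs_closed a b R).isOpen_compl.mem_nhds hz] with y hy using h y hy
  rw [this.fderiv_eq]; simp

lemma Adm.fderiv {t : ℝ} {A : Z3 → ℝ} (h : Adm ∞ t A) (v : Z3) :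
    Adm ∞ t (fun z => fderiv ℝ A z v) := by
  obtain ⟨h1, a, b, R, ha, hb, h0⟩ := h
  refine ⟨?_, a, b, R, ha, hb, fun z hz => by
    show _root_.fderiv ℝ A z v = 0
    rw [fderiv_zero_off_Cs h0 hz]; simp⟩
  exact (h1.fderiv_of_isOpen (m := ∞) (Om_open t) (by simp)).clm_apply contDiffOn_const

lemma Adm.fderiv1 {t : ℝ} {A : Z3 → ℝ} (h : Adm 1 t A) (v : Z3) :
    Adm 0 t (fun z => _root_.fderiv ℝ A z v) := by
  obtain ⟨h1, a, b, R, ha, hb, h0⟩ := h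
  refine ⟨?_, a, b, R, ha, hb, fun z hz => by
    show _root_.fderiv ℝ A z v = 0
    rw [fderiv_zero_off_Cs h0 hz]; simp⟩
  exact (h1.fderiv_of_isOpen (m := 0) (Om_open t) (by simp)).clm_apply contDiffOn_const

lemma Adm.continuous {t : ℝ} {A : Z3 → ℝ} (h : Adm 0 t A) : Continuous A := by
  rw [continuous_iff_continuousAt]
  intro z
  by_cases hz : z ∈ Om t
  · exact h.1.continuousOn.continuousAt ((Om_open t).mem_nhds hz)
  · have : z ∉ _root_.tsupport A := fun hc => hz (h.tsupport hc)
    rw [notMem_tsupport_iff_eventuallyEq] at this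
    exact (continuousAt_const (y := (0 : ℝ))).congr this.symm

lemma Adm.integrable {t : ℝ} {A : Z3 → ℝ} (h : Adm 0 t A) : Integrable A :=
  h.continuous.integrable_of_hasCompactSupport h.compact

lemma Adm.integrable_mul {t : ℝ} {A g : Z3 → ℝ} (h : Adm 0 t A) (hg : ContinuousOn g (Om t)) :
    Integrable (fun z => A z * g z) :=
  (h.mul (contDiffOn_zero.2 hg)).integrable

lemma Adm.ibp {t : ℝ} {A W : Z3 → ℝ} (h : Adm 1 t A) (hW : ContDiffOn ℝ 1 W (Om t)) (v : Z3) :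
    ∫ z, A z * _root_.fderiv ℝ W z v = - ∫ z, _root_.fderiv ℝ A z v * W z := by
  apply integral_mul_fderiv_eq_neg_fderiv_mul_of_integrable
  · exact (h.fderiv1 v).integrable_mul hW.continuousOn
  · exact (h.mono (by simp)).integrable_mul
      ((hW.continuousOn_fderiv_of_isOpen (Om_open t) le_rfl).clm_apply continuousOn_const)
  · exact (h.mono (by simp)).integrable_mul hW.continuousOn
  · intro z _
    by_cases hz : z ∈ Om t
    · exact (h.1.contDiffAt ((Om_open t).mem_nhds hz)).differentiableAt (by simp)
    · have : z ∉ _root_.tsupport A := fun hc => hz (h.tsupport hc)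
      rw [notMem_tsupport_iff_eventuallyEq] at this
      exact (differentiableAt_const (0 : ℝ)).congr_of_eventuallyEq this
  · intro z hz
    exact (hW.contDiffAt ((Om_open t).mem_nhds (h.tsupport hz))).differentiableAt (by simp)

/-- unit direction component -/
def om (k : Fin 3) (y : E3) : ℝ := y k / ‖y‖

lemma coord_e3 (k l : Fin 3) : (e3 k) l = if l = k then 1 else 0 := by
  simp [e3]

lemma norm_e3 (k : Fin 3) : ‖e3 k‖ = 1 := by simp [e3]

lemma sum_coord_e3 (y : E3) : ∑ k, y k • e3 k = y := by
  ext l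
  simp [coord_e3]

lemma norm_sq_coord (y : E3) : ‖y‖ ^ 2 = ∑ k, y k ^ 2 := by
  rw [EuclideanSpace.norm_sq_eq]; simp

lemma abs_coord_le (y : E3) (k : Fin 3) : |y k| ≤ ‖y‖ := by
  simpa using PiLp.norm_apply_le y k

lemma om_sum_sq {y : E3} (hy : y ≠ 0) : ∑ k, om k y ^ 2 = 1 := by
  have : ‖y‖ ≠ 0 := norm_ne_zero_iff.2 hy
  simp only [om, div_pow, ← Finset.sum_div, ← norm_sq_coord]
  field_simp

lemma abs_om_le (k : Fin 3) (y : E3) : |om k y| ≤ 1 := by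
  rw [om, abs_div, abs_norm]
  exact div_le_one_of_le₀ (abs_coord_le y k) (norm_nonneg _)

lemma hasFDerivAt_norm' {y : E3} (hy : y ≠ 0) :
    HasFDerivAt (fun y : E3 => ‖y‖) ((‖y‖)⁻¹ • innerSL ℝ y) y := by
  have h1 : HasFDerivAt (fun y : E3 => ‖y‖ ^ 2) (2 • innerSL ℝ y) y :=
    (hasStrictFDerivAt_norm_sq y).hasFDerivAt
  have hn : ‖y‖ ≠ 0 := norm_ne_zero_iff.2 hy
  have h2 := h1.sqrt (by positivity)
  have : (fun y : E3 => √(‖y‖ ^ 2)) = fun y => ‖y‖ := by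
    ext y; exact Real.sqrt_sq (norm_nonneg _)
  rw [this] at h2
  rw [Real.sqrt_sq (norm_nonneg y)] at h2
  refine h2.congr_fderiv ?_
  rw [← Nat.cast_smul_eq_nsmul ℝ, smul_smul]
  congr 1
  push_cast
  field_simp

lemma inner_e3 (y : E3) (k : Fin 3) : inner ℝ y (e3 k) = y k := by
  simp [e3, EuclideanSpace.inner_single_right]

lemma contDiff_coord {n : WithTop ℕ∞} (k : Fin 3) : ContDiff ℝ n (fun y : E3 => y k) :=
  (EuclideanSpace.proj (𝕜 := ℝ) k).contDiff

lemma contDiffAt_om {n : WithTop ℕ∞} (k : Fin 3) {y : E3} (hy : y ≠ 0) :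
    ContDiffAt ℝ n (om k) y :=
  (contDiff_coord k).contDiffAt.div (contDiffAt_norm ℝ hy) (norm_ne_zero_iff.2 hy)

lemma hasFDerivAt_coord (k : Fin 3) (y : E3) :
    HasFDerivAt (fun y : E3 => y k) (EuclideanSpace.proj (𝕜 := ℝ) k) y :=
  (EuclideanSpace.proj (𝕜 := ℝ) k).hasFDerivAt

/-- divergence of a radial times direction: `∑ ∂_k (g(|y|) ω_k) = g' + 2 g / r`. -/
lemma fderiv_radial {g : ℝ → ℝ} {y : E3} (hy : y ≠ 0) {g' : ℝ}
    (hg : HasDerivAt g g' ‖y‖) (k : Fin 3) :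
    fderiv ℝ (fun y : E3 => g ‖y‖) y (e3 k) = g' * om k y := by
  have := (hg.hasFDerivAt.comp y (hasFDerivAt_norm' hy)).fderiv
  have h2 : (g ∘ fun y : E3 => ‖y‖) = fun y => g ‖y‖ := rfl
  rw [h2] at this
  rw [this]
  simp [om, inner_e3]; ring

lemma div_radial {g : ℝ → ℝ} {y : E3} (hy : y ≠ 0) {g' : ℝ}
    (hg : HasDerivAt g g' ‖y‖) :
    ∑ k, fderiv ℝ (fun y : E3 => g ‖y‖ * om k y) y (e3 k) = g' + 2 * g ‖y‖ / ‖y‖ := by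
  have hn : ‖y‖ ≠ 0 := norm_ne_zero_iff.2 hy
  have hq : HasDerivAt (fun r => g r / r) ((g' * ‖y‖ - g ‖y‖) / ‖y‖ ^ 2) ‖y‖ :=
    (hg.fun_div (hasDerivAt_id' _) hn).congr_deriv (by simp)
  have : ∀ k, fderiv ℝ (fun y : E3 => g ‖y‖ * om k y) y (e3 k)
      = (g' * ‖y‖ - g ‖y‖) / ‖y‖ ^ 2 * om k y * y k + g ‖y‖ / ‖y‖ := by
    intro k
    have he : (fun y : E3 => g ‖y‖ * om k y) = fun y => (g ‖y‖ / ‖y‖) * y k := by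
      ext y; simp [om]; ring
    have h1 : DifferentiableAt ℝ (fun y : E3 => g ‖y‖ / ‖y‖) y :=
      (hq.differentiableAt).comp y (hasFDerivAt_norm' hy).differentiableAt
    rw [he, fderiv_fun_mul h1 (hasFDerivAt_coord k y).differentiableAt]
    have h2 := fderiv_radial hy hq k
    simp only [add_apply, smul_apply, smul_eq_mul, h2,
      (hasFDerivAt_coord k y).fderiv]
    simp [coord_e3]; ring
  simp only [this, Finset.sum_add_distrib]
  have h3 : ∑ k, (g' * ‖y‖ - g ‖y‖) / ‖y‖ ^ 2 * om k y * y k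
      = (g' * ‖y‖ - g ‖y‖) / ‖y‖ := by
    have : ∀ k, (g' * ‖y‖ - g ‖y‖) / ‖y‖ ^ 2 * om k y * y k
      = (g' * ‖y‖ - g ‖y‖) / ‖y‖ * (om k y)^2 := by
      intro k; simp only [om]; field_simp
    rw [Finset.sum_congr rfl fun k _ => this k, ← Finset.mul_sum, om_sum_sq hy, mul_one]
  rw [h3]
  simp
  field_simp
  ring

/-- the constant `4π` -/
def s3 : ℝ := 3 * (volume : Measure E3).real (ball 0 1)

lemma s3_pos : 0 < s3 := by
  have : 0 < (volume : Measure E3).real (ball 0 1) :=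
    ENNReal.toReal_pos (measure_ball_pos _ _ one_pos).ne' measure_ball_lt_top.ne
  unfold s3; positivity

lemma radial (g : ℝ → ℝ) : ∫ y : E3, g ‖y‖ = s3 * ∫ r in Ioi (0 : ℝ), r ^ 2 * g r := by
  rw [integral_fun_norm_addHaar]
  simp [s3]
  ring

/-- open space-time-momentum domain -/
def UU (τ : ℝ) : Set (ℝ × E3 × E3) := Ioo 0 τ ×ˢ univ

def U1 (τ : ℝ) : Set (ℝ × E3) := Ioo 0 τ ×ˢ univ

lemma UU_open (τ : ℝ) : IsOpen (UU τ) := isOpen_Ioo.prod isOpen_univ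
lemma U1_open (τ : ℝ) : IsOpen (U1 τ) := isOpen_Ioo.prod isOpen_univ

def dT (g : ℝ × E3 × E3 → ℝ) (p : ℝ × E3 × E3) : ℝ := fderiv ℝ g p (1, 0, 0)
def dX (k : Fin 3) (g : ℝ × E3 × E3 → ℝ) (p : ℝ × E3 × E3) : ℝ := fderiv ℝ g p (0, e3 k, 0)
def dV (k : Fin 3) (g : ℝ × E3 × E3 → ℝ) (p : ℝ × E3 × E3) : ℝ := fderiv ℝ g p (0, 0, e3 k)
def d0 (g : ℝ × E3 → ℝ) (p : ℝ × E3) : ℝ := fderiv ℝ g p (1, 0)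
def d1 (k : Fin 3) (g : ℝ × E3 → ℝ) (p : ℝ × E3) : ℝ := fderiv ℝ g p (0, e3 k)

/-- retarded evaluation -/
def ret (t : ℝ) (x : E3) (g : ℝ × E3 × E3 → ℝ) (z : Z3) : ℝ := g (t - ‖z.1‖, x + z.1, z.2)

lemma cd_fderiv_cont {X : Type*} [NormedAddCommGroup X] [NormedSpace ℝ X] {U : Set X}
    (hU : IsOpen U) {g : X → ℝ} (hg : ContDiffOn ℝ 1 g U) (v : X) :
    ContinuousOn (fun p => fderiv ℝ g p v) U :=
  (hg.continuousOn_fderiv_of_isOpen hU le_rfl).clm_apply continuousOn_const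

lemma ret_mem {t τ : ℝ} (ht : t ≤ τ) (x : E3) {z : Z3} (hz : z ∈ Om t) :
    (t - ‖z.1‖, x + z.1, z.2) ∈ UU τ := by
  have h1 := norm_pos_iff.2 hz.1
  have h2 := hz.2
  refine ⟨⟨?_, ?_⟩, trivial⟩ <;> simp <;> linarith

lemma ret_cont {t τ : ℝ} (ht : t ≤ τ) (x : E3) {g : ℝ × E3 × E3 → ℝ} (hg : ContinuousOn g (UU τ)) :
    ContinuousOn (ret t x g) (Om t) :=
  hg.comp (f := fun z : Z3 => (t - ‖z.1‖, x + z.1, z.2)) (by fun_prop) fun _ hz => ret_mem ht x hz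

lemma ret_cont2 {t τ : ℝ} (ht : t ≤ τ) {g : ℝ × E3 × E3 → ℝ} (hg : ContinuousOn g (UU τ)) :
    ContinuousOn (fun q : E3 × Z3 => ret t q.1 g q.2) (univ ×ˢ Om t) :=
  hg.comp (f := fun q : E3 × Z3 => (t - ‖q.2.1‖, q.1 + q.2.1, q.2.2)) (by fun_prop)
    fun q hq => ret_mem ht q.1 hq.2

lemma ret_cd {t τ : ℝ} (ht : t ≤ τ) (x : E3) {g : ℝ × E3 × E3 → ℝ} (hg : ContDiffOn ℝ 1 g (UU τ)) :
    ContDiffOn ℝ 1 (ret t x g) (Om t) := by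
  refine hg.comp (f := fun z : Z3 => (t - ‖z.1‖, x + z.1, z.2)) ?_ fun _ hz => ret_mem ht x hz
  intro z hz
  have : ContDiffAt ℝ 1 (fun z : Z3 => ‖z.1‖) z :=
    (contDiffAt_norm ℝ hz.1).comp (f := fun z : Z3 => z.1) z contDiffAt_fst
  exact ((contDiffAt_const.sub this).prodMk
    ((contDiffAt_const.add contDiffAt_fst).prodMk contDiffAt_snd)).contDiffWithinAt

lemma cd_diff {X : Type*} [NormedAddCommGroup X] [NormedSpace ℝ X] {U : Set X}
    (hU : IsOpen U) {g : X → ℝ} (hg : ContDiffOn ℝ 1 g U) {p : X} (hp : p ∈ U) :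
    HasFDerivAt g (fderiv ℝ g p) p :=
  ((hg.contDiffAt (hU.mem_nhds hp)).differentiableAt (by simp)).hasFDerivAt

lemma ret_fderiv {t τ : ℝ} (ht : t ≤ τ) (x : E3) {g : ℝ × E3 × E3 → ℝ}
    (hg : ContDiffOn ℝ 1 g (UU τ)) {z : Z3} (hz : z ∈ Om t) (v : Z3) :
    fderiv ℝ (ret t x g) z v =
      fderiv ℝ g (t - ‖z.1‖, x + z.1, z.2) (- (‖z.1‖⁻¹ * inner ℝ z.1 v.1), v.1, v.2) := by
  have h1 := cd_diff (UU_open τ) hg (ret_mem ht x hz)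
  have h2 : HasFDerivAt (fun z : Z3 => ‖z.1‖)
      (((‖z.1‖)⁻¹ • innerSL ℝ z.1).comp (ContinuousLinearMap.fst ℝ E3 E3)) z :=
    (hasFDerivAt_norm' hz.1).comp z hasFDerivAt_fst
  have h3 := (h2.const_sub t).prodMk
    (((hasFDerivAt_fst (𝕜 := ℝ) (p := z)).const_add x).prodMk (hasFDerivAt_snd (𝕜 := ℝ) (p := z)))
  have h4 := (h1.comp z h3).fderiv
  have : ret t x g = g ∘ fun z : Z3 => (t - ‖z.1‖, x + z.1, z.2) := rfl
  rw [this, h4]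
  simp

lemma ret_dy {t τ : ℝ} (ht : t ≤ τ) (x : E3) {g : ℝ × E3 × E3 → ℝ}
    (hg : ContDiffOn ℝ 1 g (UU τ)) {z : Z3} (hz : z ∈ Om t) (k : Fin 3) :
    fderiv ℝ (ret t x g) z (e3 k, 0) = ret t x (dX k g) z - om k z.1 * ret t x (dT g) z := by
  rw [ret_fderiv ht x hg hz]
  have : ((- (‖z.1‖⁻¹ * inner ℝ z.1 (e3 k)), e3 k, 0) : ℝ × E3 × E3)
      = (0, e3 k, 0) - om k z.1 • (1, 0, 0) := by
    simp [inner_e3, om]; ring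
  simp only [this, map_sub, map_smul, smul_eq_mul]
  rfl

lemma ret_dxi {t τ : ℝ} (ht : t ≤ τ) (x : E3) {g : ℝ × E3 × E3 → ℝ}
    (hg : ContDiffOn ℝ 1 g (UU τ)) {z : Z3} (hz : z ∈ Om t) (k : Fin 3) :
    fderiv ℝ (ret t x g) z (0, e3 k) = ret t x (dV k g) z := by
  rw [ret_fderiv ht x hg hz]
  simp [ret, dV]

/-- Parametric integral, compactly supported. -/
lemma param_int {X Z : Type*} [NormedAddCommGroup X] [NormedSpace ℝ X] [FiniteDimensional ℝ X]
    [NormedAddCommGroup Z] [NormedSpace ℝ Z] [FiniteDimensional ℝ Z] [MeasurableSpace Z]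
    [BorelSpace Z] (μ : Measure Z) [IsFiniteMeasureOnCompacts μ]
    {U : Set X} (hU : IsOpen U) {K : Set Z} (hK : IsCompact K)
    {H : X → Z → ℝ} {H' : X → Z → X →L[ℝ] ℝ}
    (hH : ContinuousOn H.uncurry (U ×ˢ univ)) (hH' : ContinuousOn H'.uncurry (U ×ˢ univ))
    (hd : ∀ x ∈ U, ∀ z, HasFDerivAt (fun x => H x z) (H' x z) x)
    (h0 : ∀ x z, x ∈ U → z ∉ K → H x z = 0) (h0' : ∀ x z, x ∈ U → z ∉ K → H' x z = 0) :
    (∀ x ∈ U, HasFDerivAt (fun x => ∫ z, H x z ∂μ) (∫ z, H' x z ∂μ) x) ∧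
    ContDiffOn ℝ 1 (fun x => ∫ z, H x z ∂μ) U := by
  have hc : ∀ x ∈ U, Continuous (H x) := fun x hx => by
    rw [← continuousOn_univ]
    exact hH.comp (f := fun z => (x, z)) (by fun_prop) fun z _ => ⟨hx, trivial⟩
  have hc' : ∀ x ∈ U, Continuous (H' x) := fun x hx => by
    rw [← continuousOn_univ]
    exact hH'.comp (f := fun z => (x, z)) (by fun_prop) fun z _ => ⟨hx, trivial⟩
  have hcs : ∀ x ∈ U, HasCompactSupport (H x) := fun x hx =>
    HasCompactSupport.intro hK fun z hz => h0 x z hx hz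
  have main : ∀ x ∈ U, HasFDerivAt (fun x => ∫ z, H x z ∂μ) (∫ z, H' x z ∂μ) x := by
    intro x hx
    have := FiniteDimensional.proper ℝ X
    obtain ⟨ε, hε, hb⟩ := Metric.nhds_basis_closedBall.mem_iff.1 (hU.mem_nhds hx)
    obtain ⟨C, hC⟩ := ((isCompact_closedBall x ε).prod hK).exists_bound_of_continuousOn
      (hH'.mono (prod_mono hb (subset_univ K)))
    have hb' : ∀ z, ∀ x' ∈ closedBall x ε, ‖H' x' z‖ ≤ K.indicator (fun _ => C) z := by
      intro z x' hx'
      by_cases hz : z ∈ K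
      · rw [indicator_of_mem hz]; exact hC (x', z) ⟨hx', hz⟩
      · rw [indicator_of_notMem hz, h0' x' z (hb hx') hz, norm_zero]
    refine hasFDerivAt_integral_of_dominated_of_fderiv_le (closedBall_mem_nhds x hε)
      ?_ ((hc x hx).integrable_of_hasCompactSupport (hcs x hx)) (hc' x hx).aestronglyMeasurable
      (Eventually.of_forall hb') ?_ ?_
    · filter_upwards [hU.mem_nhds hx] with y hy using (hc y hy).aestronglyMeasurable
    · exact (integrable_indicator_iff hK.measurableSet).2
        (integrableOn_const hK.measure_lt_top.ne)
    · exact Eventually.of_forall fun z x' hx' => hd x' (hb hx') z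
  refine ⟨main, ?_⟩
  rw [show (1 : WithTop ℕ∞) = 0 + 1 by simp, contDiffOn_succ_iff_fderiv_of_isOpen hU]
  refine ⟨fun x hx => (main x hx).differentiableAt.differentiableWithinAt, by simp, ?_⟩
  rw [contDiffOn_zero]
  refine (continuousOn_integral_of_compact_support (μ := μ) hK hH' h0').congr fun x hx => ?_
  exact (main x hx).fderiv

lemma Adm.cont_smul {V : Type*} [NormedAddCommGroup V] [NormedSpace ℝ V] {t : ℝ} {A : Z3 → ℝ}
    (h : Adm 0 t A) {Φ : E3 × Z3 → V} (hΦ : ContinuousOn Φ (univ ×ˢ Om t)) :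
    Continuous fun q : E3 × Z3 => A q.2 • Φ q := by
  rw [continuous_iff_continuousAt]
  intro q
  by_cases hq : q.2 ∈ Om t
  · refine (h.continuous.continuousAt.comp continuousAt_snd).smul
      (hΦ.continuousAt ((isOpen_univ.prod (Om_open t)).mem_nhds ⟨trivial, hq⟩))
  · have : q.2 ∉ _root_.tsupport A := fun hc => hq (h.tsupport hc)
    rw [notMem_tsupport_iff_eventuallyEq] at this
    have h2 : (fun q : E3 × Z3 => A q.2 • Φ q) =ᶠ[𝓝 q] fun _ => 0 := by
      filter_upwards [continuousAt_snd.eventually this] with y hy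
      simp only [hy, Pi.zero_apply, zero_smul]
    exact (continuousAt_const (y := (0 : V))).congr h2.symm

lemma Adm.ret_int_deriv {t τ : ℝ} (ht : t ≤ τ) {A : Z3 → ℝ} (h : Adm 0 t A)
    {g : ℝ × E3 × E3 → ℝ} (hg : ContDiffOn ℝ 1 g (UU τ)) (x : E3) :
    DifferentiableAt ℝ (fun x => ∫ z, A z * ret t x g z) x ∧
    ∀ k, _root_.fderiv ℝ (fun x => ∫ z, A z * ret t x g z) x (e3 k)
      = ∫ z, A z * ret t x (dX k g) z := by
  let L : E3 →L[ℝ] ℝ × E3 × E3 :=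
    (ContinuousLinearMap.inr ℝ ℝ (E3 × E3)).comp (ContinuousLinearMap.inl ℝ E3 E3)
  let Φ : E3 × Z3 → E3 →L[ℝ] ℝ := fun q =>
    (_root_.fderiv ℝ g (t - ‖q.2.1‖, q.1 + q.2.1, q.2.2)).comp L
  have hΦ : ContinuousOn Φ (univ ×ˢ Om t) := by
    refine ContinuousOn.clm_comp ?_ continuousOn_const
    exact (hg.continuousOn_fderiv_of_isOpen (UU_open τ) le_rfl).comp
      (f := fun q : E3 × Z3 => (t - ‖q.2.1‖, q.1 + q.2.1, q.2.2)) (by fun_prop)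
      fun q hq => ret_mem ht q.1 hq.2
  have hc := h.cont_smul hΦ
  have key := (param_int (volume : Measure Z3) (isOpen_univ (X := E3)) h.compact
    (H := fun x z => A z * ret t x g z) (H' := fun x z => A z • Φ (x, z))
    (h.cont_smul (ret_cont2 ht hg.continuousOn)).continuousOn hc.continuousOn ?_
    (fun p x _ hx => by simp [image_eq_zero_of_notMem_tsupport hx])
    (fun p x _ hx => by simp [image_eq_zero_of_notMem_tsupport hx])).1 x trivial
  · refine ⟨key.differentiableAt, fun k => ?_⟩
    rw [key.fderiv, ContinuousLinearMap.integral_apply]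
    · rfl
    · refine Continuous.integrable_of_hasCompactSupport ?_ ?_
      · exact hc.comp (f := fun z => (x, z)) (by fun_prop)
      · exact h.compact.smul_right
  · intro x _ z
    by_cases hz : z ∈ Om t
    · have h1 := cd_diff (UU_open τ) hg (ret_mem ht x hz)
      have h3 : HasFDerivAt (fun x : E3 => (t - ‖z.1‖, x + z.1, z.2)) L x := by
        have := (hasFDerivAt_const (𝕜 := ℝ) (t - ‖z.1‖) x).prodMk
          (((hasFDerivAt_id (𝕜 := ℝ) x).add_const z.1).prodMk (hasFDerivAt_const (𝕜 := ℝ) z.2 x))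
        exact this.congr_fderiv (by ext v <;> simp [L])
      exact (h1.comp x h3).const_mul (A z)
    · simp only [h.zero_off hz, zero_mul, zero_smul]
      exact hasFDerivAt_const _ _

/-- momentum average -/
def mom (c : E3 → ℝ) (g : ℝ × E3 × E3 → ℝ) (p : ℝ × E3) : ℝ := ∫ ξ, c ξ * g (p.1, p.2, ξ)

lemma fderiv_zero_xi {g : ℝ × E3 × E3 → ℝ} {τ R : ℝ}
    (h0 : ∀ p ∈ UU τ, R < ‖p.2.2‖ → g p = 0) {p : ℝ × E3 × E3} (hp : p ∈ UU τ) (hR : R < ‖p.2.2‖) :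
    fderiv ℝ g p = 0 := by
  have : g =ᶠ[𝓝 p] fun _ => 0 := by
    have h2 : {q : ℝ × E3 × E3 | R < ‖q.2.2‖} ∈ 𝓝 p :=
      (isOpen_lt continuous_const (continuous_snd.comp continuous_snd).norm).mem_nhds hR
    filter_upwards [(UU_open τ).mem_nhds hp, h2] with y hy hy2 using h0 y hy hy2
  rw [this.fderiv_eq]; simp

lemma mom_cd {τ R : ℝ} {c : E3 → ℝ} (hc : Continuous c) {g : ℝ × E3 × E3 → ℝ}
    (hg : ContDiffOn ℝ 1 g (UU τ)) (h0 : ∀ p ∈ UU τ, R < ‖p.2.2‖ → g p = 0) :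
    ContDiffOn ℝ 1 (mom c g) (U1 τ) ∧
    ∀ p ∈ U1 τ, d0 (mom c g) p = mom c (dT g) p ∧ ∀ k, d1 k (mom c g) p = mom c (dX k g) p := by
  let L : ℝ × E3 →L[ℝ] ℝ × E3 × E3 := (ContinuousLinearMap.fst ℝ ℝ E3).prod
    ((ContinuousLinearMap.inl ℝ E3 E3).comp (ContinuousLinearMap.snd ℝ ℝ E3))
  let H' : ℝ × E3 → E3 → (ℝ × E3 →L[ℝ] ℝ) := fun p ξ =>
    c ξ • (fderiv ℝ g (p.1, p.2, ξ)).comp L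
  have hH' : ContinuousOn H'.uncurry (U1 τ ×ˢ univ) := by
    refine (hc.comp continuous_snd).continuousOn.smul (ContinuousOn.clm_comp ?_ continuousOn_const)
    exact (hg.continuousOn_fderiv_of_isOpen (UU_open τ) le_rfl).comp
      (f := fun q : (ℝ × E3) × E3 => (q.1.1, q.1.2, q.2)) (by fun_prop)
      fun q hq => ⟨hq.1.1, trivial⟩
  have hmem : ∀ p : ℝ × E3, p ∈ U1 τ → ∀ ξ, ((p.1, p.2, ξ) : ℝ × E3 × E3) ∈ UU τ :=
    fun p hp ξ => ⟨hp.1, trivial⟩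
  have h0' : ∀ p ξ, p ∈ U1 τ → ξ ∉ closedBall (0 : E3) R → H' p ξ = 0 := by
    intro p ξ hp hξ
    simp only [mem_closedBall, dist_zero_right, not_le] at hξ
    simp only [H', fderiv_zero_xi h0 (hmem p hp ξ) hξ]; simp
  have key := param_int (volume : Measure E3) (U1_open τ) (isCompact_closedBall (0 : E3) R)
    (H := fun p ξ => c ξ * g (p.1, p.2, ξ)) (H' := H') ?_ hH' ?_ ?_ h0'
  · refine ⟨key.2, fun p hp => ?_⟩
    have hi : Integrable (H' p) := by
      refine Continuous.integrable_of_hasCompactSupport ?_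
        (HasCompactSupport.intro (isCompact_closedBall (0 : E3) R) fun ξ hξ => h0' p ξ hp hξ)
      rw [← continuousOn_univ]
      exact hH'.comp (f := fun z => (p, z)) (by fun_prop) fun z _ => ⟨hp, trivial⟩
    have h1 : ∀ v, fderiv ℝ (mom c g) p v = ∫ ξ, H' p ξ v := fun v => by
      rw [← ContinuousLinearMap.integral_apply hi]
      exact congrArg (fun T => T v) (key.1 p hp).fderiv
    exact ⟨by rw [d0, h1]; rfl, fun k => by rw [d1, h1]; rfl⟩
  · refine (hc.comp continuous_snd).continuousOn.mul ?_
    exact hg.continuousOn.comp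
      (f := fun q : (ℝ × E3) × E3 => (q.1.1, q.1.2, q.2)) (by fun_prop)
      fun q hq => ⟨hq.1.1, trivial⟩
  · intro p hp ξ
    have h1 := cd_diff (UU_open τ) hg (hmem p hp ξ)
    have h3 : HasFDerivAt (fun p : ℝ × E3 => ((p.1, p.2, ξ) : ℝ × E3 × E3)) L p :=
      (((hasFDerivAt_fst (𝕜 := ℝ) (p := p)).prodMk ((hasFDerivAt_snd (𝕜 := ℝ) (p := p)).prodMk
        (hasFDerivAt_const (𝕜 := ℝ) ξ p)))).congr_fderiv (by ext v <;> simp [L])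
    exact (h1.comp p h3).const_mul (c ξ)
  · intro p ξ hp hξ
    simp only [mem_closedBall, dist_zero_right, not_le] at hξ
    simp only [h0 _ (hmem p hp ξ) hξ, mul_zero]

lemma d0_cont {τ : ℝ} {w : ℝ × E3 → ℝ} (hw : ContDiffOn ℝ 1 w (U1 τ)) :
    ContinuousOn (d0 w) (U1 τ) := cd_fderiv_cont (U1_open τ) hw _

lemma d1_cont {τ : ℝ} {w : ℝ × E3 → ℝ} (hw : ContDiffOn ℝ 1 w (U1 τ)) (k : Fin 3) :
    ContinuousOn (d1 k w) (U1 τ) := cd_fderiv_cont (U1_open τ) hw _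

/-- retarded field in the variables `(y, x)` -/
def rp (t : ℝ) (w : ℝ × E3 → ℝ) (z : Z3) : ℝ := w (t - ‖z.1‖, z.2 + z.1)

lemma rp_mem {t τ : ℝ} (ht : t ≤ τ) {z : Z3} (hz : z ∈ Om t) :
    (t - ‖z.1‖, z.2 + z.1) ∈ U1 τ := by
  have h1 := norm_pos_iff.2 hz.1
  have h2 := hz.2
  refine ⟨⟨?_, ?_⟩, trivial⟩ <;> simp <;> linarith

lemma rp_cont {t τ : ℝ} (ht : t ≤ τ) {w : ℝ × E3 → ℝ} (hw : ContinuousOn w (U1 τ)) :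
    ContinuousOn (rp t w) (Om t) :=
  hw.comp (f := fun z : Z3 => (t - ‖z.1‖, z.2 + z.1)) (by fun_prop) fun _ hz => rp_mem ht hz

lemma rp_cd {t τ : ℝ} (ht : t ≤ τ) {w : ℝ × E3 → ℝ} (hw : ContDiffOn ℝ 1 w (U1 τ)) :
    ContDiffOn ℝ 1 (rp t w) (Om t) := by
  refine hw.comp (f := fun z : Z3 => (t - ‖z.1‖, z.2 + z.1)) ?_ fun _ hz => rp_mem ht hz
  intro z hz
  have : ContDiffAt ℝ 1 (fun z : Z3 => ‖z.1‖) z :=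
    (contDiffAt_norm ℝ hz.1).comp (f := fun z : Z3 => z.1) z contDiffAt_fst
  exact ((contDiffAt_const.sub this).prodMk
    (contDiffAt_snd.add contDiffAt_fst)).contDiffWithinAt

lemma rp_fderiv {t τ : ℝ} (ht : t ≤ τ) {w : ℝ × E3 → ℝ}
    (hw : ContDiffOn ℝ 1 w (U1 τ)) {z : Z3} (hz : z ∈ Om t) (v : Z3) :
    fderiv ℝ (rp t w) z v =
      fderiv ℝ w (t - ‖z.1‖, z.2 + z.1) (- (‖z.1‖⁻¹ * inner ℝ z.1 v.1), v.2 + v.1) := by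
  have h1 := cd_diff (U1_open τ) hw (rp_mem ht hz)
  have h2 : HasFDerivAt (fun z : Z3 => ‖z.1‖)
      (((‖z.1‖)⁻¹ • innerSL ℝ z.1).comp (ContinuousLinearMap.fst ℝ E3 E3)) z :=
    (hasFDerivAt_norm' hz.1).comp z hasFDerivAt_fst
  have h3 := (h2.const_sub t).prodMk
    ((hasFDerivAt_snd (𝕜 := ℝ) (p := z)).add (hasFDerivAt_fst (𝕜 := ℝ) (p := z)))
  have h4 := (h1.comp z h3).fderiv
  have : rp t w = w ∘ fun z : Z3 => (t - ‖z.1‖, z.2 + z.1) := rfl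
  rw [this]
  erw [h4]
  simp

lemma rp_dy {t τ : ℝ} (ht : t ≤ τ) {w : ℝ × E3 → ℝ}
    (hw : ContDiffOn ℝ 1 w (U1 τ)) {z : Z3} (hz : z ∈ Om t) (k : Fin 3) :
    fderiv ℝ (rp t w) z (e3 k, 0) = rp t (d1 k w) z - om k z.1 * rp t (d0 w) z := by
  rw [rp_fderiv ht hw hz]
  have : ((- (‖z.1‖⁻¹ * inner ℝ z.1 (e3 k)), 0 + e3 k) : ℝ × E3)
      = (0, e3 k) - om k z.1 • (1, 0) := by
    simp [inner_e3, om]; ring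
  simp only [this, map_sub, map_smul, smul_eq_mul]
  rfl

lemma rp_dx {t τ : ℝ} (ht : t ≤ τ) {w : ℝ × E3 → ℝ}
    (hw : ContDiffOn ℝ 1 w (U1 τ)) {z : Z3} (hz : z ∈ Om t) (k : Fin 3) :
    fderiv ℝ (rp t w) z (0, e3 k) = rp t (d1 k w) z := by
  rw [rp_fderiv ht hw hz]
  simp [rp, d1]

def Oy (t : ℝ) : Set E3 := {y | y ≠ 0 ∧ ‖y‖ < t}

lemma Oy_open (t : ℝ) : IsOpen (Oy t) :=
  (isOpen_ne_fun continuous_id continuous_const).inter (isOpen_lt continuous_norm continuous_const)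

def AP (t : ℝ) (P : E3 → ℝ) : Prop :=
  ContDiffOn ℝ ∞ P (Oy t) ∧ ∃ a b, 0 < a ∧ b < t ∧ ∀ y, ‖y‖ < a ∨ b < ‖y‖ → P y = 0

def TF (ψ : E3 → ℝ) : Prop := ContDiff ℝ ∞ ψ ∧ HasCompactSupport ψ

lemma TF.pd {ψ : E3 → ℝ} (h : TF ψ) (k : Fin 3) : TF (pd3 ψ k) :=
  ⟨(h.1.fderiv_right (m := ∞) (by simp)).clm_apply contDiff_const, h.2.fderiv_apply ℝ (e3 k)⟩

lemma TF.bound {ψ : E3 → ℝ} (h : TF ψ) : ∃ R, ∀ y, R < ‖y‖ → ψ y = 0 := by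
  obtain ⟨R, hR⟩ := h.2.isCompact.isBounded.exists_norm_le
  exact ⟨R, fun y hy => image_eq_zero_of_notMem_tsupport fun hc => absurd (hR y hc) (not_le.2 hy)⟩

lemma AP.adm {t : ℝ} {P ψ : E3 → ℝ} (h : AP t P) (hψ : TF ψ) :
    Adm ∞ t (fun z : Z3 => P z.1 * ψ z.2) := by
  obtain ⟨h1, a, b, ha, hb, h0⟩ := h
  obtain ⟨R, hR⟩ := hψ.bound
  refine ⟨(h1.comp contDiffOn_fst fun z hz => hz).mul (hψ.1.comp contDiff_snd).contDiffOn,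
    a, b, R, ha, hb, fun z hz => ?_⟩
  simp only [Cs, mem_ofPred_eq, not_and_or, not_le] at hz
  rcases hz with hz | hz | hz
  · simp [h0 z.1 (Or.inl hz)]
  · simp [h0 z.1 (Or.inr hz)]
  · simp [hR z.2 hz]

lemma AP.zero_off {t : ℝ} {P : E3 → ℝ} (h : AP t P) {y : E3} (hy : y ∉ Oy t) : P y = 0 := by
  obtain ⟨h1, a, b, ha, hb, h0⟩ := h
  apply h0
  simp only [Oy, mem_ofPred_eq, not_and_or, not_not, not_lt] at hy
  rcases hy with hy | hy
  · left; simpa [hy] using ha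
  · right; linarith

lemma AP.pd {t : ℝ} {P : E3 → ℝ} (h : AP t P) (k : Fin 3) : AP t (pd3 P k) := by
  obtain ⟨h1, a, b, ha, hb, h0⟩ := h
  refine ⟨(h1.fderiv_of_isOpen (m := ∞) (Oy_open t) (by simp)).clm_apply contDiffOn_const,
    a, b, ha, hb, fun y hy => ?_⟩
  have : P =ᶠ[𝓝 y] fun _ => 0 := by
    rcases hy with hy | hy
    · filter_upwards [(isOpen_lt continuous_norm continuous_const).mem_nhds hy] with z hz
      exact h0 z (Or.inl hz)
    · filter_upwards [(isOpen_lt continuous_const continuous_norm).mem_nhds hy] with z hz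
      exact h0 z (Or.inr hz)
  simp [pd3, this.fderiv_eq]

lemma AP.mulom {t : ℝ} {P : E3 → ℝ} (h : AP t P) (k : Fin 3) : AP t (fun y => P y * om k y) := by
  obtain ⟨h1, a, b, ha, hb, h0⟩ := h
  exact ⟨h1.mul fun y hy => (contDiffAt_om k hy.1).contDiffWithinAt, a, b, ha, hb,
    fun y hy => by simp [h0 y hy]⟩

lemma AP.sum {t : ℝ} {P : Fin 3 → E3 → ℝ} (h : ∀ k, AP t (P k)) : AP t (fun y => ∑ k, P k y) := by
  refine ⟨ContDiffOn.sum fun k _ => (h k).1, ?_⟩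
  choose h1 a b ha hb h0 using h
  refine ⟨min (a 0) (min (a 1) (a 2)), max (b 0) (max (b 1) (b 2)), by simp [ha], by simp [hb],
    fun y hy => ?_⟩
  show ∑ k, P k y = 0
  rw [Fin.sum_univ_three]
  rcases hy with hy | hy
  · simp only [lt_min_iff] at hy
    simp [h0 0 y (Or.inl hy.1), h0 1 y (Or.inl hy.2.1), h0 2 y (Or.inl hy.2.2)]
  · simp only [max_lt_iff] at hy
    simp [h0 0 y (Or.inr hy.1), h0 1 y (Or.inr hy.2.1), h0 2 y (Or.inr hy.2.2)]

/-- the weak pairing -/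
def br (t : ℝ) (P ψ : E3 → ℝ) (w : ℝ × E3 → ℝ) : ℝ := ∫ z : Z3, P z.1 * ψ z.2 * rp t w z

section
variable {t τ : ℝ} (ht : t ≤ τ)

lemma br_int (ht : t ≤ τ) {P ψ : E3 → ℝ} {w : ℝ × E3 → ℝ} (hP : AP t P) (hψ : TF ψ)
    (hw : ContinuousOn w (U1 τ)) : Integrable fun z : Z3 => P z.1 * ψ z.2 * rp t w z :=
  ((hP.adm hψ).mono (by simp)).integrable_mul (rp_cont ht hw)

lemma br_congr (ht : t ≤ τ) {P P' ψ : E3 → ℝ} {w w' : ℝ × E3 → ℝ} (hP : AP t P) (hP' : AP t P')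
    (h : ∀ y ∈ Oy t, P y = P' y)
    (hw : ∀ p ∈ U1 τ, w p = w' p) : br t P ψ w = br t P' ψ w' := by
  unfold br
  congr 1; ext z
  by_cases hz : z ∈ Om t
  · rw [h z.1 hz]; unfold rp; rw [hw _ (rp_mem ht hz)]
  · rw [hP.zero_off hz, hP'.zero_off hz]; simp

lemma br_add_w (ht : t ≤ τ) {P ψ : E3 → ℝ} {w w' : ℝ × E3 → ℝ} (hP : AP t P) (hψ : TF ψ)
    (hw : ContinuousOn w (U1 τ)) (hw' : ContinuousOn w' (U1 τ)) :
    br t P ψ (fun p => w p + w' p) = br t P ψ w + br t P ψ w' := by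
  unfold br
  rw [← integral_add (br_int ht hP hψ hw) (br_int ht hP hψ hw')]
  congr 1; ext z; simp only [rp]; ring

lemma br_sum_w (ht : t ≤ τ) {P ψ : E3 → ℝ} {w : Fin 3 → ℝ × E3 → ℝ} (hP : AP t P) (hψ : TF ψ)
    (hw : ∀ k, ContinuousOn (w k) (U1 τ)) :
    br t P ψ (fun p => ∑ k, w k p) = ∑ k, br t P ψ (w k) := by
  unfold br
  rw [← integral_finsetSum _ fun k _ => br_int ht hP hψ (hw k)]
  congr 1; ext z; simp only [rp, Finset.mul_sum]

lemma br_sub_w (ht : t ≤ τ) {P ψ : E3 → ℝ} {w w' : ℝ × E3 → ℝ} (hP : AP t P) (hψ : TF ψ)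
    (hw : ContinuousOn w (U1 τ)) (hw' : ContinuousOn w' (U1 τ)) :
    br t P ψ (fun p => w p - w' p) = br t P ψ w - br t P ψ w' := by
  unfold br
  rw [← integral_sub (br_int ht hP hψ hw) (br_int ht hP hψ hw')]
  congr 1; ext z; simp only [rp]; ring

lemma br_sum_P (ht : t ≤ τ) {P : Fin 3 → E3 → ℝ} {ψ : E3 → ℝ} {w : ℝ × E3 → ℝ}
    (hP : ∀ k, AP t (P k)) (hψ : TF ψ) (hw : ContinuousOn w (U1 τ)) :
    br t (fun y => ∑ k, P k y) ψ w = ∑ k, br t (P k) ψ w := by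
  unfold br
  rw [← integral_finsetSum _ fun k _ => br_int ht (hP k) hψ hw]
  congr 1; ext z; simp only [Finset.sum_mul]

lemma br_R1 (ht : t ≤ τ) {P ψ : E3 → ℝ} {w : ℝ × E3 → ℝ} (hP : AP t P) (hψ : TF ψ)
    (hw : ContDiffOn ℝ 1 w (U1 τ)) (k : Fin 3) :
    br t P ψ (d1 k w) = - br t P (pd3 ψ k) w := by
  have hA := (hP.adm hψ)
  have := (hA.mono (m := 1) (by simp)).ibp (rp_cd ht hw) (0, e3 k)
  unfold br
  convert this using 1
  · congr 1; ext z
    by_cases hz : z ∈ Om t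
    · rw [rp_dx ht hw hz]
    · rw [hP.zero_off hz]; simp
  · congr 2; ext z
    by_cases hz : z ∈ Om t
    · have h1 : HasFDerivAt (fun z : Z3 => P z.1)
          ((fderiv ℝ P z.1).comp (ContinuousLinearMap.fst ℝ E3 E3)) z :=
        (((hP.1.contDiffAt ((Oy_open t).mem_nhds hz)).differentiableAt (by simp)).hasFDerivAt).comp
          z hasFDerivAt_fst
      have h2 : HasFDerivAt (fun z : Z3 => ψ z.2)
          ((fderiv ℝ ψ z.2).comp (ContinuousLinearMap.snd ℝ E3 E3)) z :=
        (((hψ.1.differentiable (by simp)) z.2).hasFDerivAt).comp z hasFDerivAt_snd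
      rw [(h1.fun_mul h2).fderiv]
      simp [pd3]
    · rw [hP.zero_off hz, (hA.fderiv (0, e3 k)).zero_off hz]; simp

lemma br_R3 (ht : t ≤ τ) {P ψ : E3 → ℝ} {w : ℝ × E3 → ℝ} (hP : AP t P) (hψ : TF ψ)
    (hw : ContDiffOn ℝ 1 w (U1 τ)) (k : Fin 3) :
    br t P ψ (d1 k w) - br t (fun y => P y * om k y) ψ (d0 w) = - br t (pd3 P k) ψ w := by
  have hA := (hP.adm hψ)
  have := (hA.mono (m := 1) (by simp)).ibp (rp_cd ht hw) (e3 k, 0)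
  unfold br
  rw [← integral_sub (br_int ht hP hψ (d1_cont hw k))
    (br_int ht (hP.mulom k) hψ (d0_cont hw))]
  convert this using 1
  · congr 1; ext z
    by_cases hz : z ∈ Om t
    · rw [rp_dy ht hw hz]; simp only [rp, d1, d0]; ring
    · rw [hP.zero_off hz]; simp
  · congr 2; ext z
    by_cases hz : z ∈ Om t
    · have h1 : HasFDerivAt (fun z : Z3 => P z.1)
          ((fderiv ℝ P z.1).comp (ContinuousLinearMap.fst ℝ E3 E3)) z :=
        (((hP.1.contDiffAt ((Oy_open t).mem_nhds hz)).differentiableAt (by simp)).hasFDerivAt).comp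
          z hasFDerivAt_fst
      have h2 : HasFDerivAt (fun z : Z3 => ψ z.2)
          ((fderiv ℝ ψ z.2).comp (ContinuousLinearMap.snd ℝ E3 E3)) z :=
        (((hψ.1.differentiable (by simp)) z.2).hasFDerivAt).comp z hasFDerivAt_snd
      rw [(h1.fun_mul h2).fderiv]
      simp [pd3]; left; ring
    · rw [(hP.pd k).zero_off hz, (hA.fderiv (e3 k, 0)).zero_off hz]; simp

lemma br_R2 (ht : t ≤ τ) {P ψ : E3 → ℝ} {w : ℝ × E3 → ℝ} (hP : AP t P) (hψ : TF ψ)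
    (hw : ContDiffOn ℝ 1 w (U1 τ)) :
    br t P ψ (d0 w) = br t (fun y => ∑ k, pd3 (fun y => P y * om k y) k y) ψ w
      - ∑ k, br t (fun y => P y * om k y) (pd3 ψ k) w := by
  have h0 : br t P ψ (d0 w) = ∑ k, br t (fun y => P y * om k y * om k y) ψ (d0 w) := by
    rw [← br_sum_P ht (fun k => (hP.mulom k).mulom k) hψ (d0_cont hw)]
    refine br_congr ht hP (AP.sum fun k => (hP.mulom k).mulom k) (fun y hy => ?_) fun _ _ => rfl
    have := om_sum_sq hy.1
    calc P y = P y * ∑ k, om k y ^ 2 := by rw [this, mul_one]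
      _ = _ := by rw [Finset.mul_sum]; congr 1; ext k; ring
  rw [h0, br_sum_P ht (fun k => (hP.mulom k).pd k) hψ hw.continuousOn, ← Finset.sum_sub_distrib]
  refine Finset.sum_congr rfl fun k _ => ?_
  have h1 := br_R3 ht (hP.mulom k) hψ hw k
  have h2 := br_R1 ht (hP.mulom k) hψ hw k
  linarith

lemma TF.comm {ψ : E3 → ℝ} (h : TF ψ) (k l : Fin 3) : pd3 (pd3 ψ k) l = pd3 (pd3 ψ l) k := by
  ext x
  have hs : IsSymmSndFDerivAt ℝ ψ x := (h.1.contDiffAt (x := x)).isSymmSndFDerivAt (by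
    simp only [minSmoothness_of_isRCLikeNormedField]; exact WithTop.coe_le_coe.2 le_top)
  have hd : ∀ m : Fin 3, ∀ v, fderiv ℝ (pd3 ψ m) x v = fderiv ℝ (fderiv ℝ ψ) x v (e3 m) := by
    intro m v
    have hdd : DifferentiableAt ℝ (fderiv ℝ ψ) x :=
      ((h.1.fderiv_right (m := ∞) (by simp)).differentiable (by simp)) x
    have := (hdd.hasFDerivAt.clm_apply (hasFDerivAt_const (e3 m) x)).fderiv
    have he : pd3 ψ m = fun y => (fderiv ℝ ψ y) (e3 m) := rfl
    rw [he, this]; simp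
  simp only [pd3] at *
  rw [hd k, hd l]
  exact hs.eq _ _
end

/-- weak Kirchhoff identity for a first order system -/
lemma kirch_weak {t τ : ℝ} (ht : t ≤ τ) {w b ρ : ℝ × E3 → ℝ} {a c d : Fin 3 → ℝ × E3 → ℝ}
    (i : Fin 3)
    (hw : ContDiffOn ℝ 1 w (U1 τ)) (hb : ContDiffOn ℝ 1 b (U1 τ)) (hρ : ContDiffOn ℝ 1 ρ (U1 τ))
    (ha : ∀ k, ContDiffOn ℝ 1 (a k) (U1 τ)) (hc : ∀ k, ContDiffOn ℝ 1 (c k) (U1 τ))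
    (hd : ∀ k, ContDiffOn ℝ 1 (d k) (U1 τ))
    (e1 : ∀ p ∈ U1 τ, b p = d0 w p - ∑ k, d1 k (a k) p)
    (e2 : ∀ k, ∀ p ∈ U1 τ, d k p = d0 (a k) p - d1 k w p + d1 i (c k) p)
    (e3' : ∀ p ∈ U1 τ, ρ p = ∑ k, d1 k (c k) p)
    {N ψ : E3 → ℝ} (hN : AP t N) (hψ : TF ψ) :
    br t N ψ (d1 i ρ) - ∑ k, br t N ψ (d1 k (d k)) - br t N ψ (d0 b)
      = - ∑ k, br t (pd3 N k) ψ (d1 k w)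
        - br t (fun y => ∑ k, pd3 (fun y => N y * om k y) k y) ψ (d0 w) := by
  have hm : AP t (fun y => ∑ k, pd3 (fun y => N y * om k y) k y) := AP.sum fun k => (hN.mulom k).pd k
  -- source terms
  have s1 : br t N ψ (d1 i ρ) = ∑ k, br t N (pd3 (pd3 ψ i) k) (c k) := by
    rw [br_R1 ht hN hψ hρ, br_congr ht hN hN (fun _ _ => rfl) e3',
      br_sum_w ht hN (hψ.pd i) fun k => d1_cont (hc k) k, ← Finset.sum_neg_distrib]
    refine Finset.sum_congr rfl fun k _ => ?_
    rw [br_R1 ht hN (hψ.pd i) (hc k), neg_neg]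
  have s2 : ∀ k, br t N ψ (d1 k (d k)) = - br t N (pd3 ψ k) (d0 (a k))
      + br t N (pd3 ψ k) (d1 k w) + br t N (pd3 (pd3 ψ i) k) (c k) := by
    intro k
    rw [br_R1 ht hN hψ (hd k), br_congr ht hN hN (fun _ _ => rfl) (e2 k),
      br_add_w (w := fun p => d0 (a k) p - d1 k w p) ht hN (hψ.pd k) ((d0_cont (ha k)).sub (d1_cont hw k)) (d1_cont (hc k) i),
      br_sub_w ht hN (hψ.pd k) (d0_cont (ha k)) (d1_cont hw k),
      br_R1 ht hN (hψ.pd k) (hc k) i, hψ.comm k i]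
    ring
  have s3 : br t N ψ (d0 b) = br t (fun y => ∑ k, pd3 (fun y => N y * om k y) k y) ψ (d0 w)
      - ∑ k, br t (fun y => N y * om k y) (pd3 ψ k) (d0 w)
      + ∑ k, br t N (pd3 ψ k) (d0 (a k)) := by
    have hbw : ∀ {P φ : E3 → ℝ}, AP t P → TF φ → br t P φ b = br t P φ (d0 w)
        + ∑ k, br t P (pd3 φ k) (a k) := by
      intro P φ hP hφ
      rw [br_congr ht hP hP (fun _ _ => rfl) e1,
        br_sub_w ht hP hφ (d0_cont hw) (continuousOn_finsetSum _ fun k _ => d1_cont (ha k) k),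
        br_sum_w ht hP hφ fun k => d1_cont (ha k) k, sub_eq_add_neg, ← Finset.sum_neg_distrib]
      congr 1
      refine Finset.sum_congr rfl fun k _ => ?_
      rw [br_R1 ht hP hφ (ha k), neg_neg]
    rw [br_R2 ht hN hψ hb, hbw hm hψ,
      Finset.sum_congr rfl fun k _ => hbw (hN.mulom k) (hψ.pd k), Finset.sum_add_distrib,
      Finset.sum_comm]
    have : ∀ k, br t N (pd3 ψ k) (d0 (a k)) =
        br t (fun y => ∑ k, pd3 (fun y => N y * om k y) k y) (pd3 ψ k) (a k)
        - ∑ l, br t (fun y => N y * om l y) (pd3 (pd3 ψ l) k) (a k) := by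
      intro k
      rw [br_R2 ht hN (hψ.pd k) (ha k)]
      congr 1
      exact Finset.sum_congr rfl fun l _ => by rw [hψ.comm k l]
    rw [Finset.sum_congr rfl fun k _ => this k, Finset.sum_sub_distrib]
    ring
  have s4 : ∀ k, br t N (pd3 ψ k) (d1 k w) - br t (fun y => N y * om k y) (pd3 ψ k) (d0 w)
      = br t (pd3 N k) ψ (d1 k w) := by
    intro k
    rw [br_R3 ht hN (hψ.pd k) hw k, br_R1 ht (hN.pd k) hψ hw k]
  rw [s1, s3, Finset.sum_congr rfl fun k _ => s2 k, ← Finset.sum_congr rfl fun k _ => s4 k]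
  simp only [Finset.sum_add_distrib, Finset.sum_sub_distrib, Finset.sum_neg_distrib]
  ring

/-- radial profiles -/
def RC (t : ℝ) (g : ℝ → ℝ) : Prop :=
  ContDiffOn ℝ ∞ g (Ioi 0) ∧ ∃ a b, 0 < a ∧ b < t ∧ ∀ r, r < a ∨ b < r → g r = 0

lemma RC.ap {t : ℝ} {g : ℝ → ℝ} (h : RC t g) : AP t (fun y => g ‖y‖) := by
  obtain ⟨h1, a, b, ha, hb, h0⟩ := h
  refine ⟨?_, a, b, ha, hb, fun y hy => h0 _ hy⟩
  intro y hy
  have hn : (0 : ℝ) < ‖y‖ := norm_pos_iff.2 hy.1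
  exact ((h1.contDiffAt (Ioi_mem_nhds hn)).comp y (contDiffAt_norm ℝ hy.1)).contDiffWithinAt

lemma RC.deriv {t : ℝ} {g : ℝ → ℝ} (h : RC t g) : RC t (deriv g) := by
  obtain ⟨h1, a, b, ha, hb, h0⟩ := h
  refine ⟨h1.deriv_of_isOpen isOpen_Ioi (by simp), a, b, ha, hb, fun y hy => ?_⟩
  have : g =ᶠ[𝓝 y] fun _ => 0 := by
    rcases hy with hy | hy
    · filter_upwards [Iio_mem_nhds hy] with z hz using h0 z (Or.inl hz)
    · filter_upwards [Ioi_mem_nhds hy] with z hz using h0 z (Or.inr hz)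
  simp [this.deriv_eq]

lemma RC.mul {t : ℝ} {g φ : ℝ → ℝ} (h : RC t g) (hφ : ContDiffOn ℝ ∞ φ (Ioi 0)) :
    RC t (fun r => g r * φ r) := by
  obtain ⟨h1, a, b, ha, hb, h0⟩ := h
  exact ⟨h1.mul hφ, a, b, ha, hb, fun y hy => by simp [h0 y hy]⟩

lemma cd_inv_pow (n : ℕ) : ContDiffOn ℝ ∞ (fun r : ℝ => (r ^ n)⁻¹) (Ioi 0) :=
  fun _ hr => (((contDiff_id.pow n).contDiffAt).inv (pow_ne_zero _ (ne_of_gt hr))).contDiffWithinAt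

lemma RC.hasDeriv {t : ℝ} {g : ℝ → ℝ} (h : RC t g) {y : E3} (hy : y ≠ 0) :
    HasDerivAt g (_root_.deriv g ‖y‖) ‖y‖ :=
  ((h.1.contDiffAt (Ioi_mem_nhds (norm_pos_iff.2 hy))).differentiableAt (by simp)).hasDerivAt

/-- kernel profile `χ(|y|) |y|^{-n}` -/
def pr (χ : ℝ → ℝ) (n : ℕ) (y : E3) : ℝ := χ ‖y‖ * (‖y‖ ^ n)⁻¹

lemma pr_ap {t : ℝ} {χ : ℝ → ℝ} (h : RC t χ) (n : ℕ) : AP t (pr χ n) := (h.mul (cd_inv_pow n)).ap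

lemma kirch_weak2 {t τ : ℝ} (ht : t ≤ τ) {w b ρ : ℝ × E3 → ℝ} {a c d : Fin 3 → ℝ × E3 → ℝ}
    (i : Fin 3)
    (hw : ContDiffOn ℝ 1 w (U1 τ)) (hb : ContDiffOn ℝ 1 b (U1 τ)) (hρ : ContDiffOn ℝ 1 ρ (U1 τ))
    (ha : ∀ k, ContDiffOn ℝ 1 (a k) (U1 τ)) (hc : ∀ k, ContDiffOn ℝ 1 (c k) (U1 τ))
    (hd : ∀ k, ContDiffOn ℝ 1 (d k) (U1 τ))
    (e1 : ∀ p ∈ U1 τ, b p = d0 w p - ∑ k, d1 k (a k) p)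
    (e2 : ∀ k, ∀ p ∈ U1 τ, d k p = d0 (a k) p - d1 k w p + d1 i (c k) p)
    (e3' : ∀ p ∈ U1 τ, ρ p = ∑ k, d1 k (c k) p)
    {χ : ℝ → ℝ} {ψ : E3 → ℝ} (hχ : RC t χ) (hψ : TF ψ) :
    br t (pr χ 1) ψ (d1 i ρ) - ∑ k, br t (pr χ 1) ψ (d1 k (d k)) - br t (pr χ 1) ψ (d0 b)
      = - ((∑ k, br t (fun y => pr (deriv χ) 1 y * om k y) ψ (d1 k w))
        + br t (pr (deriv χ) 1) ψ (d0 w) + br t (pr (deriv χ) 2) ψ w) := by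
  have h1 := pr_ap hχ 1
  have h2 := pr_ap hχ 2
  have k1 := pr_ap hχ.deriv 1
  have k2 := pr_ap hχ.deriv 2
  have hder : ∀ n : ℕ, ∀ y : E3, y ≠ 0 → HasDerivAt (fun r => χ r * (r ^ (n+1))⁻¹)
      (deriv χ ‖y‖ * (‖y‖ ^ (n+1))⁻¹ - (n+1) * χ ‖y‖ * (‖y‖ ^ (n+2))⁻¹) ‖y‖ := by
    intro n y hy
    have hn : ‖y‖ ≠ 0 := norm_ne_zero_iff.2 hy
    have := (hχ.hasDeriv hy).mul ((hasDerivAt_pow (n+1) ‖y‖).inv (pow_ne_zero _ hn))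
    refine this.congr_deriv ?_
    push_cast
    simp
    field_simp
    ring
  rw [kirch_weak ht i hw hb hρ ha hc hd e1 e2 e3' h1 hψ]
  have q1 : ∀ k, br t (pd3 (pr χ 1) k) ψ (d1 k w)
      = br t (fun y => pr (deriv χ) 1 y * om k y) ψ (d1 k w)
        - br t (fun y => pr χ 2 y * om k y) ψ (d1 k w) := by
    intro k
    unfold br
    rw [← integral_sub (br_int ht (k1.mulom k) hψ (d1_cont hw k))
      (br_int ht (h2.mulom k) hψ (d1_cont hw k))]
    congr 1; ext z
    by_cases hz : z ∈ Om t
    · have := fderiv_radial hz.1 (hder 0 z.1 hz.1) k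
      change pd3 (pr χ 1) k z.1 = _ at this
      rw [this]; simp only [pr]; push_cast; ring
    · rw [(h1.pd k).zero_off hz, k1.zero_off hz, h2.zero_off hz]; simp
  have q2 : br t (fun y => ∑ k, pd3 (fun y => pr χ 1 y * om k y) k y) ψ (d0 w)
      = br t (pr (deriv χ) 1) ψ (d0 w) + br t (pr χ 2) ψ (d0 w) := by
    unfold br
    rw [← integral_add (br_int ht k1 hψ (d0_cont hw)) (br_int ht h2 hψ (d0_cont hw))]
    congr 1; ext z
    by_cases hz : z ∈ Om t
    · have := div_radial hz.1 (hder 0 z.1 hz.1)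
      have hn : ‖z.1‖ ≠ 0 := norm_ne_zero_iff.2 hz.1
      simp only [pd3, pr]
      simp only [zero_add] at this
      rw [this]; push_cast; field_simp; ring
    · have e : ∑ k, pd3 (fun y => pr χ 1 y * om k y) k z.1 = 0 :=
        (AP.sum fun k => (h1.mulom k).pd k).zero_off hz
      simp only [e, k1.zero_off hz, h2.zero_off hz]; simp
  have q3 : ∑ k, br t (fun y => pr χ 2 y * om k y) ψ (d1 k w) - br t (pr χ 2) ψ (d0 w)
      = - br t (pr (deriv χ) 2) ψ w := by
    have h0 : br t (pr χ 2) ψ (d0 w) = ∑ k, br t (fun y => pr χ 2 y * om k y * om k y) ψ (d0 w) := by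
      rw [← br_sum_P ht (fun k => (h2.mulom k).mulom k) hψ (d0_cont hw)]
      refine br_congr ht h2 (AP.sum fun k => (h2.mulom k).mulom k) (fun y hy => ?_) fun _ _ => rfl
      have := om_sum_sq hy.1
      calc pr χ 2 y = pr χ 2 y * ∑ k, om k y ^ 2 := by rw [this, mul_one]
        _ = _ := by rw [Finset.mul_sum]; congr 1; ext k; ring
    rw [h0, ← Finset.sum_sub_distrib,
      Finset.sum_congr rfl fun k _ => br_R3 ht (h2.mulom k) hψ hw k, Finset.sum_neg_distrib,
      ← br_sum_P ht (fun k => (h2.mulom k).pd k) hψ hw.continuousOn]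
    congr 1
    refine br_congr ht (AP.sum fun k => (h2.mulom k).pd k) k2 (fun y hy => ?_) fun _ _ => rfl
    have := div_radial hy.1 (hder 1 y hy.1)
    have hn : ‖y‖ ≠ 0 := norm_ne_zero_iff.2 hy.1
    simp only [pd3, pr]
    norm_num at this
    rw [this]; field_simp; ring
  rw [q2, Finset.sum_congr rfl fun k _ => q1 k, Finset.sum_sub_distrib]
  linarith

/-- strong retarded potential -/
def sy (t : ℝ) (x : E3) (P : E3 → ℝ) (w : ℝ × E3 → ℝ) : ℝ := ∫ y, P y * w (t - ‖y‖, x + y)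

lemma sy_cont2 {t τ : ℝ} (ht : t ≤ τ) {P : E3 → ℝ} {w : ℝ × E3 → ℝ} (hP : AP t P)
    (hw : ContinuousOn w (U1 τ)) :
    Continuous fun q : E3 × E3 => P q.2 * w (t - ‖q.2‖, q.1 + q.2) := by
  rw [continuous_iff_continuousAt]
  intro q
  by_cases hq : q.2 ∈ Oy t
  · have h1 : ContinuousAt P q.2 := hP.1.continuousOn.continuousAt ((Oy_open t).mem_nhds hq)
    have hm : (t - ‖q.2‖, q.1 + q.2) ∈ U1 τ := rp_mem (z := (q.2, q.1)) ht hq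
    refine (h1.comp continuousAt_snd).mul ?_
    exact (hw.continuousAt ((U1_open τ).mem_nhds hm)).comp
      (f := fun q : E3 × E3 => (t - ‖q.2‖, q.1 + q.2)) (by fun_prop)
  · obtain ⟨h1, a, b, ha, hb, h0⟩ := hP
    have : ∀ᶠ y in 𝓝 q.2, P y = 0 := by
      simp only [Oy, mem_ofPred_eq, not_and_or, not_not, not_lt] at hq
      rcases hq with hq | hq
      · have : ‖q.2‖ < a := by rw [hq, norm_zero]; exact ha
        filter_upwards [(isOpen_lt continuous_norm continuous_const).mem_nhds this] with z hz
        exact h0 z (Or.inl hz)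
      · filter_upwards [(isOpen_lt continuous_const continuous_norm).mem_nhds (hb.trans_le hq)]
          with z hz
        exact h0 z (Or.inr hz)
    have h2 : (fun q : E3 × E3 => P q.2 * w (t - ‖q.2‖, q.1 + q.2)) =ᶠ[𝓝 q] fun _ => 0 := by
      filter_upwards [continuousAt_snd.eventually this] with y hy
      simp [hy]
    exact (continuousAt_const (y := (0 : ℝ))).congr h2.symm

lemma sy_supp {t : ℝ} {P : E3 → ℝ} (hP : AP t P) :
    ∃ K : Set E3, IsCompact K ∧ ∀ y ∉ K, P y = 0 := by
  obtain ⟨h1, a, b, ha, hb, h0⟩ := hP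
  refine ⟨closedBall 0 b, isCompact_closedBall _ _, fun y hy => h0 y (Or.inr ?_)⟩
  simpa using hy

lemma sy_cont {t τ : ℝ} (ht : t ≤ τ) {P : E3 → ℝ} {w : ℝ × E3 → ℝ} (hP : AP t P)
    (hw : ContinuousOn w (U1 τ)) : Continuous fun x => sy t x P w := by
  obtain ⟨K, hK, h0⟩ := sy_supp hP
  rw [← continuousOn_univ]
  exact continuousOn_integral_of_compact_support (f := fun x y => P y * w (t - ‖y‖, x + y)) hK
    (sy_cont2 ht hP hw).continuousOn fun p x _ hx => by simp [h0 x hx]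

lemma sy_int {t τ : ℝ} (ht : t ≤ τ) {P : E3 → ℝ} {w : ℝ × E3 → ℝ} (hP : AP t P)
    (hw : ContinuousOn w (U1 τ)) (x : E3) : Integrable fun y => P y * w (t - ‖y‖, x + y) := by
  obtain ⟨K, hK, h0⟩ := sy_supp hP
  refine Continuous.integrable_of_hasCompactSupport ?_
    (HasCompactSupport.intro hK fun y hy => by simp [h0 y hy])
  exact (sy_cont2 ht hP hw).comp (f := fun y => (x, y)) (by fun_prop)

lemma br_eq {t τ : ℝ} (ht : t ≤ τ) {P ψ : E3 → ℝ} {w : ℝ × E3 → ℝ} (hP : AP t P) (hψ : TF ψ)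
    (hw : ContinuousOn w (U1 τ)) : br t P ψ w = ∫ x, ψ x * sy t x P w := by
  unfold br
  have := integral_prod_symm (μ := (volume : Measure E3)) (ν := (volume : Measure E3)) _
    (br_int ht hP hψ hw)
  rw [← Measure.volume_eq_prod] at this
  rw [this]
  congr 1; ext x
  rw [sy, ← integral_const_mul]
  congr 1; ext y
  simp only [rp]; ring

lemma TF.int_mul {ψ : E3 → ℝ} (hψ : TF ψ) {G : E3 → ℝ} (hG : Continuous G) :
    Integrable fun x => ψ x * G x :=
  (hψ.1.continuous.mul hG).integrable_of_hasCompactSupport hψ.2.mul_right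

lemma kirch {t τ : ℝ} (ht : t ≤ τ) {w b ρ : ℝ × E3 → ℝ} {a c d : Fin 3 → ℝ × E3 → ℝ}
    (i : Fin 3)
    (hw : ContDiffOn ℝ 1 w (U1 τ)) (hb : ContDiffOn ℝ 1 b (U1 τ)) (hρ : ContDiffOn ℝ 1 ρ (U1 τ))
    (ha : ∀ k, ContDiffOn ℝ 1 (a k) (U1 τ)) (hc : ∀ k, ContDiffOn ℝ 1 (c k) (U1 τ))
    (hd : ∀ k, ContDiffOn ℝ 1 (d k) (U1 τ))
    (e1 : ∀ p ∈ U1 τ, b p = d0 w p - ∑ k, d1 k (a k) p)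
    (e2 : ∀ k, ∀ p ∈ U1 τ, d k p = d0 (a k) p - d1 k w p + d1 i (c k) p)
    (e3' : ∀ p ∈ U1 τ, ρ p = ∑ k, d1 k (c k) p)
    {χ : ℝ → ℝ} (hχ : RC t χ) (x : E3) :
    sy t x (pr χ 1) (d1 i ρ) - ∑ k, sy t x (pr χ 1) (d1 k (d k)) - sy t x (pr χ 1) (d0 b)
      = - ((∑ k, sy t x (fun y => pr (deriv χ) 1 y * om k y) (d1 k w))
        + sy t x (pr (deriv χ) 1) (d0 w) + sy t x (pr (deriv χ) 2) w) := by
  have h1 := pr_ap hχ 1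
  have k1 := pr_ap hχ.deriv 1
  have k2 := pr_ap hχ.deriv 2
  have c1 := sy_cont ht h1 (d1_cont hρ i)
  have c2 := fun k => sy_cont ht h1 (d1_cont (hd k) k)
  have c3 := sy_cont ht h1 (d0_cont hb)
  have c4 := fun k => sy_cont ht (k1.mulom k) (d1_cont hw k)
  have c5 := sy_cont ht k1 (d0_cont hw)
  have c6 := sy_cont ht k2 hw.continuousOn
  let G : E3 → ℝ := fun x =>
    sy t x (pr χ 1) (d1 i ρ) - ∑ k, sy t x (pr χ 1) (d1 k (d k)) - sy t x (pr χ 1) (d0 b)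
      + ((∑ k, sy t x (fun y => pr (deriv χ) 1 y * om k y) (d1 k w))
        + sy t x (pr (deriv χ) 1) (d0 w) + sy t x (pr (deriv χ) 2) w)
  have hG : Continuous G := by
    refine ((c1.sub (continuous_finsetSum _ fun k _ => c2 k)).sub c3).add
      (((continuous_finsetSum _ fun k _ => c4 k).add c5).add c6)
  have hz : ∀ ψ : E3 → ℝ, ContDiff ℝ ∞ ψ → HasCompactSupport ψ → ∫ x, ψ x • G x = 0 := by
    intro ψ s1 s2
    have hψ : TF ψ := ⟨s1, s2⟩
    have key := kirch_weak2 ht i hw hb hρ ha hc hd e1 e2 e3' hχ hψ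
    rw [br_eq ht h1 hψ (d1_cont hρ i), br_eq ht h1 hψ (d0_cont hb),
      Finset.sum_congr rfl fun k _ => br_eq ht h1 hψ (d1_cont (hd k) k),
      Finset.sum_congr rfl fun k _ => br_eq ht (k1.mulom k) hψ (d1_cont hw k),
      br_eq ht k1 hψ (d0_cont hw), br_eq ht k2 hψ hw.continuousOn] at key
    have : ∀ x, ψ x • G x = (ψ x * sy t x (pr χ 1) (d1 i ρ)
        - ∑ k, ψ x * sy t x (pr χ 1) (d1 k (d k)) - ψ x * sy t x (pr χ 1) (d0 b))
      + ((∑ k, ψ x * sy t x (fun y => pr (deriv χ) 1 y * om k y) (d1 k w))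
        + ψ x * sy t x (pr (deriv χ) 1) (d0 w) + ψ x * sy t x (pr (deriv χ) 2) w) := by
      intro x
      simp only [G, smul_eq_mul, ← Finset.mul_sum]; ring
    simp only [this]
    have i1 := hψ.int_mul c1
    have i2 := fun k => hψ.int_mul (c2 k)
    have i3 := hψ.int_mul c3
    have i4 := fun k => hψ.int_mul (c4 k)
    have i5 := hψ.int_mul c5
    have i6 := hψ.int_mul c6
    have j2 := integrable_finsetSum (Finset.univ : Finset (Fin 3)) fun k _ => i2 k
    have j4 := integrable_finsetSum (Finset.univ : Finset (Fin 3)) fun k _ => i4 k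
    rw [integral_add (by exact (i1.sub j2).sub i3) (by exact (j4.add i5).add i6),
      integral_sub (by exact i1.sub j2) i3,
      integral_sub i1 j2, integral_add (by exact j4.add i5) i6, integral_add j4 i5,
      integral_finsetSum _ fun k _ => i2 k, integral_finsetSum _ fun k _ => i4 k]
    linarith
  have h0 := ae_eq_zero_of_integral_contDiff_smul_eq_zero hG.locallyIntegrable hz
  have h00 : G = fun _ => 0 := (Continuous.ae_eq_iff_eq volume hG continuous_const).1 h0
  have := congrFun h00 x
  simp only [G] at this
  linarith

def P0 : Set Z3 := {z | z.1 ≠ 0}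
lemma P0_open : IsOpen P0 := isOpen_ne_fun continuous_fst continuous_const
lemma Om_P0 (t : ℝ) : Om t ⊆ P0 := fun _ h => h.1
/-- smooth kernels, homogeneous of degree `-m` in the first variable -/
def Hm (m : ℕ) (H : Z3 → ℝ) : Prop :=
  ContDiffOn ℝ ∞ H P0 ∧ ∀ l : ℝ, 0 < l → ∀ z ∈ P0, H (l • z.1, z.2) = (l ^ m)⁻¹ * H z
def Ker (m : ℕ) (R : ℝ) (H : Z3 → ℝ) : Prop := Hm m H ∧ ∀ z : Z3, R < ‖z.2‖ → H z = 0

lemma Hm.mul {m n : ℕ} {A B : Z3 → ℝ} (hA : Hm m A) (hB : Hm n B) :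
    Hm (m + n) fun z => A z * B z := by
  refine ⟨hA.1.mul hB.1, fun l hl z hz => ?_⟩
  beta_reduce; rw [hA.2 l hl z hz, hB.2 l hl z hz, pow_add, mul_inv]; ring
lemma Hm.add {m : ℕ} {A B : Z3 → ℝ} (hA : Hm m A) (hB : Hm m B) :
    Hm m fun z => A z + B z := by
  refine ⟨hA.1.add hB.1, fun l hl z hz => ?_⟩
  beta_reduce; rw [hA.2 l hl z hz, hB.2 l hl z hz]; ring
lemma Hm.sub {m : ℕ} {A B : Z3 → ℝ} (hA : Hm m A) (hB : Hm m B) :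
    Hm m fun z => A z - B z := by
  refine ⟨hA.1.sub hB.1, fun l hl z hz => ?_⟩
  beta_reduce; rw [hA.2 l hl z hz, hB.2 l hl z hz]; ring
lemma Hm.sum {m : ℕ} {A : Fin 3 → Z3 → ℝ} (hA : ∀ k, Hm m (A k)) :
    Hm m fun z => ∑ k, A k z := by
  refine ⟨ContDiffOn.sum fun k _ => (hA k).1, fun l hl z hz => ?_⟩
  rw [Finset.mul_sum]
  exact Finset.sum_congr rfl fun k _ => (hA k).2 l hl z hz
lemma Hm.mul0 {m : ℕ} {A B : Z3 → ℝ} (hA : Hm 0 A) (hB : Hm m B) : Hm m fun z => A z * B z := by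
  have := hA.mul hB; rwa [zero_add] at this

lemma Hm.diff {m : ℕ} {A : Z3 → ℝ} (hA : Hm m A) {z : Z3} (hz : z ∈ P0) :
    DifferentiableAt ℝ A z :=
  (hA.1.contDiffAt (P0_open.mem_nhds hz)).differentiableAt (by simp)

lemma Hm.fd {m : ℕ} {A : Z3 → ℝ} (hA : Hm m A) {l : ℝ} (hl : 0 < l) {z : Z3} (hz : z ∈ P0)
    (v : Z3) : fderiv ℝ A (l • z.1, z.2) (l • v.1, v.2) = (l ^ m)⁻¹ * fderiv ℝ A z v := by
  let L : Z3 →L[ℝ] Z3 := (l • ContinuousLinearMap.fst ℝ E3 E3).prod (ContinuousLinearMap.snd ℝ E3 E3)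
  have hLz : L z = (l • z.1, z.2) := rfl
  have hz' : L z ∈ P0 := by
    rw [hLz]; exact smul_ne_zero hl.ne' hz
  have h1 : HasFDerivAt (fun z => A (L z)) ((fderiv ℝ A (L z)).comp L) z :=
    (hA.diff hz').hasFDerivAt.comp z L.hasFDerivAt
  have h2 : HasFDerivAt (fun z => (l ^ m)⁻¹ * A z) ((l ^ m)⁻¹ • fderiv ℝ A z) z :=
    (hA.diff hz).hasFDerivAt.const_mul _
  have h3 : (fun z => A (L z)) =ᶠ[𝓝 z] fun z => (l ^ m)⁻¹ * A z := by
    filter_upwards [P0_open.mem_nhds hz] with y hy using hA.2 l hl y hy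
  have := (h1.congr_of_eventuallyEq h3.symm).unique h2
  have := congrArg (fun T => T v) this
  simpa [L] using this

lemma Hm.cdf {m : ℕ} {A : Z3 → ℝ} (hA : Hm m A) (v : Z3) :
    ContDiffOn ℝ ∞ (fun z => fderiv ℝ A z v) P0 :=
  (hA.1.fderiv_of_isOpen P0_open (m := ∞) (by simp)).clm_apply contDiffOn_const

lemma Hm.dy {m : ℕ} {A : Z3 → ℝ} (hA : Hm m A) (k : Fin 3) :
    Hm (m + 1) fun z => fderiv ℝ A z (e3 k, 0) := by
  refine ⟨hA.cdf _, fun l hl z hz => ?_⟩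
  have h := hA.fd hl hz (e3 k, 0)
  have e : ((l • e3 k, 0) : Z3) = l • (e3 k, 0) := by ext <;> simp
  simp only [e, map_smul, smul_eq_mul] at h
  rw [pow_succ, mul_inv]
  field_simp at h ⊢
  linarith
lemma Hm.dxi {m : ℕ} {A : Z3 → ℝ} (hA : Hm m A) (k : Fin 3) :
    Hm m fun z => fderiv ℝ A z (0, e3 k) := by
  refine ⟨hA.cdf _, fun l hl z hz => ?_⟩
  have h := hA.fd hl hz (0, e3 k)
  simpa using h

lemma Ker.fd0 {R : ℝ} {A : Z3 → ℝ} (h : ∀ z : Z3, R < ‖z.2‖ → A z = 0) {z : Z3}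
    (hz : R < ‖z.2‖) : fderiv ℝ A z = 0 := by
  have : A =ᶠ[𝓝 z] fun _ => 0 := by
    filter_upwards [(isOpen_lt continuous_const (continuous_snd.norm)).mem_nhds hz] with y hy
    exact h y hy
  rw [this.fderiv_eq]; simp
lemma Ker.dy {m : ℕ} {R : ℝ} {A : Z3 → ℝ} (hA : Ker m R A) (k : Fin 3) :
    Ker (m + 1) R fun z => fderiv ℝ A z (e3 k, 0) :=
  ⟨hA.1.dy k, fun z hz => by simp [Ker.fd0 hA.2 hz]⟩
lemma Ker.dxi {m : ℕ} {R : ℝ} {A : Z3 → ℝ} (hA : Ker m R A) (k : Fin 3) :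
    Ker m R fun z => fderiv ℝ A z (0, e3 k) :=
  ⟨hA.1.dxi k, fun z hz => by simp [Ker.fd0 hA.2 hz]⟩
lemma Ker.sum {m : ℕ} {R : ℝ} {A : Fin 3 → Z3 → ℝ} (hA : ∀ k, Ker m R (A k)) :
    Ker m R fun z => ∑ k, A k z :=
  ⟨Hm.sum fun k => (hA k).1, fun z hz => Finset.sum_eq_zero fun k _ => (hA k).2 z hz⟩
lemma Ker.mul0 {m : ℕ} {R : ℝ} {A B : Z3 → ℝ} (hA : Hm 0 A) (hB : Ker m R B) :
    Ker m R fun z => A z * B z := ⟨hA.mul0 hB.1, fun z hz => by simp [hB.2 z hz]⟩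
lemma Ker.zero (m : ℕ) (R : ℝ) : Ker m R fun _ => 0 :=
  ⟨⟨contDiffOn_const, fun _ _ _ _ => by simp⟩, fun _ _ => rfl⟩

lemma Ker.bound {m : ℕ} {R : ℝ} {A : Z3 → ℝ} (hA : Ker m R A) :
    ∃ C, 0 ≤ C ∧ ∀ z ∈ P0, |A z| ≤ C * (‖z.1‖ ^ m)⁻¹ := by
  have hc : IsCompact (sphere (0 : E3) 1 ×ˢ closedBall (0 : E3) R) :=
    (isCompact_sphere _ _).prod (isCompact_closedBall _ _)
  have hs : sphere (0 : E3) 1 ×ˢ closedBall (0 : E3) R ⊆ P0 := fun z hz => by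
    have : ‖z.1‖ = 1 := by simpa using hz.1
    exact fun h => by simp [h] at this
  obtain ⟨C, hC⟩ := hc.exists_bound_of_continuousOn (hA.1.1.continuousOn.mono hs)
  refine ⟨max C 0, le_max_right _ _, fun z hz => ?_⟩
  have hn : 0 < ‖z.1‖ := norm_pos_iff.2 hz
  rcases lt_or_ge R ‖z.2‖ with h | h
  · rw [hA.2 z h, abs_zero]; positivity
  have e := hA.1.2 ‖z.1‖ hn (‖z.1‖⁻¹ • z.1, z.2) (smul_ne_zero (inv_ne_zero hn.ne') hz)
  simp only [smul_smul, mul_inv_cancel₀ hn.ne', one_smul] at e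
  rw [e, abs_mul, abs_of_nonneg (by positivity), mul_comm]
  gcongr
  refine (hC _ ⟨?_, ?_⟩).trans (le_max_left _ _)
  · simp [norm_smul, hn.ne']
  · simpa using h

lemma vrel_apply (ξ : E3) (k : Fin 3) : vrel ξ k = (√(1 + ‖ξ‖ ^ 2))⁻¹ * ξ k := by
  simp [vrel]
lemma vrel_cd {n : WithTop ℕ∞} (k : Fin 3) : ContDiff ℝ n fun ξ => vrel ξ k := by
  simp only [vrel_apply]
  refine ContDiff.mul (ContDiff.inv (ContDiff.sqrt ?_ fun x => by positivity)
    fun x => by positivity) (contDiff_coord k)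
  exact contDiff_const.add (contDiff_norm_sq ℝ)
lemma vrel_lt (ξ : E3) : ‖vrel ξ‖ < 1 := by
  rw [vrel, norm_smul, norm_inv, Real.norm_of_nonneg (by positivity), inv_mul_lt_one₀ (by positivity)]
  exact Real.lt_sqrt_of_sq_lt (by linarith)

lemma beta_pos (z : Z3) : 0 < 1 + ∑ k, vrel z.2 k * om k z.1 := by
  have : ∑ k, vrel z.2 k * om k z.1 = inner ℝ (vrel z.2) z.1 / ‖z.1‖ := by
    simp only [PiLp.inner_apply, om, Finset.sum_div]
    refine Finset.sum_congr rfl fun k _ => ?_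
    simp; ring
  rw [this]
  by_cases h : z.1 = 0
  · simp [h]
  have hn : 0 < ‖z.1‖ := norm_pos_iff.2 h
  have h1 := abs_real_inner_le_norm (vrel z.2) z.1
  have h2 := vrel_lt z.2
  have : -1 < inner ℝ (vrel z.2) z.1 / ‖z.1‖ := by
    rw [lt_div_iff₀ hn]
    have := (abs_le.1 h1).1
    nlinarith
  linarith

def bet (z : Z3) : ℝ := (1 + ∑ k, vrel z.2 k * om k z.1)⁻¹

lemma om_hm (k : Fin 3) : Hm 0 fun z => om k z.1 := by
  refine ⟨fun z hz => ((contDiffAt_om k hz).comp z contDiffAt_fst).contDiffWithinAt,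
    fun l hl z hz => ?_⟩
  simp only [om, norm_smul, Real.norm_of_nonneg hl.le, PiLp.smul_apply, smul_eq_mul]
  have : ‖z.1‖ ≠ 0 := norm_ne_zero_iff.2 hz
  field_simp
lemma xi_hm {c : E3 → ℝ} (hc : ContDiff ℝ ∞ c) : Hm 0 fun z => c z.2 :=
  ⟨(hc.comp contDiff_snd).contDiffOn, fun l hl z hz => by simp⟩
lemma bet_hm : Hm 0 bet := by
  have h := Hm.sum fun k => (xi_hm (vrel_cd k)).mul0 (om_hm k)
  refine ⟨(contDiffOn_const.add h.1).inv fun z _ => (beta_pos z).ne', fun l hl z hz => ?_⟩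
  have := h.2 l hl z hz
  simp only [bet]
  simp only [pow_zero, inv_one, one_mul] at this ⊢
  rw [this]
lemma inv_hm (n : ℕ) : Hm n fun z => (‖z.1‖ ^ n)⁻¹ := by
  refine ⟨fun z hz => ?_, fun l hl z hz => ?_⟩
  · exact (((contDiffAt_norm ℝ hz).comp z contDiffAt_fst).pow n).inv
      (pow_ne_zero _ (norm_ne_zero_iff.2 hz)) |>.contDiffWithinAt
  · simp [norm_smul, abs_of_pos hl, mul_pow, mul_comm]

def Nk (H0 : Z3 → ℝ) (H : Fin 3 → Z3 → ℝ) (z : Z3) : ℝ := bet z * (H0 z + ∑ k, om k z.1 * H k z)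
def Qk (H0 : Z3 → ℝ) (H : Fin 3 → Z3 → ℝ) (k : Fin 3) (z : Z3) : ℝ :=
  vrel z.2 k * Nk H0 H z - H k z

lemma Nk_ker {m : ℕ} {R : ℝ} {H0 : Z3 → ℝ} {H : Fin 3 → Z3 → ℝ} (h0 : Ker m R H0)
    (h : ∀ k, Ker m R (H k)) : Ker m R (Nk H0 H) := by
  refine Ker.mul0 bet_hm ?_
  have := Ker.sum fun k => Ker.mul0 (om_hm k) (h k)
  exact ⟨h0.1.add this.1, fun z hz => by have := this.2 z hz; simp_all [h0.2 z hz]⟩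
lemma Qk_ker {m : ℕ} {R : ℝ} {H0 : Z3 → ℝ} {H : Fin 3 → Z3 → ℝ} (h0 : Ker m R H0)
    (h : ∀ k, Ker m R (H k)) (k : Fin 3) : Ker m R (Qk H0 H k) := by
  have := Ker.mul0 (xi_hm (vrel_cd k)) (Nk_ker h0 h)
  exact ⟨this.1.sub (h k).1, fun z hz => by
    have := this.2 z hz; simp_all [Qk, (h k).2 z hz]⟩

lemma Ker.adm {t : ℝ} {m : ℕ} {R : ℝ} {H q : Z3 → ℝ} {φ : ℝ → ℝ} (h : Ker m R H) (hφ : RC t φ)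
    {n : WithTop ℕ∞} (hn : n ≤ (⊤ : ℕ∞)) (hq : ContDiffOn ℝ n q (Om t)) :
    Adm n t fun z => φ ‖z.1‖ * q z * H z := by
  obtain ⟨h1, a, b, ha, hb, h0⟩ := hφ
  refine ⟨((?_ : ContDiffOn ℝ n _ (Om t)).mul hq).mul ((h.1.1.mono (Om_P0 t)).of_le hn),
    a, b, R, ha, hb, ?_⟩
  · intro z hz
    have : ContDiffAt ℝ n φ ‖z.1‖ :=
      (h1.contDiffAt (Ioi_mem_nhds (norm_pos_iff.2 hz.1))).of_le hn
    exact (this.comp z ((contDiffAt_norm ℝ hz.1).comp z contDiffAt_fst)).contDiffWithinAt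
  · intro z hz
    simp only [Cs, mem_ofPred_eq, not_and_or, not_le] at hz
    rcases hz with hz | hz | hz
    · simp [h0 _ (Or.inl hz)]
    · simp [h0 _ (Or.inr hz)]
    · simp [h.2 z hz]

lemma division {t τ : ℝ} (ht : t ≤ τ) (x : E3) {g : ℝ × E3 × E3 → ℝ}
    {K : Fin 3 → ℝ × E3 × E3 → ℝ} (hg : ContDiffOn ℝ 1 g (UU τ))
    (hK : ∀ l, ContDiffOn ℝ 1 (K l) (UU τ))
    (hV : ∀ p ∈ UU τ, dT g p + ∑ k, vrel p.2.2 k * dX k g p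
      = - ∑ l, dV l (fun q => K l q * g q) p)
    {m : ℕ} {R : ℝ} {H0 q : Z3 → ℝ} {H : Fin 3 → Z3 → ℝ} (h0 : Ker m R H0)
    (h : ∀ k, Ker m R (H k)) {φ : ℝ → ℝ} (hφ : RC t φ) (hq : ContDiffOn ℝ 1 q (Om t)) :
    ∫ z, φ ‖z.1‖ * q z * (H0 z * ret t x (dT g) z + ∑ k, H k z * ret t x (dX k g) z)
    = (∑ k, ∫ z, fderiv ℝ (fun z => φ ‖z.1‖ * q z * Qk H0 H k z) z (e3 k, 0) * ret t x g z)
    + ∑ l, ∫ z, fderiv ℝ (fun z => φ ‖z.1‖ * q z * Nk H0 H z) z (0, e3 l)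
        * ret t x (fun p => K l p * g p) z := by
  have aQ := fun k => (Qk_ker h0 h k).adm hφ (n := 1) (by simp) hq
  have aN := (Nk_ker h0 h).adm hφ (n := 1) (by simp) hq
  have hKg := fun l => (hK l).mul hg
  have i1 := fun k => (aQ k).ibp (ret_cd ht x hg) (e3 k, 0)
  have i2 := fun l => aN.ibp (ret_cd ht x (hKg l)) (0, e3 l)
  have e1 := fun k => neg_eq_iff_eq_neg.2 (i1 k)
  have e2 := fun l => neg_eq_iff_eq_neg.2 (i2 l)
  have j1 := fun k => ((aQ k).mono (m := 0) (by simp)).integrable_mul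
    (cd_fderiv_cont (Om_open t) (ret_cd ht x hg) (e3 k, 0))
  have j2 := fun l => (aN.mono (m := 0) (by simp)).integrable_mul
    (cd_fderiv_cont (Om_open t) (ret_cd ht x (hKg l)) (0, e3 l))
  rw [Finset.sum_congr rfl fun k _ => (e1 k).symm]
  conv_rhs => rw [Finset.sum_congr rfl fun l _ => (e2 l).symm]
  rw [Finset.sum_neg_distrib, Finset.sum_neg_distrib,
    ← integral_finsetSum _ fun k _ => j1 k, ← integral_finsetSum _ fun k _ => j2 k,
    ← integral_neg, ← integral_neg, ← integral_add
      (by exact (integrable_finsetSum _ fun k _ => j1 k).neg)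
      (by exact (integrable_finsetSum _ fun k _ => j2 k).neg)]
  congr 1; ext z
  by_cases hz : z ∈ Om t
  · have r1 := fun k => ret_dy ht x hg hz k
    have r2 := fun l => ret_dxi ht x (hKg l) hz l
    have rV := hV _ (ret_mem ht x hz)
    simp only [r1]
    have r2' : ∀ l, fderiv ℝ (ret t x fun p => K l p * g p) z (0, e3 l)
        = ret t x (dV l fun p => K l p * g p) z := r2
    simp only [r2']
    have rV' : ret t x (dT g) z + ∑ k, vrel z.2 k * ret t x (dX k g) z
      = - ∑ l, ret t x (dV l fun p => K l p * g p) z := rV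
    have hb : bet z * (1 + ∑ k, vrel z.2 k * om k z.1) = 1 := inv_mul_cancel₀ (beta_pos z).ne'
    simp only [Qk, Nk, Fin.sum_univ_three] at rV' hb ⊢
    generalize bet z = b at *
    generalize ret t x (dT g) z = T at *
    generalize φ ‖z.1‖ * q z = A at *
    generalize H0 z = w0
    linear_combination (A * b * (w0 + (om 0 z.1 * H 0 z + om 1 z.1 * H 1 z + om 2 z.1 * H 2 z))) * rV'
      - A * T * (w0 + (om 0 z.1 * H 0 z + om 1 z.1 * H 1 z + om 2 z.1 * H 2 z)) * hb
  · have hz2 : φ ‖z.1‖ * q z = 0 ∨ (∀ k, H k z = 0) ∧ H0 z = 0 := by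
      obtain ⟨-, a, b, ha, hb, hz0⟩ := hφ
      left
      rw [hz0]; · simp
      simp only [Om, mem_ofPred_eq, not_and_or, not_not, not_lt] at hz
      rcases hz with hz | hz
      · left; rw [hz]; simpa using ha
      · right; linarith
    rcases hz2 with hz2 | ⟨a1, a2⟩
    · simp [hz2]
    · simp [a1, a2, Qk, Nk]

lemma fd_prod {t : ℝ} {φ : ℝ → ℝ} (hφ : RC t φ) {q Q : Z3 → ℝ} {m : ℕ}
    (hq : ContDiffOn ℝ 1 q (Om t)) (hQ : Hm m Q) {z : Z3} (hz : z ∈ Om t) (v : Z3) :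
    fderiv ℝ (fun z => φ ‖z.1‖ * q z * Q z) z v
      = deriv φ ‖z.1‖ * (‖z.1‖⁻¹ * inner ℝ z.1 v.1) * q z * Q z
        + φ ‖z.1‖ * fderiv ℝ q z v * Q z + φ ‖z.1‖ * q z * fderiv ℝ Q z v := by
  have h1 : HasFDerivAt (fun z : Z3 => φ ‖z.1‖)
      (deriv φ ‖z.1‖ • ((‖z.1‖⁻¹ • innerSL ℝ z.1).comp (ContinuousLinearMap.fst ℝ E3 E3))) z :=
    (hφ.hasDeriv hz.1).comp_hasFDerivAt (f := fun z : Z3 => ‖z.1‖) z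
      ((hasFDerivAt_norm' hz.1).comp z hasFDerivAt_fst)
  have h2 := cd_diff (Om_open t) hq hz
  have h3 := (hQ.diff (Om_P0 t hz)).hasFDerivAt
  rw [((h1.fun_mul h2).fun_mul h3).fderiv]
  simp
  ring
lemma fd_prod_y {t : ℝ} {φ : ℝ → ℝ} (hφ : RC t φ) {q Q : Z3 → ℝ} {m : ℕ}
    (hq : ContDiffOn ℝ 1 q (Om t)) (hQ : Hm m Q) {z : Z3} (hz : z ∈ Om t) (k : Fin 3) :
    fderiv ℝ (fun z => φ ‖z.1‖ * q z * Q z) z (e3 k, 0)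
      = deriv φ ‖z.1‖ * om k z.1 * q z * Q z
        + φ ‖z.1‖ * fderiv ℝ q z (e3 k, 0) * Q z
        + φ ‖z.1‖ * q z * fderiv ℝ Q z (e3 k, 0) := by
  rw [fd_prod hφ hq hQ hz, inner_e3, om, div_eq_inv_mul]
lemma fd_prod_xi {t : ℝ} {φ : ℝ → ℝ} (hφ : RC t φ) {q Q : Z3 → ℝ} {m : ℕ}
    (hq : ContDiffOn ℝ 1 q (Om t)) (hQ : Hm m Q) {z : Z3} (hz : z ∈ Om t) (k : Fin 3) :
    fderiv ℝ (fun z => φ ‖z.1‖ * q z * Q z) z (0, e3 k)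
      = φ ‖z.1‖ * fderiv ℝ q z (0, e3 k) * Q z
        + φ ‖z.1‖ * q z * fderiv ℝ Q z (0, e3 k) := by
  rw [fd_prod hφ hq hQ hz]; simp

lemma RC.off {t : ℝ} {φ : ℝ → ℝ} (hφ : RC t φ) {z : Z3} (hz : z ∉ Om t) : φ ‖z.1‖ = 0 := by
  obtain ⟨-, a, b, ha, hb, hz0⟩ := hφ
  apply hz0
  simp only [Om, mem_ofPred_eq, not_and_or, not_not, not_lt] at hz
  rcases hz with hz | hz
  · left; rw [hz]; simpa using ha
  · right; linarith

/-- boundary operator of Kirchhoff's formula -/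
def DD (χ : ℝ → ℝ) (w : ℝ × E3 → ℝ) (t : ℝ) (x : E3) : ℝ :=
  (∑ k, sy t x (fun y => pr (deriv χ) 1 y * om k y) (d1 k w))
        + sy t x (pr (deriv χ) 1) (d0 w) + sy t x (pr (deriv χ) 2) w

lemma sy_mom {t τ R : ℝ} (ht : t ≤ τ) (x : E3) {c : E3 → ℝ} (hc : ContDiff ℝ ∞ c)
    (hR : ∀ ξ, R < ‖ξ‖ → c ξ = 0) {χ : ℝ → ℝ} (hχ : RC t χ) {h : ℝ × E3 × E3 → ℝ}
    (hh : ContinuousOn h (UU τ)) :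
    Ker 1 R (fun z => c z.2 * (‖z.1‖ ^ 1)⁻¹) ∧
    Integrable (fun z : Z3 => χ ‖z.1‖ * 1 * (c z.2 * (‖z.1‖ ^ 1)⁻¹) * ret t x h z) ∧
    sy t x (pr χ 1) (mom c h)
      = ∫ z : Z3, χ ‖z.1‖ * 1 * (c z.2 * (‖z.1‖ ^ 1)⁻¹) * ret t x h z := by
  have hk : Ker 1 R (fun z => c z.2 * (‖z.1‖ ^ 1)⁻¹) :=
    ⟨(xi_hm hc).mul0 (inv_hm 1), fun z hz => by simp [hR z.2 hz]⟩
  have hi := ((hk.adm hχ (n := 0) (by simp) (q := fun _ => 1) contDiffOn_const)).integrable_mul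
    (ret_cont ht x hh)
  refine ⟨hk, hi, ?_⟩
  rw [Measure.volume_eq_prod, integral_prod _ (by exact hi)]
  simp only [sy, mom, pr, ret]
  congr 1; ext y
  rw [← integral_const_mul]
  congr 1; ext ξ; ring

/-- first order representation of a field component -/
def FRep (τ : ℝ) (g : ℝ × E3 × E3 → ℝ) (K : Fin 3 → ℝ × E3 × E3 → ℝ) (w : ℝ × E3 → ℝ)
    (R : ℝ) (A1 A2 : Z3 → ℝ) (W : Fin 3 → Z3 → ℝ) : Prop :=
  ∀ t ≤ τ, ∀ χ, RC t χ → ∀ x, - DD χ w t x = (∫ z, deriv χ ‖z.1‖ * A1 z * ret t x g z)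
    + (∫ z, χ ‖z.1‖ * A2 z * ret t x g z)
    + ∑ l, ∫ z, χ ‖z.1‖ * W l z * ret t x (fun p => K l p * g p) z

lemma rep {τ R : ℝ} {g : ℝ × E3 × E3 → ℝ}
    {K : Fin 3 → ℝ × E3 × E3 → ℝ} (hg : ContDiffOn ℝ 1 g (UU τ))
    (hK : ∀ l, ContDiffOn ℝ 1 (K l) (UU τ))
    (hV : ∀ p ∈ UU τ, dT g p + ∑ k, vrel p.2.2 k * dX k g p
      = - ∑ l, dV l (fun q => K l q * g q) p)
    (hg0 : ∀ p ∈ UU τ, R < ‖p.2.2‖ → g p = 0)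
    {w : ℝ × E3 → ℝ} {a c : Fin 3 → ℝ × E3 → ℝ} {cb cρ : E3 → ℝ} {cd : Fin 3 → E3 → ℝ}
    (i : Fin 3) (hw : ContDiffOn ℝ 1 w (U1 τ))
    (ha : ∀ k, ContDiffOn ℝ 1 (a k) (U1 τ)) (hc : ∀ k, ContDiffOn ℝ 1 (c k) (U1 τ))
    (sb : ContDiff ℝ ∞ cb) (sρ : ContDiff ℝ ∞ cρ) (sd : ∀ k, ContDiff ℝ ∞ (cd k))
    (zb : ∀ ξ, R < ‖ξ‖ → cb ξ = 0) (zρ : ∀ ξ, R < ‖ξ‖ → cρ ξ = 0)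
    (zd : ∀ k ξ, R < ‖ξ‖ → cd k ξ = 0)
    (e1 : ∀ p ∈ U1 τ, mom cb g p = d0 w p - ∑ k, d1 k (a k) p)
    (e2 : ∀ k, ∀ p ∈ U1 τ, mom (cd k) g p = d0 (a k) p - d1 k w p + d1 i (c k) p)
    (e3' : ∀ p ∈ U1 τ, mom cρ g p = ∑ k, d1 k (c k) p) :
    ∃ A1 A2 W, Ker 1 R A1 ∧ Ker 2 R A2 ∧ (∀ l, Ker 1 R (W l)) ∧ FRep τ g K w R A1 A2 W := by
  let H0 : Z3 → ℝ := fun z => -cb z.2 * (‖z.1‖ ^ 1)⁻¹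
  let H : Fin 3 → Z3 → ℝ := fun k z => ((if k = i then cρ z.2 else 0) - cd k z.2) * (‖z.1‖ ^ 1)⁻¹
  have kk : ∀ c : E3 → ℝ, ContDiff ℝ ∞ c → (∀ ξ, R < ‖ξ‖ → c ξ = 0) →
      Ker 1 R (fun z => c z.2 * (‖z.1‖ ^ 1)⁻¹) := fun c hc hR =>
    ⟨(xi_hm hc).mul0 (inv_hm 1), fun z hz => by simp [hR z.2 hz]⟩
  have k0 : Ker 1 R H0 := kk (fun ξ => -cb ξ) sb.neg fun ξ h => by simp [zb ξ h]
  have kH : ∀ k, Ker 1 R (H k) := fun k => kk (fun ξ => (if k = i then cρ ξ else 0) - cd k ξ)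
    (by split_ifs; exacts [sρ.sub (sd k), contDiff_const.sub (sd k)])
    fun ξ h => by simp [zρ ξ h, zd k ξ h]
  have kQ := Qk_ker k0 kH
  have kN := Nk_ker k0 kH
  refine ⟨fun z => ∑ k, om k z.1 * Qk H0 H k z, fun z => ∑ k, fderiv ℝ (Qk H0 H k) z (e3 k, 0),
    fun l z => fderiv ℝ (Nk H0 H) z (0, e3 l), Ker.sum fun k => Ker.mul0 (om_hm k) (kQ k),
    Ker.sum fun k => (kQ k).dy k, fun l => kN.dxi l, ?_⟩
  intro t ht χ hχ x
  have mb := mom_cd sb.continuous hg hg0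
  have mρ := mom_cd sρ.continuous hg hg0
  have md := fun k => mom_cd (sd k).continuous hg hg0
  have key := kirch ht i hw mb.1 mρ.1 ha hc (fun k => (md k).1) e1 e2 e3' hχ x
  change _ = - DD χ w t x at key
  rw [← key]
  have cg : ∀ P : E3 → ℝ, AP t P → ∀ u v : ℝ × E3 → ℝ, (∀ p ∈ U1 τ, u p = v p) →
      sy t x P u = sy t x P v := by
    intro P hP u v huv
    simp only [sy]
    congr 1; ext y
    by_cases hy : y ∈ Oy t
    · rw [huv _ (rp_mem (z := (y, x)) ht hy)]
    · rw [hP.zero_off hy]; simp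
  have hp := pr_ap hχ 1
  rw [cg _ hp _ _ fun p hp => (mρ.2 p hp).2 i, cg _ hp _ _ fun p hp => (mb.2 p hp).1,
    Finset.sum_congr rfl fun k _ => cg _ hp _ _ fun p hp => ((md k).2 p hp).2 k]
  have cX := fun k => cd_fderiv_cont (UU_open τ) hg (0, e3 k, 0)
  have cT := cd_fderiv_cont (UU_open τ) hg (1, 0, 0)
  obtain ⟨-, I1, E1⟩ := sy_mom ht x sρ zρ hχ (cX i)
  obtain ⟨-, I2, E2⟩ := sy_mom ht x sb zb hχ cT
  have E3 := fun k => (sy_mom ht x (sd k) (zd k) hχ (cX k)).2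
  change sy t x (pr χ 1) (mom cρ (dX i g)) = _ at E1
  change sy t x (pr χ 1) (mom cb (dT g)) = _ at E2
  have E3' : ∀ k, sy t x (pr χ 1) (mom (cd k) (dX k g)) = _ := fun k => (E3 k).2
  rw [E1, E2, Finset.sum_congr rfl fun k _ => E3' k, ← integral_finsetSum _ fun k _ => (E3 k).1,
    ← integral_sub I1 (by exact integrable_finsetSum _ fun k _ => (E3 k).1),
    ← integral_sub (by exact I1.sub (integrable_finsetSum _ fun k _ => (E3 k).1)) I2]
  have dv := division ht x hg hK hV k0 kH hχ (q := fun _ => 1) contDiffOn_const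
  have cg1 := ret_cont ht x hg.continuousOn
  have J1 := fun k => ((kQ k).adm (n := 0) hχ.deriv (by simp) (q := fun z => 1 * om k z.1)
    (contDiffOn_const.mul ((((om_hm k).1.mono (Om_P0 t))).of_le (by simp)))).integrable_mul cg1
  have J2 := fun k => (((kQ k).dy k).adm (n := 0) hχ (by simp) (q := fun z => 1)
    contDiffOn_const).integrable_mul cg1
  refine Eq.trans ?_ (dv.trans (congrArg₂ (· + ·) ?_ ?_))
  · congr 1; ext z
    simp only [H0, H, sub_mul, ite_mul, zero_mul, Finset.sum_sub_distrib, Finset.sum_ite_eq',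
      Finset.mem_univ, if_true, ret, dX, dT, ← Finset.mul_sum, mul_assoc, mul_sub, mul_add]
    simp only [Finset.mul_sum]
    ring
  · have eA : ∀ k z, fderiv ℝ (fun z => χ ‖z.1‖ * 1 * Qk H0 H k z) z (e3 k, 0) * ret t x g z
        = deriv χ ‖z.1‖ * (1 * om k z.1) * Qk H0 H k z * ret t x g z
          + χ ‖z.1‖ * 1 * fderiv ℝ (Qk H0 H k) z (e3 k, 0) * ret t x g z := by
      intro k z
      by_cases hz : z ∈ Om t
      · rw [fd_prod_y hχ (q := fun _ => 1) contDiffOn_const (kQ k).1 hz k]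
        simp; ring
      · rw [((kQ k).adm hχ (n := 1) (by simp) (q := fun _ => 1)
          contDiffOn_const).fderiv1 (e3 k, 0) |>.zero_off hz, hχ.off hz, hχ.deriv.off hz]
        simp
    simp only [eA]
    rw [Finset.sum_congr rfl fun k _ => integral_add (J1 k) (J2 k), Finset.sum_add_distrib,
      ← integral_finsetSum _ fun k _ => J1 k, ← integral_finsetSum _ fun k _ => J2 k]
    congr 2 <;> ext z <;> simp only [Fin.sum_univ_three] <;> ring
  · refine Finset.sum_congr rfl fun l _ => ?_
    congr 1; ext z
    by_cases hz : z ∈ Om t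
    · rw [fd_prod_xi hχ (q := fun _ => 1) contDiffOn_const kN.1 hz l]
      simp
    · rw [(kN.adm hχ (n := 1) (by simp) (q := fun _ => 1)
          contDiffOn_const).fderiv1 (0, e3 l) |>.zero_off hz, hχ.off hz]
      simp

lemma maj_int {t : ℝ} {U : ℝ → ℝ} (hU : IntegrableOn U (Ioo 0 t)) :
    Integrable (fun y : E3 => (Ioo 0 t).indicator (fun r => U r * (r ^ 2)⁻¹) ‖y‖) ∧
    ∫ y : E3, (Ioo 0 t).indicator (fun r => U r * (r ^ 2)⁻¹) ‖y‖
      = s3 * ∫ r in Ioo 0 t, U r := by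
  have e : ∀ r : ℝ, r ^ 2 * (Ioo 0 t).indicator (fun r => U r * (r ^ 2)⁻¹) r
      = (Ioo 0 t).indicator U r := by
    intro r
    by_cases h : r ∈ Ioo 0 t
    · have := h.1.ne'
      simp only [indicator_of_mem h]; field_simp
    · simp [indicator_of_notMem h]
  constructor
  · rw [integrable_fun_norm_addHaar (μ := volume) (E := E3)
      (f := (Ioo 0 t).indicator (fun r => U r * (r ^ 2)⁻¹))]
    simp only [finrank_euclideanSpace, Fintype.card_fin, smul_eq_mul]
    simp only [show 3 - 1 = 2 from rfl, e]
    exact ((integrable_indicator_iff measurableSet_Ioo).2 hU).integrableOn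
  · rw [radial (fun r => (Ioo 0 t).indicator (fun r => U r * (r ^ 2)⁻¹) r)]
    simp only [e]
    rw [setIntegral_indicator measurableSet_Ioo, inter_eq_right.2 fun r hr => hr.1]

lemma Yb {t : ℝ} {F : E3 → ℝ} {U : ℝ → ℝ} (hU : IntegrableOn U (Ioo 0 t))
    (hF : ∀ y ∈ Oy t, ‖y‖ ^ 2 * |F y| ≤ U ‖y‖) (h0 : ∀ y ∉ Oy t, F y = 0) :
    |∫ y, F y| ≤ s3 * ∫ r in Ioo 0 t, U r := by
  rw [← (maj_int hU).2]
  rw [← Real.norm_eq_abs]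
  refine norm_integral_le_of_norm_le (maj_int hU).1 (ae_of_all _ fun y => ?_)
  by_cases hy : y ∈ Oy t
  · have hn : 0 < ‖y‖ := norm_pos_iff.2 hy.1
    rw [indicator_of_mem (show ‖y‖ ∈ Ioo 0 t from ⟨hn, hy.2⟩), ← div_eq_mul_inv,
      le_div_iff₀ (by positivity), mul_comm]
    exact hF y hy
  · rw [h0 y hy, indicator_of_notMem]; · simp
    exact fun h => hy ⟨norm_pos_iff.1 h.1, h.2⟩

/-- constant of momentum volume -/
def bV (R : ℝ) : ℝ := s3 * (volume : Measure E3).real (closedBall 0 R)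
lemma bV_nonneg (R : ℝ) : 0 ≤ bV R := mul_nonneg s3_pos.le measureReal_nonneg

lemma Zb {t R : ℝ} {F : Z3 → ℝ} {U : ℝ → ℝ} (hU : IntegrableOn U (Ioo 0 t))
    (hF : ∀ z ∈ Om t, ‖z.1‖ ^ 2 * |F z| ≤ U ‖z.1‖) (h0 : ∀ z ∉ Om t, F z = 0)
    (hR : ∀ z, R < ‖z.2‖ → F z = 0) :
    |∫ z, F z| ≤ bV R * ∫ r in Ioo 0 t, U r := by
  have i2 : Integrable ((closedBall (0 : E3) R).indicator fun _ => (1 : ℝ)) :=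
    (integrable_indicator_iff isClosed_closedBall.measurableSet).2
      (integrableOn_const (by exact measure_closedBall_lt_top.ne))
  have hi := (maj_int hU).1.mul_prod i2
  have e := integral_prod_mul (μ := volume) (ν := volume)
    (fun y : E3 => (Ioo 0 t).indicator (fun r => U r * (r ^ 2)⁻¹) ‖y‖)
    ((closedBall (0 : E3) R).indicator fun _ => (1 : ℝ))
  rw [(maj_int hU).2, integral_indicator isClosed_closedBall.measurableSet] at e
  have e' : bV R * ∫ r in Ioo 0 t, U r = s3 * (∫ r in Ioo 0 t, U r)
      * ∫ x in closedBall (0 : E3) R, (1 : ℝ) := by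
    simp [bV]; ring
  rw [e', ← e, ← Real.norm_eq_abs, Measure.volume_eq_prod]
  refine norm_integral_le_of_norm_le hi (ae_of_all _ fun z => ?_)
  by_cases hz : z ∈ Om t
  · by_cases hzR : ‖z.2‖ ≤ R
    · have hn : 0 < ‖z.1‖ := norm_pos_iff.2 hz.1
      rw [indicator_of_mem (show ‖z.1‖ ∈ Ioo 0 t from ⟨hn, hz.2⟩), ← div_eq_mul_inv,
        indicator_of_mem (by simpa using hzR), mul_one,
        le_div_iff₀ (by positivity), mul_comm]
      exact hF z hz
    · rw [hR z (not_le.1 hzR), indicator_of_notMem (s := closedBall _ _) (by simpa using hzR)]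
      simp
  · rw [h0 z hz, indicator_of_notMem (s := Ioo 0 t)]; · simp
    exact fun h => hz ⟨norm_pos_iff.1 h.1, h.2⟩

/-- smooth step from `c` to `c + d` -/
def cu (c d r : ℝ) : ℝ := Real.smoothTransition ((r - c) / d)
lemma cu_cd (c d : ℝ) {n : ℕ∞} : ContDiff ℝ n (cu c d) :=
  Real.smoothTransition.contDiff.comp ((contDiff_id.sub contDiff_const).div_const d)
lemma cu_zero {c d r : ℝ} (hd : 0 < d) (h : r ≤ c) : cu c d r = 0 :=
  Real.smoothTransition.zero_of_nonpos (div_nonpos_of_nonpos_of_nonneg (by linarith) hd.le)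
lemma cu_one {c d r : ℝ} (hd : 0 < d) (h : c + d ≤ r) : cu c d r = 1 :=
  Real.smoothTransition.one_of_one_le ((one_le_div hd).2 (by linarith))
lemma cu_nn (c d r : ℝ) : 0 ≤ cu c d r := Real.smoothTransition.nonneg _
lemma cu_le (c d r : ℝ) : cu c d r ≤ 1 := Real.smoothTransition.le_one _
lemma cu_mono (c : ℝ) {d : ℝ} (hd : 0 < d) : Monotone (cu c d) := fun a b h =>
  Real.smoothTransition.monotone (by gcongr)
lemma cu_dnn (c : ℝ) {d : ℝ} (hd : 0 < d) (r : ℝ) : 0 ≤ deriv (cu c d) r :=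
  (cu_mono c hd).deriv_nonneg
lemma cu_diff (c d r : ℝ) : DifferentiableAt ℝ (cu c d) r :=
  (cu_cd c d (n := 1)).differentiable (by simp) r
lemma cu_dcont (c d : ℝ) : Continuous (deriv (cu c d)) :=
  (cu_cd c d (n := 1)).continuous_deriv (by simp)
lemma cu_d0 {c d r : ℝ} (hd : 0 < d) (h : r < c ∨ c + d < r) : deriv (cu c d) r = 0 := by
  rcases h with h | h
  · have : cu c d =ᶠ[𝓝 r] fun _ => 0 := by
      filter_upwards [Iio_mem_nhds h] with s hs using cu_zero hd (le_of_lt hs)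
    rw [this.deriv_eq]; simp
  · have : cu c d =ᶠ[𝓝 r] fun _ => 1 := by
      filter_upwards [Ioi_mem_nhds h] with s hs using cu_one hd (le_of_lt hs)
    rw [this.deriv_eq]; simp
lemma cu_int {c d t : ℝ} (ht : 0 ≤ t) : IntegrableOn (deriv (cu c d)) (Ioo 0 t) ∧
    ∫ r in Ioo 0 t, deriv (cu c d) r = cu c d t - cu c d 0 := by
  constructor
  · exact ((cu_dcont c d).integrableOn_Icc).mono_set Ioo_subset_Icc_self
  · rw [← integral_Ioc_eq_integral_Ioo, ← intervalIntegral.integral_of_le ht]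
    exact intervalIntegral.integral_deriv_eq_sub (fun r _ => cu_diff c d r)
      ((cu_dcont c d).intervalIntegrable _ _)

/-- good cutoffs -/
def Gd (t M : ℝ) (χ : ℝ → ℝ) : Prop :=
  RC t χ ∧ (∀ r, 0 ≤ χ r ∧ χ r ≤ 1) ∧ IntegrableOn (fun r => |deriv χ r|) (Ioo 0 t) ∧
    ∫ r in Ioo 0 t, |deriv χ r| ≤ M

lemma Gd.mulcu {t M c d : ℝ} {χ : ℝ → ℝ} (h : Gd t M χ) (ht : 0 ≤ t) (hd : 0 < d) :
    Gd t (M + 1) fun r => χ r * cu c d r := by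
  have h1 : RC t fun r => χ r * cu c d r := h.1.mul (cu_cd c d (n := ⊤)).contDiffOn
  have hb : ∀ r ∈ Ioo 0 t, |deriv (fun r => χ r * cu c d r) r| ≤ |deriv χ r| + deriv (cu c d) r := by
    intro r hr
    have hχ : DifferentiableAt ℝ χ r :=
      (h.1.1.contDiffAt (Ioi_mem_nhds hr.1)).differentiableAt (by simp)
    rw [deriv_fun_mul hχ (cu_diff c d r)]
    refine (abs_add_le _ _).trans ?_
    rw [abs_mul, abs_mul, abs_of_nonneg (cu_nn c d r), abs_of_nonneg (h.2.1 r).1,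
      abs_of_nonneg (cu_dnn c hd r)]
    have a1 := mul_le_mul_of_nonneg_left (cu_le c d r) (abs_nonneg (deriv χ r))
    have a2 := mul_le_mul_of_nonneg_right (h.2.1 r).2 (cu_dnn c hd r)
    linarith
  have hi : IntegrableOn (fun r => |deriv χ r| + deriv (cu c d) r) (Ioo 0 t) :=
    h.2.2.1.add (cu_int ht).1
  have hI : IntegrableOn (fun r => |deriv (fun r => χ r * cu c d r) r|) (Ioo 0 t) := by
    refine hi.mono' ?_ ?_
    · exact (measurable_deriv _).abs.aestronglyMeasurable
    · refine (ae_restrict_iff' measurableSet_Ioo).2 (ae_of_all _ fun r hr => ?_)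
      rw [Real.norm_eq_abs, abs_abs]; exact hb r hr
  refine ⟨h1, fun r => ⟨mul_nonneg (h.2.1 r).1 (cu_nn _ _ _),
    mul_le_one₀ (h.2.1 r).2 (cu_nn _ _ _) (cu_le _ _ _)⟩, hI, ?_⟩
  refine (setIntegral_mono_on hI hi measurableSet_Ioo hb).trans ?_
  rw [integral_add h.2.2.1 (cu_int ht).1, (cu_int ht).2]
  have := h.2.2.2; have := cu_le c d t; have := cu_nn c d 0
  linarith

/-- the standard cutoff -/
def ch (t a r : ℝ) : ℝ := cu a a r * (1 - cu (t - 2 * a) a r)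

lemma ch_in {t a r : ℝ} (ha : 0 < a) (hr : r < t - 2 * a) :
    deriv (ch t a) r = deriv (cu a a) r := by
  refine Filter.EventuallyEq.deriv_eq ?_
  filter_upwards [Iio_mem_nhds hr] with s hs
  simp [ch, cu_zero ha (le_of_lt hs)]
lemma ch_d0 {t a r : ℝ} (ha : 0 < a) (h2 : 2 * a < r) (hr : r < t - 2 * a) :
    deriv (ch t a) r = 0 := by rw [ch_in ha hr, cu_d0 ha (Or.inr (by linarith))]

lemma ch_gd {t a : ℝ} (ha : 0 < a) (hat : 4 * a < t) : Gd t 2 (ch t a) := by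
  have hc : ContDiff ℝ ∞ (ch t a) := (cu_cd a a).mul (contDiff_const.sub (cu_cd (t - 2 * a) a))
  have h1 : RC t (ch t a) := by
    refine ⟨hc.contDiffOn, a, t - a, ha, by linarith, fun r hr => ?_⟩
    rcases hr with hr | hr
    · simp [ch, cu_zero ha hr.le]
    · simp [ch, cu_one (c := t - 2 * a) ha (show t - 2 * a + a ≤ r by linarith)]
  have n1 := cu_nn (t - 2 * a) a
  have n2 := cu_le (t - 2 * a) a
  have hb : ∀ r, |deriv (ch t a) r| ≤ deriv (cu a a) r + deriv (cu (t - 2 * a) a) r := by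
    intro r
    have hd : deriv (ch t a) r = deriv (cu a a) r * (1 - cu (t - 2 * a) a r)
        + cu a a r * (0 - deriv (cu (t - 2 * a) a) r) := by
      exact ((cu_diff a a r).hasDerivAt.mul
        ((hasDerivAt_const r (1 : ℝ)).sub (cu_diff (t - 2 * a) a r).hasDerivAt)).deriv
    rw [hd]
    have a1 := cu_dnn a ha r
    have a2 := cu_dnn (t - 2 * a) ha r
    have := n1 r; have := n2 r; have := cu_nn a a r; have := cu_le a a r
    rw [abs_le]; constructor <;> nlinarith [mul_nonneg a1 (n1 r), mul_nonneg a1 (sub_nonneg.2 (n2 r)),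
      mul_nonneg a2 (cu_nn a a r), mul_nonneg a2 (sub_nonneg.2 (cu_le a a r))]
  have ht : 0 ≤ t := by linarith
  have hi : IntegrableOn (fun r => deriv (cu a a) r + deriv (cu (t - 2 * a) a) r) (Ioo 0 t) :=
    (cu_int ht).1.add (cu_int ht).1
  have hI : IntegrableOn (fun r => |deriv (ch t a) r|) (Ioo 0 t) :=
    ((hc.continuous_deriv (by simp)).abs.integrableOn_Icc).mono_set Ioo_subset_Icc_self
  refine ⟨h1, fun r => ⟨mul_nonneg (cu_nn _ _ _) (by linarith [n2 r]),
    mul_le_one₀ (cu_le _ _ _) (by linarith [n2 r]) (by linarith [n1 r])⟩, hI, ?_⟩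
  refine (setIntegral_mono_on hI hi measurableSet_Ioo fun r _ => hb r).trans ?_
  rw [integral_add (cu_int ht).1 (cu_int ht).1, (cu_int ht).2, (cu_int ht).2]
  have := n2 t; have := n1 0; have := cu_le a a t; have := cu_nn a a 0
  linarith

lemma ptw {t a r v B L : ℝ} (ha : 0 < a) (hr : 0 < r) (hrt : r < t) (hv : 0 ≤ v)
    (hB : 0 ≤ B) (hL : 0 ≤ L) (h1 : r ≤ 2 * a → v ≤ B) (h2 : t - r ≤ 2 * a → v ≤ L) :
    r * |deriv (ch t a) r| * v ≤ |deriv (ch t a) r| * (2 * a * B + t * L) := by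
  have p1 : 0 ≤ 2 * a * B := by positivity
  have p2 : 0 ≤ t * L := mul_nonneg (by linarith) hL
  rw [mul_comm r, mul_assoc]
  by_cases c1 : r ≤ 2 * a
  · gcongr
    have := mul_le_mul c1 (h1 c1) hv (by linarith)
    linarith
  by_cases c2 : t - r ≤ 2 * a
  · gcongr
    have := mul_le_mul hrt.le (h2 c2) hv (by linarith)
    linarith
  rw [ch_d0 ha (by linarith) (by linarith)]; simp

lemma ev_pos {P : ℝ → Prop} (h : ∀ᶠ s in 𝓝[>] (0 : ℝ), P s) : ∃ s0 > 0, ∀ s, 0 < s → s < s0 → P s := by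
  obtain ⟨u, hu, h⟩ := mem_nhdsGT_iff_exists_Ioo_subset.1 h
  exact ⟨u, hu, fun s h1 h2 => h ⟨h1, h2⟩⟩

lemma U_bound {t a B L T : ℝ} (ha : 0 < a) (hat : 4 * a < t) (ht : t ≤ T) (hB : 0 ≤ B) (hL : 0 ≤ L) :
    IntegrableOn (fun r => |deriv (ch t a) r| * (2 * a * B + t * L)) (Ioo 0 t) ∧
    ∫ r in Ioo 0 t, |deriv (ch t a) r| * (2 * a * B + t * L) ≤ 4 * a * B + 2 * T * L := by
  have hg := ch_gd ha hat
  refine ⟨hg.2.2.1.mul_const _, ?_⟩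
  rw [integral_mul_const]
  have p1 : 0 ≤ 2 * a * B := by positivity
  have p2 : 0 ≤ t * L := mul_nonneg (by linarith) hL
  have := mul_le_mul_of_nonneg_right hg.2.2.2 (add_nonneg p1 p2)
  have := mul_le_mul_of_nonneg_right ht hL
  linarith

lemma lim_g {t τ L R : ℝ} (h0 : 0 < t) (ht : t < τ) {G : ℝ × E3 × E3 → ℝ} (hG : ContinuousOn G (UU τ))
    {A : Z3 → ℝ} {C : ℝ} (hC : 0 ≤ C) (hA : ∀ z ∈ P0, |A z| ≤ C * (‖z.1‖ ^ 1)⁻¹)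
    (hAR : ∀ z : Z3, R < ‖z.2‖ → A z = 0) (x : E3) (hL0 : 0 ≤ L)
    (hL : ∀ᶠ s in 𝓝[>] (0 : ℝ), ∀ y ξ, ‖y - x‖ ≤ t → ‖ξ‖ ≤ R → |G (s, y, ξ)| ≤ L)
    {ε : ℝ} (hε : 0 < ε) :
    ∀ᶠ a in 𝓝[>] (0 : ℝ), |∫ z, deriv (ch t a) ‖z.1‖ * A z * ret t x G z|
      ≤ bV R * (C * (2 * τ * L)) + ε := by
  obtain ⟨s0, hs0, hs⟩ := ev_pos hL
  have hc : IsCompact (Icc (t / 2) t ×ˢ closedBall x t ×ˢ closedBall (0 : E3) R) :=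
    isCompact_Icc.prod ((isCompact_closedBall _ _).prod (isCompact_closedBall _ _))
  obtain ⟨B, hB⟩ := hc.exists_bound_of_continuousOn (hG.mono fun p hp =>
    ⟨⟨by have := hp.1.1; linarith, by have := hp.1.2; linarith⟩, mem_univ _⟩)
  have hB' : ∀ p ∈ (Icc (t / 2) t ×ˢ closedBall x t ×ˢ closedBall (0 : E3) R), |G p| ≤ |B| :=
    fun p hp => (hB p hp).trans (le_abs_self _)
  let q := bV R * (C * (4 * |B|)) + 1
  have hq : 0 < q := by have := bV_nonneg R; positivity
  filter_upwards [Ioo_mem_nhdsGT (show 0 < min (min (s0 / 2) (t / 4)) (ε / q) by positivity)] with a ha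
  simp only [mem_Ioo, lt_min_iff] at ha
  obtain ⟨ha0, ⟨ha1, ha2⟩, ha3⟩ := ha
  have ub := U_bound (T := τ) ha0 (by linarith) ht.le (abs_nonneg B) hL0
  refine (Zb (R := R) (t := t) (ub.1.const_mul C) ?_ ?_ ?_).trans ?_
  · intro z hz
    by_cases hzR : R < ‖z.2‖
    · rw [hAR z hzR]
      simp
      have : 0 ≤ t * L := by positivity
      positivity
    have hn : 0 < ‖z.1‖ := norm_pos_iff.2 hz.1
    have := ptw (L := L) ha0 hn hz.2 (abs_nonneg (ret t x G z)) (abs_nonneg B) hL0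
      (fun h => hB' _ ⟨⟨by simp; linarith, by simp⟩, by simp [hz.2.le], by simpa using hzR⟩)
      (fun h => hs _ (by linarith [hz.2]) (by linarith) _ _ (by simp [hz.2.le]) (by simpa using hzR))
    rw [abs_mul, abs_mul]
    have h3 := hA z hz.1
    calc ‖z.1‖ ^ 2 * (|deriv (ch t a) ‖z.1‖| * |A z| * |ret t x G z|)
        ≤ ‖z.1‖ ^ 2 * (|deriv (ch t a) ‖z.1‖| * (C * (‖z.1‖ ^ 1)⁻¹) * |ret t x G z|) := by gcongr
      _ = C * (‖z.1‖ * |deriv (ch t a) ‖z.1‖| * |ret t x G z|) := by field_simp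
      _ ≤ _ := by gcongr
  · intro z hz; rw [(ch_gd ha0 (by linarith)).1.deriv.off hz]; simp
  · intro z hz; rw [hAR z hz]; simp
  · rw [integral_const_mul]
    have h1 : bV R * (C * ∫ r in Ioo 0 t, |deriv (ch t a) r| * (2 * a * |B| + t * L))
      ≤ bV R * (C * (4 * a * |B| + 2 * τ * L)) := by
      gcongr; exacts [bV_nonneg R, ub.2]
    rw [lt_div_iff₀ hq] at ha3
    have : bV R * (C * (4 * |B|)) * a ≤ a * q := by simp only [q]; nlinarith
    linarith

lemma lim_1 {t τ L : ℝ} (h0 : 0 < t) (ht : t < τ) {u : ℝ × E3 → ℝ} (hu : ContinuousOn u (U1 τ))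
    {m : E3 → ℝ} (hm : ∀ y, |m y| ≤ 1) (x : E3) (hL0 : 0 ≤ L)
    (hL : ∀ᶠ s in 𝓝[>] (0 : ℝ), ∀ y, ‖y - x‖ ≤ t → |u (s, y)| ≤ L) {ε : ℝ} (hε : 0 < ε) :
    ∀ᶠ a in 𝓝[>] (0 : ℝ), |sy t x (fun y => pr (deriv (ch t a)) 1 y * m y) u|
      ≤ s3 * (2 * τ * L) + ε := by
  obtain ⟨s0, hs0, hs⟩ := ev_pos hL
  have hc : IsCompact (Icc (t / 2) t ×ˢ closedBall x t) :=
    isCompact_Icc.prod (isCompact_closedBall _ _)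
  obtain ⟨B, hB⟩ := hc.exists_bound_of_continuousOn (hu.mono fun p hp =>
    ⟨⟨by have := hp.1.1; linarith, by have := hp.1.2; linarith⟩, mem_univ _⟩)
  have hB' : ∀ p ∈ (Icc (t / 2) t ×ˢ closedBall x t), |u p| ≤ |B| :=
    fun p hp => (hB p hp).trans (le_abs_self _)
  let q := s3 * (4 * |B|) + 1
  have hq : 0 < q := by have := s3_pos; positivity
  filter_upwards [Ioo_mem_nhdsGT (show 0 < min (min (s0 / 2) (t / 4)) (ε / q) by positivity)] with a ha
  simp only [mem_Ioo, lt_min_iff] at ha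
  obtain ⟨ha0, ⟨ha1, ha2⟩, ha3⟩ := ha
  have ub := U_bound (T := τ) ha0 (by linarith) ht.le (abs_nonneg B) hL0
  refine (Yb (t := t) ub.1 ?_ ?_).trans ?_
  · intro y hy
    have hn : 0 < ‖y‖ := norm_pos_iff.2 hy.1
    have := ptw (L := L) ha0 hn hy.2 (abs_nonneg (u (t - ‖y‖, x + y))) (abs_nonneg B) hL0
      (fun h => hB' _ ⟨⟨by simp; linarith, by simp⟩, by simp [hy.2.le]⟩)
      (fun h => hs _ (by linarith [hy.2]) (by linarith) _ (by simp [hy.2.le]))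
    rw [abs_mul, abs_mul, pr, abs_mul, abs_of_nonneg (show 0 ≤ (‖y‖ ^ 1)⁻¹ by positivity)]
    calc ‖y‖ ^ 2 * (|deriv (ch t a) ‖y‖| * (‖y‖ ^ 1)⁻¹ * |m y| * |u (t - ‖y‖, x + y)|)
        ≤ ‖y‖ ^ 2 * (|deriv (ch t a) ‖y‖| * (‖y‖ ^ 1)⁻¹ * 1 * |u (t - ‖y‖, x + y)|) := by
          gcongr; exact hm y
      _ = ‖y‖ * |deriv (ch t a) ‖y‖| * |u (t - ‖y‖, x + y)| := by field_simp
      _ ≤ _ := this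
  · intro y hy
    have : deriv (ch t a) ‖y‖ = 0 := (ch_gd ha0 (by linarith)).1.deriv.off (z := (y, 0)) hy
    simp [pr, this]
  · have h1 := mul_le_mul_of_nonneg_left ub.2 s3_pos.le
    rw [lt_div_iff₀ hq] at ha3
    have : s3 * (4 * |B|) * a ≤ a * q := by simp only [q]; nlinarith
    linarith

lemma lim_2 {t τ L : ℝ} (h0 : 0 < t) (ht : t < τ) {u : ℝ × E3 → ℝ} (hu : ContinuousOn u (U1 τ))
    (x : E3) (hL0 : 0 ≤ L)
    (hL : ∀ᶠ s in 𝓝[>] (0 : ℝ), ∀ y, ‖y - x‖ ≤ t → |u (s, y)| ≤ L) {ε : ℝ} (hε : 0 < ε) :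
    ∀ᶠ a in 𝓝[>] (0 : ℝ), |sy t x (pr (deriv (ch t a)) 2) u - s3 * u (t, x)|
      ≤ s3 * (2 * L) + ε := by
  obtain ⟨s0, hs0, hs⟩ := ev_pos hL
  have hca : ContinuousAt u (t, x) := hu.continuousAt ((U1_open τ).mem_nhds ⟨⟨h0, ht⟩, mem_univ _⟩)
  have s3p := s3_pos
  obtain ⟨ρ, hρ, hd⟩ := Metric.continuousAt_iff.1 hca (ε / (2 * s3)) (by positivity)
  filter_upwards [Ioo_mem_nhdsGT (show 0 < min (min (s0 / 2) (t / 4)) (ρ / 2) by positivity)] with a ha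
  simp only [mem_Ioo, lt_min_iff] at ha
  obtain ⟨ha0, ⟨ha1, ha2⟩, ha3⟩ := ha
  have hg := ch_gd (t := t) ha0 (by linarith)
  have mj := maj_int (cu_int (c := a) (d := a) h0.le).1
  have e1 := mj.2
  rw [(cu_int h0.le).2, cu_one ha0 (by linarith), cu_zero ha0 ha0.le, sub_zero, mul_one] at e1
  have e2 : s3 * u (t, x) = ∫ y : E3, (Ioo 0 t).indicator (fun r => deriv (cu a a) r * (r ^ 2)⁻¹) ‖y‖
      * u (t, x) := by rw [integral_mul_const, e1]
  rw [sy, e2, ← integral_sub (sy_int ht.le (pr_ap hg.1.deriv 2) hu x) (mj.1.mul_const _)]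
  refine (Yb (t := t) (hg.2.2.1.mul_const (ε / (2 * s3) + L)) ?_ ?_).trans ?_
  · intro y hy
    have hn : 0 < ‖y‖ := norm_pos_iff.2 hy.1
    rw [indicator_of_mem (show ‖y‖ ∈ Ioo 0 t from ⟨hn, hy.2⟩), pr]
    by_cases c1 : ‖y‖ ≤ 2 * a
    · rw [ch_in ha0 (by linarith)]
      have hdd : dist (t - ‖y‖, x + y) (t, x) < ρ := by
        rw [Prod.dist_eq, max_lt_iff]
        constructor
        · simp [Real.dist_eq]; linarith
        · simp; linarith
      have := hd hdd
      rw [Real.dist_eq] at this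
      have e : deriv (cu a a) ‖y‖ * (‖y‖ ^ 2)⁻¹ * u (t - ‖y‖, x + y)
        - deriv (cu a a) ‖y‖ * (‖y‖ ^ 2)⁻¹ * u (t, x)
        = deriv (cu a a) ‖y‖ * (‖y‖ ^ 2)⁻¹ * (u (t - ‖y‖, x + y) - u (t, x)) := by ring
      rw [e, abs_mul, abs_mul, abs_of_nonneg (show 0 ≤ (‖y‖ ^ 2)⁻¹ by positivity)]
      calc _ = |deriv (cu a a) ‖y‖| * |u (t - ‖y‖, x + y) - u (t, x)| := by field_simp
        _ ≤ _ := by gcongr; linarith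
    · rw [cu_d0 ha0 (Or.inr (by linarith)), zero_mul, zero_mul, sub_zero, abs_mul, abs_mul,
        abs_of_nonneg (show 0 ≤ (‖y‖ ^ 2)⁻¹ by positivity)]
      by_cases c2 : t - ‖y‖ ≤ 2 * a
      · have := hs (t - ‖y‖) (by linarith [hy.2]) (by linarith) (x + y) (by simp [hy.2.le])
        calc _ = |deriv (ch t a) ‖y‖| * |u (t - ‖y‖, x + y)| := by field_simp
          _ ≤ _ := by
            gcongr
            have : 0 < ε / (2 * s3) := by positivity
            linarith
      · rw [ch_d0 ha0 (by linarith) (by linarith)]; simp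
  · intro y hy
    have : deriv (ch t a) ‖y‖ = 0 := hg.1.deriv.off (z := (y, 0)) hy
    rw [indicator_of_notMem fun h => hy ⟨norm_pos_iff.1 h.1, h.2⟩]
    simp [pr, this]
  · rw [integral_mul_const]
    have : (∫ r in Ioo 0 t, |deriv (ch t a) r|) * (ε / (2 * s3) + L) ≤ 2 * (ε / (2 * s3) + L) := by
      gcongr; exact hg.2.2.2
    calc _ ≤ s3 * (2 * (ε / (2 * s3) + L)) := by gcongr
      _ = _ := by field_simp; ring

/-- behaviour near the initial time -/
def Lay {X : Type*} [NormedAddCommGroup X] (L : ℝ) (u : ℝ × X → ℝ) : Prop :=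
  ∀ (ρ : ℝ) (h : X) (ε : ℝ), 0 < ε → ∀ᶠ s in 𝓝[>] (0 : ℝ), ∀ x, ‖x‖ ≤ ρ →
    |u (s, x)| ≤ L + ε ∧ |u (s, x + h) - u (s, x)| ≤ L * ‖h‖ + ε

lemma core {t τ L R C : ℝ} (h0 : 0 < t) (ht : t < τ) {G : ℝ × E3 × E3 → ℝ} {u ud : ℝ × E3 → ℝ}
    {ux : Fin 3 → ℝ × E3 → ℝ} (hG : ContinuousOn G (UU τ)) (hu : ContinuousOn u (U1 τ))
    (hud : ContinuousOn ud (U1 τ)) (hux : ∀ k, ContinuousOn (ux k) (U1 τ))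
    {A : Z3 → ℝ} (hC : 0 ≤ C) (hA : ∀ z ∈ P0, |A z| ≤ C * (‖z.1‖ ^ 1)⁻¹)
    (hAR : ∀ z : Z3, R < ‖z.2‖ → A z = 0) (x : E3) (hL0 : 0 ≤ L)
    (lG : ∀ᶠ s in 𝓝[>] (0 : ℝ), ∀ y ξ, ‖y - x‖ ≤ t → ‖ξ‖ ≤ R → |G (s, y, ξ)| ≤ L)
    (lu : ∀ᶠ s in 𝓝[>] (0 : ℝ), ∀ y, ‖y - x‖ ≤ t → |u (s, y)| ≤ L)
    (lud : ∀ᶠ s in 𝓝[>] (0 : ℝ), ∀ y, ‖y - x‖ ≤ t → |ud (s, y)| ≤ L)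
    (lux : ∀ k, ∀ᶠ s in 𝓝[>] (0 : ℝ), ∀ y, ‖y - x‖ ≤ t → |ux k (s, y)| ≤ L)
    {ε : ℝ} (hε : 0 < ε) :
    ∀ᶠ a in 𝓝[>] (0 : ℝ), |(∑ k, sy t x (fun y => pr (deriv (ch t a)) 1 y * om k y) (ux k))
        + sy t x (pr (deriv (ch t a)) 1) ud + sy t x (pr (deriv (ch t a)) 2) u
        + (∫ z, deriv (ch t a) ‖z.1‖ * A z * ret t x G z) - s3 * u (t, x)|
      ≤ (8 * s3 * τ + 2 * s3 + 2 * bV R * C * τ) * L + 6 * ε := by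
  have hx := fun k => lim_1 h0 ht (hux k) (abs_om_le k) x hL0 (lux k) hε
  filter_upwards [lim_g h0 ht hG hC hA hAR x hL0 lG hε, lim_2 h0 ht hu x hL0 lu hε,
    lim_1 h0 ht hud (m := fun _ => 1) (by simp) x hL0 lud hε, hx 0, hx 1, hx 2] with a h1 h2 h3 k0 k1 k2
  simp only [mul_one] at h3
  rw [Fin.sum_univ_three]
  rw [abs_le] at *
  constructor <;> nlinarith

/-- interior part of the representation -/
def SS (g : ℝ × E3 × E3 → ℝ) (K : Fin 3 → ℝ × E3 × E3 → ℝ) (A2 : Z3 → ℝ) (W : Fin 3 → Z3 → ℝ)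
    (χ : ℝ → ℝ) (t : ℝ) (x : E3) : ℝ :=
  (∫ z, χ ‖z.1‖ * A2 z * ret t x g z)
    + ∑ l, ∫ z, χ ‖z.1‖ * W l z * ret t x (fun p => K l p * g p) z

lemma sy_shift {t τ : ℝ} (ht : t ≤ τ) {P : E3 → ℝ} {w : ℝ × E3 → ℝ} (hP : AP t P)
    (hw : ContinuousOn w (U1 τ)) (x h : E3) :
    sy t x P (fun p => w (p.1, p.2 + h) - w p) = sy t (x + h) P w - sy t x P w := by
  rw [sy, sy, sy, ← integral_sub (sy_int ht hP hw _) (sy_int ht hP hw _)]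
  congr 1; ext y; rw [add_right_comm]; ring

lemma L1 {τ R L : ℝ} (hL : 0 ≤ L) {g : ℝ × E3 × E3 → ℝ} {K : Fin 3 → ℝ × E3 × E3 → ℝ} {w : ℝ × E3 → ℝ}
    {A1 A2 : Z3 → ℝ} {W : Fin 3 → Z3 → ℝ} (hg : ContDiffOn ℝ 1 g (UU τ)) (hw : ContDiffOn ℝ 1 w (U1 τ))
    (hr : FRep τ g K w R A1 A2 W) (hA : Ker 1 R A1)
    (lg : Lay L g) (lw : Lay L w) (l0 : Lay L (d0 w)) (l1 : ∀ k, Lay L (d1 k w)) :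
    ∃ C0, 0 ≤ C0 ∧ ∀ t ∈ Ioo 0 τ, ∀ x h : E3, ∀ ε > 0, ∃ χ, Gd t 2 χ ∧
      |s3 * w (t, x) + SS g K A2 W χ t x| ≤ C0 + ε ∧
      |s3 * (w (t, x + h) - w (t, x)) + (SS g K A2 W χ t (x + h) - SS g K A2 W χ t x)|
        ≤ C0 * ‖h‖ + ε := by
  obtain ⟨C, hC, hAb⟩ := hA.bound
  by_cases hτ : 0 < τ
  swap
  · exact ⟨0, le_rfl, fun t ht => absurd (ht.1.trans ht.2) hτ⟩
  set Q := 8 * s3 * τ + 2 * s3 + 2 * bV R * C * τ with hQ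
  have hQ0 : 0 ≤ Q := by have := s3_pos; have := bV_nonneg R; positivity
  refine ⟨Q * L, by positivity, fun t ht x h ε hε => ?_⟩
  let η := ε / (Q + 6)
  have hη : 0 < η := by positivity
  have hηe : Q * η + 6 * η = ε := by simp only [η]; field_simp
  have sh : MapsTo (fun p : ℝ × E3 => (p.1, p.2 + h)) (U1 τ) (U1 τ) := fun p hp => ⟨hp.1, trivial⟩
  have shc {u : ℝ × E3 → ℝ} (hu : ContinuousOn u (U1 τ)) :
      ContinuousOn (fun p : ℝ × E3 => u (p.1, p.2 + h) - u p) (U1 τ) :=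
    (hu.comp (f := fun p : ℝ × E3 => (p.1, p.2 + h)) (by fun_prop) sh).sub hu
  have sgc : ContinuousOn (fun p : ℝ × E3 × E3 => g (p.1, p.2.1 + h, p.2.2) - g p) (UU τ) :=
    (hg.continuousOn.comp (f := fun p : ℝ × E3 × E3 => (p.1, p.2.1 + h, p.2.2)) (by fun_prop)
      fun p hp => ⟨hp.1, trivial⟩).sub hg.continuousOn
  have nb {y : E3} (hy : ‖y - x‖ ≤ t) : ‖y‖ ≤ ‖x‖ + t := by
    have := norm_sub_norm_le y x; linarith
  have la {u : ℝ × E3 → ℝ} (lu : Lay L u) :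
      ∀ᶠ s in 𝓝[>] (0 : ℝ), ∀ y, ‖y - x‖ ≤ t → |u (s, y)| ≤ L + η := by
    filter_upwards [lu (‖x‖ + t) h η hη] with s hs y hy using (hs y (nb hy)).1
  have lb {u : ℝ × E3 → ℝ} (lu : Lay L u) :
      ∀ᶠ s in 𝓝[>] (0 : ℝ), ∀ y, ‖y - x‖ ≤ t → |u (s, y + h) - u (s, y)| ≤ L * ‖h‖ + η := by
    filter_upwards [lu (‖x‖ + t) h η hη] with s hs y hy using (hs y (nb hy)).2
  have lga : ∀ᶠ s in 𝓝[>] (0 : ℝ), ∀ y ξ, ‖y - x‖ ≤ t → ‖ξ‖ ≤ R → |g (s, y, ξ)| ≤ L + η := by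
    filter_upwards [lg (max (‖x‖ + t) R) (h, 0) η hη] with s hs y ξ hy hξ using
      (hs (y, ξ) (max_le_max (nb hy) hξ)).1
  have lgb : ∀ᶠ s in 𝓝[>] (0 : ℝ), ∀ y ξ, ‖y - x‖ ≤ t → ‖ξ‖ ≤ R →
      |g (s, y + h, ξ) - g (s, y, ξ)| ≤ L * ‖h‖ + η := by
    filter_upwards [lg (max (‖x‖ + t) R) (h, 0) η hη] with s hs y ξ hy hξ
    simpa using (hs (y, ξ) (max_le_max (nb hy) hξ)).2
  have c1 := core ht.1 ht.2 hg.continuousOn hw.continuousOn (d0_cont hw) (d1_cont hw) hC hAb hA.2 x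
    (by positivity) lga (la lw) (la l0) (fun k => la (l1 k)) hη
  have c2 := core ht.1 ht.2 sgc (shc hw.continuousOn) (shc (d0_cont hw)) (fun k => shc (d1_cont hw k))
    hC hAb hA.2 x (by positivity) lgb (lb lw) (lb l0) (fun k => lb (l1 k)) hη
  obtain ⟨a, a1, a2, a3⟩ := (c1.and (c2.and
    (Ioo_mem_nhdsGT (show 0 < t / 4 by linarith [ht.1])))).exists
  have gd : Gd t 2 (ch t a) := ch_gd a3.1 (by linarith [a3.2])
  have rc := gd.1
  have r1 := hr t ht.2.le _ rc x
  have r2 := hr t ht.2.le _ rc (x + h)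
  refine ⟨_, gd, ?_, ?_⟩
  · have e : s3 * w (t, x) + SS g K A2 W (ch t a) t x
      = -((∑ k, sy t x (fun y => pr (deriv (ch t a)) 1 y * om k y) (d1 k w))
        + sy t x (pr (deriv (ch t a)) 1) (d0 w) + sy t x (pr (deriv (ch t a)) 2) w
        + (∫ z, deriv (ch t a) ‖z.1‖ * A1 z * ret t x g z) - s3 * w (t, x)) := by
      simp only [DD] at r1
      simp only [SS]; linarith
    rw [e, abs_neg]
    refine a1.trans ?_
    rw [← hQ]; nlinarith
  · simp only [sy_shift ht.2.le ((pr_ap rc.deriv _).mulom _) (d1_cont hw _),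
      sy_shift ht.2.le (pr_ap rc.deriv _) hw.continuousOn,
      sy_shift ht.2.le (pr_ap rc.deriv _) (d0_cont hw)] at a2
    have i1 : ∀ x, Integrable fun z => deriv (ch t a) ‖z.1‖ * A1 z * ret t x g z := fun x => by
      simpa using (hA.adm rc.deriv (n := 0) (by simp) (q := fun _ => 1) contDiffOn_const).integrable_mul
        (ret_cont ht.2.le x hg.continuousOn)
    have e1 : (∫ z, deriv (ch t a) ‖z.1‖ * A1 z
        * ret t x (fun p => g (p.1, p.2.1 + h, p.2.2) - g p) z)
        = (∫ z, deriv (ch t a) ‖z.1‖ * A1 z * ret t (x + h) g z)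
        - ∫ z, deriv (ch t a) ‖z.1‖ * A1 z * ret t x g z := by
      rw [← integral_sub (i1 _) (i1 _)]
      congr 1; ext z; simp only [ret]; rw [add_right_comm]; ring
    rw [e1] at a2
    have e : s3 * (w (t, x + h) - w (t, x)) + (SS g K A2 W (ch t a) t (x + h) - SS g K A2 W (ch t a) t x)
      = -((∑ k, (sy t (x + h) (fun y => pr (deriv (ch t a)) 1 y * om k y) (d1 k w)
          - sy t x (fun y => pr (deriv (ch t a)) 1 y * om k y) (d1 k w)))
        + (sy t (x + h) (pr (deriv (ch t a)) 1) (d0 w) - sy t x (pr (deriv (ch t a)) 1) (d0 w))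
        + (sy t (x + h) (pr (deriv (ch t a)) 2) w - sy t x (pr (deriv (ch t a)) 2) w)
        + ((∫ z, deriv (ch t a) ‖z.1‖ * A1 z * ret t (x + h) g z)
        - ∫ z, deriv (ch t a) ‖z.1‖ * A1 z * ret t x g z) - s3 * (w (t, x + h) - w (t, x))) := by
      simp only [DD] at r1 r2
      simp only [SS, Finset.sum_sub_distrib]; linarith
    rw [e, abs_neg]
    refine a2.trans ?_
    rw [← hQ]; nlinarith

lemma div_bound {τ R : ℝ} {m : ℕ} {A : Z3 → ℝ} (hA : Ker m R A) (i : Fin 3) {g : ℝ × E3 × E3 → ℝ}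
    {K : Fin 3 → ℝ × E3 × E3 → ℝ} (hg : ContDiffOn ℝ 1 g (UU τ))
    (hK : ∀ l, ContDiffOn ℝ 1 (K l) (UU τ))
    (hV : ∀ p ∈ UU τ, dT g p + ∑ k, vrel p.2.2 k * dX k g p
      = - ∑ l, dV l (fun q => K l q * g q) p) :
    ∃ C, 0 ≤ C ∧ ∀ t ≤ τ, ∀ x φ q, ∀ V q1 : ℝ → ℝ, ∀ q0 q2 M N : ℝ, RC t φ → ContDiffOn ℝ 1 q (Om t) →
      IntegrableOn V (Ioo 0 t) → 0 ≤ N → 0 ≤ q2 →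
      (∀ z ∈ Om t, |ret t x g z| ≤ M ∧ |q z| ≤ q0 ∧
        (∀ l, |ret t x (K l) z| ≤ N ∧ |fderiv ℝ q z (e3 l, 0)| ≤ q1 ‖z.1‖ ∧
          |fderiv ℝ q z (0, e3 l)| ≤ q2)) →
      (∀ r ∈ Ioo 0 t, |deriv φ r| * q0 * (r ^ 2 * (r ^ m)⁻¹)
        + |φ r| * (q1 r * (r ^ 2 * (r ^ m)⁻¹) + q0 * (r ^ 2 * (r ^ (m + 1))⁻¹))
        + N * |φ r| * (q2 + q0) * (r ^ 2 * (r ^ m)⁻¹) ≤ V r) →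
      |∫ z, φ ‖z.1‖ * q z * A z * ret t x (dX i g) z| ≤ C * (M * ∫ r in Ioo 0 t, V r) := by
  let H : Fin 3 → Z3 → ℝ := fun k => if k = i then A else fun _ => 0
  have h0 := Ker.zero m R
  have h : ∀ k, Ker m R (H k) := fun k => by
    simp only [H]; split_ifs; exacts [hA, h0]
  have kQ := Qk_ker h0 h
  have kN := Nk_ker h0 h
  choose cQ cQ0 bQ using fun k => (kQ k).bound
  choose cd cd0 bd using fun k => ((kQ k).dy k).bound
  obtain ⟨cN, cN0, bN⟩ := kN.bound
  choose ce ce0 be using fun k => (kN.dxi k).bound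
  have vn := bV_nonneg R
  refine ⟨bV R * ((∑ k, (cQ k + cd k)) + ∑ k, (cN + ce k)), mul_nonneg vn (add_nonneg
    (Finset.sum_nonneg fun k _ => add_nonneg (cQ0 k) (cd0 k))
    (Finset.sum_nonneg fun k _ => add_nonneg cN0 (ce0 k))), ?_⟩
  intro t ht x φ q V q1 q0 q2 M N hφ hq hVi hN hq2 hb hU
  have dv := division ht x hg hK hV h0 h hφ hq
  have e : (∫ z, φ ‖z.1‖ * q z * A z * ret t x (dX i g) z)
      = ∫ z, φ ‖z.1‖ * q z * (0 * ret t x (dT g) z + ∑ k, H k z * ret t x (dX k g) z) := by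
    congr 1; ext z
    rw [Finset.sum_eq_single i (fun k _ hk => by simp [H, hk]) (by simp)]
    simp [H]; ring
  rw [e, dv, mul_assoc, add_mul, mul_add, Finset.sum_mul, Finset.sum_mul, Finset.mul_sum, Finset.mul_sum]
  refine (abs_add_le _ _).trans (add_le_add ((Finset.abs_sum_le_sum_abs _ _).trans
    (Finset.sum_le_sum fun k _ => ?_)) ((Finset.abs_sum_le_sum_abs _ _).trans
    (Finset.sum_le_sum fun k _ => ?_)))
  · refine (Zb (R := R) (hVi.const_mul ((cQ k + cd k) * M)) (fun z hz => ?_) (fun z hz => ?_)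
      fun z hz => ?_).trans ?_
    · have hn : 0 < ‖z.1‖ := norm_pos_iff.2 hz.1
      obtain ⟨b1, b2, b3⟩ := hb z hz
      have hU' := hU ‖z.1‖ ⟨hn, hz.2⟩
      have p0 : 0 ≤ q0 := (abs_nonneg _).trans b2
      have pM : 0 ≤ M := (abs_nonneg _).trans b1
      have p1 : 0 ≤ q1 ‖z.1‖ := (abs_nonneg _).trans (b3 k).2.1
      rw [abs_mul, fd_prod_y hφ hq (kQ k).1 hz]
      have c1 := bQ k z (Om_P0 t hz)
      have c2 := bd k z (Om_P0 t hz)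
      have cc := cQ0 k
      have cc2 := cd0 k
      have k1 : |deriv φ ‖z.1‖ * om k z.1 * q z * Qk (fun _ => 0) H k z
        + φ ‖z.1‖ * fderiv ℝ q z (e3 k, 0) * Qk (fun _ => 0) H k z
        + φ ‖z.1‖ * q z * fderiv ℝ (Qk (fun _ => 0) H k) z (e3 k, 0)|
        ≤ |deriv φ ‖z.1‖| * 1 * q0 * (cQ k * (‖z.1‖ ^ m)⁻¹)
        + |φ ‖z.1‖| * q1 ‖z.1‖ * (cQ k * (‖z.1‖ ^ m)⁻¹)
        + |φ ‖z.1‖| * q0 * (cd k * (‖z.1‖ ^ (m + 1))⁻¹) := by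
        refine (abs_add_le _ _).trans (add_le_add ((abs_add_le _ _).trans (add_le_add ?_ ?_)) ?_) <;>
        simp only [abs_mul] <;> gcongr
        exacts [abs_om_le k _, (b3 k).2.1]
      calc _ ≤ ‖z.1‖ ^ 2 * ((|deriv φ ‖z.1‖| * 1 * q0 * (cQ k * (‖z.1‖ ^ m)⁻¹)
        + |φ ‖z.1‖| * q1 ‖z.1‖ * (cQ k * (‖z.1‖ ^ m)⁻¹)
        + |φ ‖z.1‖| * q0 * (cd k * (‖z.1‖ ^ (m + 1))⁻¹)) * M) := by gcongr
        _ = (cQ k * (|deriv φ ‖z.1‖| * q0 * (‖z.1‖ ^ 2 * (‖z.1‖ ^ m)⁻¹)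
          + |φ ‖z.1‖| * (q1 ‖z.1‖ * (‖z.1‖ ^ 2 * (‖z.1‖ ^ m)⁻¹)))
          + cd k * (|φ ‖z.1‖| * (q0 * (‖z.1‖ ^ 2 * (‖z.1‖ ^ (m + 1))⁻¹)))) * M := by ring
        _ ≤ (cQ k * V ‖z.1‖ + cd k * V ‖z.1‖) * M := by
          have t1 : 0 ≤ |deriv φ ‖z.1‖| * q0 * (‖z.1‖ ^ 2 * (‖z.1‖ ^ m)⁻¹) := by positivity
          have t2 : 0 ≤ |φ ‖z.1‖| * (q1 ‖z.1‖ * (‖z.1‖ ^ 2 * (‖z.1‖ ^ m)⁻¹)) := by positivity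
          have t3 : 0 ≤ |φ ‖z.1‖| * (q0 * (‖z.1‖ ^ 2 * (‖z.1‖ ^ (m + 1))⁻¹)) := by positivity
          have t4 : 0 ≤ N * |φ ‖z.1‖| * (q2 + q0) * (‖z.1‖ ^ 2 * (‖z.1‖ ^ m)⁻¹) := by positivity
          gcongr <;> linarith
        _ = _ := by ring
    · have := (((kQ k).adm hφ (n := 1) (by simp) hq).fderiv1 (e3 k, 0)).zero_off hz
      simp only [this, zero_mul]
    · rw [Ker.fd0 (R := R) (fun z hz => by rw [(kQ k).2 z hz, mul_zero]) hz]; simp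
    · rw [integral_const_mul]; apply le_of_eq; ring
  · refine (Zb (R := R) (hVi.const_mul ((cN + ce k) * M)) (fun z hz => ?_) (fun z hz => ?_)
      fun z hz => ?_).trans ?_
    · have hn : 0 < ‖z.1‖ := norm_pos_iff.2 hz.1
      obtain ⟨b1, b2, b3⟩ := hb z hz
      have hU' := hU ‖z.1‖ ⟨hn, hz.2⟩
      have p0 : 0 ≤ q0 := (abs_nonneg _).trans b2
      have pM : 0 ≤ M := (abs_nonneg _).trans b1
      have p1 : 0 ≤ q1 ‖z.1‖ := (abs_nonneg _).trans (b3 k).2.1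
      rw [abs_mul, fd_prod_xi hφ hq kN.1 hz]
      have c1 := bN z (Om_P0 t hz)
      have c2 := be k z (Om_P0 t hz)
      have cc2 := ce0 k
      have k1 : |φ ‖z.1‖ * fderiv ℝ q z (0, e3 k) * Nk (fun _ => 0) H z
        + φ ‖z.1‖ * q z * fderiv ℝ (Nk (fun _ => 0) H) z (0, e3 k)|
        ≤ |φ ‖z.1‖| * q2 * (cN * (‖z.1‖ ^ m)⁻¹)
        + |φ ‖z.1‖| * q0 * (ce k * (‖z.1‖ ^ m)⁻¹) := by
        refine (abs_add_le _ _).trans (add_le_add ?_ ?_) <;>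
        simp only [abs_mul] <;> gcongr
        exact (b3 k).2.2
      have k2 : |ret t x (fun p => K k p * g p) z| ≤ N * M := by
        have : ret t x (fun p => K k p * g p) z = ret t x (K k) z * ret t x g z := rfl
        rw [this, abs_mul]
        exact mul_le_mul (b3 k).1 b1 (abs_nonneg _) hN
      calc _ ≤ ‖z.1‖ ^ 2 * ((|φ ‖z.1‖| * q2 * (cN * (‖z.1‖ ^ m)⁻¹)
        + |φ ‖z.1‖| * q0 * (ce k * (‖z.1‖ ^ m)⁻¹)) * (N * M)) := by gcongr
        _ = (cN * (N * |φ ‖z.1‖| * q2 * (‖z.1‖ ^ 2 * (‖z.1‖ ^ m)⁻¹))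
          + ce k * (N * |φ ‖z.1‖| * q0 * (‖z.1‖ ^ 2 * (‖z.1‖ ^ m)⁻¹))) * M := by ring
        _ ≤ (cN * V ‖z.1‖ + ce k * V ‖z.1‖) * M := by
          have t1 : 0 ≤ |deriv φ ‖z.1‖| * q0 * (‖z.1‖ ^ 2 * (‖z.1‖ ^ m)⁻¹) := by positivity
          have t2 : 0 ≤ |φ ‖z.1‖| * (q1 ‖z.1‖ * (‖z.1‖ ^ 2 * (‖z.1‖ ^ m)⁻¹)
            + q0 * (‖z.1‖ ^ 2 * (‖z.1‖ ^ (m + 1))⁻¹)) := by positivity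
          have t3 : 0 ≤ N * |φ ‖z.1‖| * q2 * (‖z.1‖ ^ 2 * (‖z.1‖ ^ m)⁻¹) := by positivity
          have t4 : 0 ≤ N * |φ ‖z.1‖| * q0 * (‖z.1‖ ^ 2 * (‖z.1‖ ^ m)⁻¹) := by positivity
          gcongr <;> linarith
        _ = _ := by ring
    · have := ((kN.adm hφ (n := 1) (by simp) hq).fderiv1 (0, e3 k)).zero_off hz
      simp only [this, zero_mul]
    · rw [Ker.fd0 (R := R) (fun z hz => by rw [kN.2 z hz, mul_zero]) hz]; simp
    · rw [integral_const_mul]; apply le_of_eq; ring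

lemma i_const (t c : ℝ) (ht : 0 ≤ t) : IntegrableOn (fun _ => c) (Ioo 0 t) ∧
    ∫ _ in Ioo 0 t, c = c * t := by
  refine ⟨integrableOn_const (by simp), ?_⟩
  simp [ht]; ring

lemma i_exp {t l : ℝ} (ht : 0 ≤ t) (hl : 0 < l) :
    IntegrableOn (fun r => Real.exp (l * (t - r))) (Ioo 0 t) ∧
    ∫ r in Ioo 0 t, Real.exp (l * (t - r)) ≤ Real.exp (l * t) / l := by
  have hc : Continuous fun r => Real.exp (l * (t - r)) := by fun_prop
  refine ⟨(hc.integrableOn_Icc).mono_set Ioo_subset_Icc_self, ?_⟩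
  rw [← integral_Ioc_eq_integral_Ioo, ← intervalIntegral.integral_of_le ht,
    intervalIntegral.integral_eq_sub_of_hasDerivAt (f := fun r => - Real.exp (l * (t - r)) / l)
    (fun r _ => ?_) (hc.intervalIntegrable _ _)]
  · simp; rw [neg_div]; have : 0 < l⁻¹ := by positivity
    simp [neg_div]
    linarith
  · have := (((((hasDerivAt_id r).const_sub t).const_mul l).exp).neg).div_const l
    refine this.congr_deriv ?_
    simp only [id]; field_simp

lemma i_log {t d : ℝ} (ht : 0 ≤ t) (hd : 0 < d) :
    IntegrableOn (fun r => (r + d)⁻¹) (Ioo 0 t) ∧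
    ∫ r in Ioo 0 t, (r + d)⁻¹ = Real.log (1 + t / d) := by
  have hc : ContinuousOn (fun r => (r + d)⁻¹) (Icc 0 t) :=
    ContinuousOn.inv₀ (by fun_prop) fun r hr => by have := hr.1; linarith
  refine ⟨(hc.integrableOn_Icc).mono_set Ioo_subset_Icc_self, ?_⟩
  rw [← integral_Ioc_eq_integral_Ioo, ← intervalIntegral.integral_of_le ht,
    intervalIntegral.integral_eq_sub_of_hasDerivAt (f := fun r => Real.log (r + d))
    (fun r hr => ?_) (by rw [← uIcc_of_le ht] at hc; exact hc.intervalIntegrable)]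
  · rw [zero_add, ← Real.log_div (by linarith) hd.ne', add_div, div_self hd.ne', add_comm]
  · rw [uIcc_of_le ht] at hr
    have := ((hasDerivAt_id r).add_const d).log (by simp; linarith [hr.1])
    simpa using this

lemma i_ind {t d : ℝ} (hd : 0 ≤ d) : IntegrableOn ((Iic d).indicator fun _ => (1 : ℝ)) (Ioo 0 t) ∧
    ∫ r in Ioo 0 t, (Iic d).indicator (fun _ => (1 : ℝ)) r ≤ d := by
  refine ⟨(integrableOn_const (by simp)).indicator measurableSet_Iic, ?_⟩
  rw [setIntegral_indicator measurableSet_Iic, setIntegral_const, smul_eq_mul, mul_one]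
  have : Ioo 0 t ∩ Iic d ⊆ Icc 0 d := fun r hr => ⟨hr.1.1.le, hr.2⟩
  refine (measureReal_mono this (by simp)).trans ?_
  simp [hd]

/-- direct bound of a kernel integral -/
lemma KB {t R C : ℝ} {m : ℕ} {A b : Z3 → ℝ} (hC : ∀ z ∈ P0, |A z| ≤ C * (‖z.1‖ ^ m)⁻¹)
    (hA : ∀ z : Z3, R < ‖z.2‖ → A z = 0) {φ U : ℝ → ℝ} (hφ : RC t φ) (hU : IntegrableOn U (Ioo 0 t))
    (hb : ∀ z ∈ Om t, |φ ‖z.1‖| * (‖z.1‖ ^ 2 * (‖z.1‖ ^ m)⁻¹) * |b z| ≤ U ‖z.1‖) (hC0 : 0 ≤ C) :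
    |∫ z, φ ‖z.1‖ * A z * b z| ≤ bV R * C * ∫ r in Ioo 0 t, U r := by
  refine (Zb (R := R) (hU.const_mul C) (fun z hz => ?_) (fun z hz => ?_) fun z hz => ?_).trans ?_
  · have h1 := hC z (Om_P0 t hz)
    rw [abs_mul, abs_mul]
    calc _ ≤ ‖z.1‖ ^ 2 * (|φ ‖z.1‖| * (C * (‖z.1‖ ^ m)⁻¹) * |b z|) := by gcongr
      _ = C * (|φ ‖z.1‖| * (‖z.1‖ ^ 2 * (‖z.1‖ ^ m)⁻¹) * |b z|) := by ring
      _ ≤ _ := by gcongr; exact hb z hz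
  · rw [hφ.off hz]; simp
  · rw [hA z hz]; simp
  · rw [integral_const_mul, mul_assoc]

lemma Gd.abs {t M : ℝ} {χ : ℝ → ℝ} (h : Gd t M χ) (r : ℝ) : |χ r| ≤ 1 :=
  abs_le.2 ⟨by linarith [(h.2.1 r).1], (h.2.1 r).2⟩

lemma SS0 {τ R : ℝ} {g : ℝ × E3 × E3 → ℝ} {K : Fin 3 → ℝ × E3 × E3 → ℝ}
    {A2 : Z3 → ℝ} {W : Fin 3 → Z3 → ℝ} (hA : Ker 2 R A2) (hW : ∀ l, Ker 1 R (W l)) (hτ : 0 < τ) {M : ℝ}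
    (hM0 : 0 ≤ M) :
    ∃ C, 0 ≤ C ∧ ∀ t ∈ Ioo 0 τ, ∀ x χ, ∀ κ : ℝ → ℝ, Gd t 2 χ → IntegrableOn κ (Ioo 0 t) →
      (∀ z ∈ Om t, |ret t x g z| ≤ M ∧ ∀ l, |ret t x (K l) z| ≤ κ ‖z.1‖) →
      |SS g K A2 W χ t x| ≤ C * (1 + ∫ r in Ioo 0 t, κ r) := by
  obtain ⟨c, c0, bc⟩ := hA.bound
  choose d d0 bd using fun l => (hW l).bound
  have vn := bV_nonneg R
  have dn : 0 ≤ ∑ l, d l := Finset.sum_nonneg fun l _ => d0 l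
  refine ⟨bV R * c * (M * τ) + ∑ l, bV R * d l * (τ * M), add_nonneg (by positivity)
    (Finset.sum_nonneg fun l _ => by have := d0 l; positivity), ?_⟩
  intro t ht x χ κ hχ hκ hb
  have htp := ht.1
  have ik : 0 ≤ ∫ r in Ioo 0 t, κ r := by
    refine setIntegral_nonneg measurableSet_Ioo fun r hr => ?_
    have := ((hb (r • e3 0, 0) ⟨by simpa [e3] using hr.1.ne', by
      simp [norm_smul, norm_e3, abs_of_pos hr.1, hr.2]⟩).2 0)
    simp [norm_smul, norm_e3, abs_of_pos hr.1] at this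
    exact (abs_nonneg _).trans this
  have h1 : |∫ z, χ ‖z.1‖ * A2 z * ret t x g z| ≤ bV R * c * (M * τ) := by
    refine (KB (U := fun _ => M) bc hA.2 hχ.1 (i_const t M ht.1.le).1 (fun z hz => ?_) c0).trans ?_
    · have hn : 0 < ‖z.1‖ := norm_pos_iff.2 hz.1
      rw [mul_inv_cancel₀ (by positivity), mul_one]
      have := mul_le_mul (hχ.abs ‖z.1‖) (hb z hz).1 (abs_nonneg _) zero_le_one
      linarith
    · rw [(i_const t M ht.1.le).2]; gcongr; exact ht.2.le
  have h2 : ∀ l, |∫ z, χ ‖z.1‖ * W l z * ret t x (fun p => K l p * g p) z|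
      ≤ bV R * d l * (τ * M) * ∫ r in Ioo 0 t, κ r := by
    intro l
    refine (KB (U := fun r => τ * M * κ r) (bd l) (hW l).2 hχ.1 (hκ.const_mul _) (fun z hz => ?_)
      (d0 l)).trans ?_
    · have hn : 0 < ‖z.1‖ := norm_pos_iff.2 hz.1
      have e : ‖z.1‖ ^ 2 * (‖z.1‖ ^ 1)⁻¹ = ‖z.1‖ := by field_simp
      have e2 : ret t x (fun p => K l p * g p) z = ret t x (K l) z * ret t x g z := rfl
      rw [e, e2, abs_mul]
      have b1 := (hb z hz).1
      have b2 := (hb z hz).2 l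
      have := hz.2
      have b3 := (abs_nonneg _).trans b2
      calc _ ≤ 1 * τ * (κ ‖z.1‖ * M) := by
            gcongr
            exacts [hχ.abs _, by linarith [ht.2]]
        _ = _ := by ring
    · rw [integral_const_mul]; apply le_of_eq; ring
  rw [SS, add_mul]
  refine (abs_add_le _ _).trans (add_le_add (h1.trans ?_) ((Finset.abs_sum_le_sum_abs _ _).trans ?_))
  · exact le_mul_of_one_le_right (by positivity) (by linarith)
  · rw [Finset.sum_mul]
    refine Finset.sum_le_sum fun l _ => (h2 l).trans ?_
    have := d0 l
    gcongr; linarith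

lemma SS1 {τ R : ℝ} {g : ℝ × E3 × E3 → ℝ} {K : Fin 3 → ℝ × E3 × E3 → ℝ}
    {A2 : Z3 → ℝ} {W : Fin 3 → Z3 → ℝ} (hA : Ker 2 R A2) (hW : ∀ l, Ker 1 R (W l)) (hτ : 0 < τ)
    (hg : ContDiffOn ℝ 1 g (UU τ)) (hK : ∀ l, ContDiffOn ℝ 1 (K l) (UU τ))
    (hV : ∀ p ∈ UU τ, dT g p + ∑ k, vrel p.2.2 k * dX k g p
      = - ∑ l, dV l (fun q => K l q * g q) p) {M N : ℝ} (hM0 : 0 ≤ M) (hN : 0 ≤ N) (i : Fin 3) :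
    ∃ C, 0 ≤ C ∧ ∀ t ∈ Ioo 0 τ, ∀ x χ, ∀ G : ℝ → ℝ, ∀ F, Gd t 2 χ → IntegrableOn G (Ioo 0 t) →
      (∀ r ∈ Ioo 0 t, 0 ≤ G r) → 0 ≤ F →
      (∀ z ∈ Om t, |ret t x g z| ≤ M ∧ |ret t x (dX i g) z| ≤ F ∧ ∀ l, |ret t x (K l) z| ≤ N ∧
        |ret t x (dT (K l)) z| ≤ G ‖z.1‖ ∧
        ∀ k, |ret t x (dX k (K l)) z| ≤ G ‖z.1‖ ∧ |ret t x (dV k (K l)) z| ≤ N) →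
      DifferentiableAt ℝ (SS g K A2 W χ t) x ∧
      |fderiv ℝ (SS g K A2 W χ t) x (e3 i)|
        ≤ C * (1 + Real.log (1 + F) + ∫ r in Ioo 0 t, G r) := by
  obtain ⟨c, c0, bc⟩ := hA.bound
  choose d d0 bd using fun l => (hW l).bound
  have vn := bV_nonneg R
  obtain ⟨a, a0, ha⟩ := div_bound hA i hg hK hV
  choose b b0 hb using fun l => div_bound (hW l) i hg hK hV
  let c1 := bV R * c * 2
  let c2 := a * (M * (3 + 2 * τ + N * τ + 2))
  let c3 := fun l => bV R * d l * (τ * M)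
  let c4 := fun l => b l * (M * (τ * N * 2 + 2 * τ + (N + 2 * N ^ 2 * τ) * τ))
  have p1 : 0 ≤ c1 := by positivity
  have p2 : 0 ≤ c2 := by positivity
  have p3 : ∀ l, 0 ≤ c3 l := fun l => by have := d0 l; positivity
  have p4 : ∀ l, 0 ≤ c4 l := fun l => by have := b0 l; positivity
  refine ⟨c1 + c2 + ∑ l, (c3 l + c4 l), add_nonneg (by positivity)
    (Finset.sum_nonneg fun l _ => add_nonneg (p3 l) (p4 l)), ?_⟩
  intro t ht x χ G F hχ hG hG0 hF H
  have htp := ht.1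
  have htt := ht.2.le
  set I := ∫ r in Ioo 0 t, G r with hI
  have I0 : 0 ≤ I := setIntegral_nonneg measurableSet_Ioo hG0
  have l0 : 0 ≤ Real.log (1 + F) := Real.log_nonneg (by linarith)
  set ℓ := Real.log (1 + F) with hℓ
  have aA : Adm 0 t fun z => χ ‖z.1‖ * A2 z := by
    simpa using hA.adm hχ.1 (n := 0) (by simp) (q := fun _ => 1) contDiffOn_const
  have aW : ∀ l, Adm 0 t fun z => χ ‖z.1‖ * W l z := fun l => by
    simpa using (hW l).adm hχ.1 (n := 0) (by simp) (q := fun _ => 1) contDiffOn_const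
  have D1 := aA.ret_int_deriv htt hg x
  have D2 := fun l => (aW l).ret_int_deriv htt ((hK l).mul hg) x
  have e : SS g K A2 W χ t = fun x => (∫ z, χ ‖z.1‖ * A2 z * ret t x g z)
    + ∑ l, ∫ z, χ ‖z.1‖ * W l z * ret t x (fun p => K l p * g p) z := rfl
  have HD := D1.1.hasFDerivAt.fun_add (HasFDerivAt.fun_sum fun l (_ : l ∈ Finset.univ) =>
    (D2 l).1.hasFDerivAt)
  rw [e]
  refine ⟨HD.differentiableAt, ?_⟩
  rw [HD.fderiv, add_apply, sum_apply, D1.2 i]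
  simp only [fun l => (D2 l).2 i]
  have nn : ∀ z ∈ Om t, 0 < ‖z.1‖ := fun z hz => norm_pos_iff.2 hz.1
  -- near and far parts
  let δ := (1 + F)⁻¹
  have hδ : 0 < δ := by positivity
  have hφ := hχ.mulcu (c := δ) (d := δ) htp.le hδ
  have rN : RC t fun r => χ r * (1 - cu δ δ r) :=
    hχ.1.mul (contDiff_const.sub (cu_cd δ δ (n := ⊤))).contDiffOn
  have T1 : |∫ z, (χ ‖z.1‖ * (1 - cu δ δ ‖z.1‖)) * A2 z * ret t x (dX i g) z| ≤ c1 := by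
    refine (KB (φ := fun r => χ r * (1 - cu δ δ r)) bc hA.2 rN
      ((i_ind (t := t) (d := 2 * δ) (by positivity)).1.const_mul F)
      (fun z hz => ?_) c0).trans ?_
    · have hn := nn z hz
      rw [mul_inv_cancel₀ (by positivity), mul_one]
      by_cases h : ‖z.1‖ ≤ 2 * δ
      · rw [indicator_of_mem (by exact h), mul_one, abs_mul]
        have h2 : |1 - cu δ δ ‖z.1‖| ≤ 1 := abs_le.2 ⟨by linarith [cu_le δ δ ‖z.1‖], by
          linarith [cu_nn δ δ ‖z.1‖]⟩
        calc _ ≤ 1 * 1 * F := by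
              gcongr
              exacts [hχ.abs _, (H z hz).2.1]
          _ = F := by ring
      · rw [cu_one hδ (by linarith)]; simp
        exact mul_nonneg hF (indicator_nonneg (by simp) _)
    · rw [integral_const_mul]
      have := (i_ind (t := t) (d := 2 * δ) (by positivity)).2
      have h3 : F * δ ≤ 1 := by
        simp only [δ]; rw [← div_eq_mul_inv]; exact div_le_one_of_le₀ (by linarith) (by linarith)
      calc _ ≤ bV R * c * (F * (2 * δ)) := by gcongr
        _ = bV R * c * 2 * (F * δ) := by ring
        _ ≤ bV R * c * 2 * 1 := by gcongr
        _ = c1 := by simp only [c1]; ring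
  have T2 : |∫ z, (χ ‖z.1‖ * cu δ δ ‖z.1‖) * A2 z * ret t x (dX i g) z| ≤ c2 * (1 + ℓ) := by
    have il := i_log htp.le hδ
    have ic := i_const t N htp.le
    have := ha t htt x (fun r => χ r * cu δ δ r) (fun _ => 1)
      (fun r => |deriv (fun r => χ r * cu δ δ r) r| + 2 * (r + δ)⁻¹ + N) (fun _ => 0) 1 0 M N hφ.1
      contDiffOn_const ((hφ.2.2.1.add (il.1.const_mul 2)).add ic.1) hN le_rfl
      (fun z hz => ⟨(H z hz).1, by simp, fun l => ⟨((H z hz).2.2 l).1, by simp, by simp⟩⟩) ?_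
    · simp only [mul_one] at this
      refine this.trans ?_
      rw [integral_add (by exact hφ.2.2.1.add (il.1.const_mul 2)) ic.1,
        integral_add hφ.2.2.1 (by exact il.1.const_mul 2), integral_const_mul, il.2, ic.2]
      have hl : Real.log (1 + t / δ) ≤ τ + ℓ := by
        calc _ ≤ Real.log ((1 + τ) * (1 + F)) := by
              apply Real.log_le_log (by positivity)
              simp only [δ, div_inv_eq_mul]
              nlinarith
          _ = Real.log (1 + τ) + ℓ := Real.log_mul (by positivity) (by positivity)
          _ ≤ _ := by linarith [Real.log_le_sub_one_of_pos (show 0 < 1 + τ by linarith)]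
      have h4 := hφ.2.2.2
      have h5 : N * t ≤ N * τ := by gcongr
      calc _ ≤ a * (M * (3 + 2 * (τ + ℓ) + N * τ)) := by gcongr; linarith
        _ ≤ a * (M * ((3 + 2 * τ + N * τ + 2) * (1 + ℓ))) := by
          gcongr
          have : 0 ≤ (3 + 2 * τ + N * τ) * ℓ := by positivity
          linarith
        _ = _ := by simp only [c2]; ring
    · intro r hr
      have hr0 := hr.1
      rw [mul_inv_cancel₀ (by positivity)]
      have e3 : r ^ 2 * (r ^ (2 + 1))⁻¹ = r⁻¹ := by field_simp
      have h6 : |χ r * cu δ δ r| * r⁻¹ ≤ 2 * (r + δ)⁻¹ := by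
        by_cases h : r ≤ δ
        · rw [cu_zero hδ h]; simp; positivity
        · calc _ ≤ 1 * r⁻¹ := by gcongr; exact hφ.abs r
            _ ≤ _ := by
              rw [one_mul, ← div_eq_mul_inv, inv_eq_one_div, div_le_div_iff₀ hr0 (by positivity)]
              linarith
      have h7 := mul_le_mul_of_nonneg_left (hφ.abs r) hN
      rw [e3]; simp only [mul_one, zero_add, one_mul]
      linarith
  have T12 : (∫ z, χ ‖z.1‖ * A2 z * ret t x (dX i g) z)
      = (∫ z, (χ ‖z.1‖ * (1 - cu δ δ ‖z.1‖)) * A2 z * ret t x (dX i g) z)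
      + ∫ z, (χ ‖z.1‖ * cu δ δ ‖z.1‖) * A2 z * ret t x (dX i g) z := by
    have hc : ContinuousOn (ret t x (dX i g)) (Om t) :=
      ret_cont htt x (cd_fderiv_cont (UU_open τ) hg (0, e3 i, 0))
    rw [← integral_add]
    · congr 1; ext z; ring
    · simpa using (hA.adm rN (n := 0) (by simp) (q := fun _ => 1) contDiffOn_const).integrable_mul hc
    · simpa using (hA.adm hφ.1 (n := 0) (by simp) (q := fun _ => 1) contDiffOn_const).integrable_mul hc
  have T3 : ∀ l, |∫ z, χ ‖z.1‖ * W l z * (ret t x (dX i (K l)) z * ret t x g z)| ≤ c3 l * I := by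
    intro l
    refine (KB (U := fun r => τ * M * G r) (bd l) (hW l).2 hχ.1 (hG.const_mul _) (fun z hz => ?_)
      (d0 l)).trans ?_
    · have hn := nn z hz
      have e : ‖z.1‖ ^ 2 * (‖z.1‖ ^ 1)⁻¹ = ‖z.1‖ := by field_simp
      rw [e, abs_mul]
      have b1 := (H z hz).1
      have b2 := (((H z hz).2.2 l).2.2 i).1
      have := hz.2
      have b3 := (abs_nonneg _).trans b2
      calc _ ≤ 1 * τ * (G ‖z.1‖ * M) := by
            gcongr
            exacts [hχ.abs _, by linarith [ht.2]]
        _ = _ := by ring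
    · rw [integral_const_mul]; apply le_of_eq; simp only [c3]; ring
  have T4 : ∀ l, |∫ z, χ ‖z.1‖ * ret t x (K l) z * W l z * ret t x (dX i g) z| ≤ c4 l * (1 + I) := by
    intro l
    have ic := i_const t (N + 2 * N ^ 2 * τ) htp.le
    have := hb l t htt x χ (ret t x (K l))
      (fun r => (τ * N) * |deriv χ r| + 2 * τ * G r + (N + 2 * N ^ 2 * τ)) (fun r => 2 * G r) N N M N
      hχ.1 (ret_cd htt x (hK l)) (by exact ((hχ.2.2.1.const_mul (τ * N)).add (hG.const_mul (2 * τ))).add ic.1) hN hN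
      (fun z hz => ⟨(H z hz).1, ((H z hz).2.2 l).1, fun k => ⟨((H z hz).2.2 k).1, ?_, ?_⟩⟩) ?_
    · refine this.trans ?_
      rw [integral_add (by exact (hχ.2.2.1.const_mul _).add (hG.const_mul _)) ic.1,
        integral_add (by exact hχ.2.2.1.const_mul _) (by exact hG.const_mul _), integral_const_mul,
        integral_const_mul, ic.2, ← hI]
      have h4 := hχ.2.2.2
      have bl := b0 l
      calc _ ≤ b l * (M * (τ * N * 2 + 2 * τ * I + (N + 2 * N ^ 2 * τ) * τ)) := by gcongr
        _ ≤ b l * (M * ((τ * N * 2 + 2 * τ + (N + 2 * N ^ 2 * τ) * τ) * (1 + I))) := by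
          gcongr
          have : 0 ≤ (τ * N * 2 + (N + 2 * N ^ 2 * τ) * τ) * I := by positivity
          nlinarith
        _ = _ := by simp only [c4]; ring
    · rw [ret_dy htt x (hK l) hz]
      obtain ⟨-, -, q⟩ := H z hz
      have q1 := (q l).2.1
      have q2 := ((q l).2.2 k).1
      have q3 := abs_om_le k z.1
      have : |om k z.1 * ret t x (dT (K l)) z| ≤ G ‖z.1‖ := by
        rw [abs_mul]
        have := mul_le_mul q3 q1 (abs_nonneg _) zero_le_one
        linarith
      have := abs_sub (ret t x (dX k (K l)) z) (om k z.1 * ret t x (dT (K l)) z)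
      linarith
    · rw [ret_dxi htt x (hK l) hz]; exact (((H z hz).2.2 l).2.2 k).2
    · intro r hr
      have hr0 := hr.1
      have hrτ : r ≤ τ := by linarith [hr.2]
      have e1 : r ^ 2 * (r ^ 1)⁻¹ = r := by field_simp
      have e2 : r ^ 2 * (r ^ (1 + 1))⁻¹ = 1 := by field_simp
      rw [e1, e2]
      have := hG0 r hr
      have hx := hχ.abs r
      calc _ ≤ |deriv χ r| * N * τ + 1 * (2 * G r * τ + N * 1) + N * 1 * (N + N) * τ := by gcongr
        _ = _ := by ring
  have T34 : ∀ l, |∫ z, χ ‖z.1‖ * W l z * ret t x (dX i fun p => K l p * g p) z|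
      ≤ c3 l * I + c4 l * (1 + I) := by
    intro l
    have hc1 := ret_cont htt x (cd_fderiv_cont (UU_open τ) hg (0, e3 i, 0))
    have hc2 := ret_cont htt x (cd_fderiv_cont (UU_open τ) (hK l) (0, e3 i, 0))
    have hc3 := ret_cont htt x hg.continuousOn
    have hc4 := ret_cont htt x (hK l).continuousOn
    have ee : (∫ z, χ ‖z.1‖ * W l z * ret t x (dX i fun p => K l p * g p) z)
      = (∫ z, χ ‖z.1‖ * W l z * (ret t x (dX i (K l)) z * ret t x g z))
        + ∫ z, χ ‖z.1‖ * ret t x (K l) z * W l z * ret t x (dX i g) z := by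
      rw [← integral_add]
      · congr 1; ext z
        by_cases hz : z ∈ Om t
        · have m := ret_mem htt x hz
          have h1 := cd_diff (UU_open τ) hg m
          have h2 := cd_diff (UU_open τ) (hK l) m
          have : ret t x (dX i fun p => K l p * g p) z
            = ret t x (K l) z * ret t x (dX i g) z + ret t x (dX i (K l)) z * ret t x g z := by
            simp only [ret, dX]
            rw [(h2.fun_mul h1).fderiv]; simp; ring
          rw [this]; ring
        · rw [hχ.1.off hz]; simp
      · exact (aW l).integrable_mul (hc2.mul hc3)
      · refine ((aW l).integrable_mul (hc4.mul hc1)).congr (ae_of_all _ fun z => ?_)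
        beta_reduce; simp only [Pi.mul_apply]; ring_nf; rfl
    rw [ee]
    exact (abs_add_le _ _).trans (add_le_add (T3 l) (T4 l))
  rw [T12, add_mul]
  refine (abs_add_le _ _).trans (add_le_add ((abs_add_le _ _).trans ?_)
    ((Finset.abs_sum_le_sum_abs _ _).trans ?_))
  · refine (add_le_add T1 T2).trans ?_
    have : 0 ≤ c1 * (ℓ + I) := by positivity
    have : 0 ≤ c2 * I := by positivity
    nlinarith
  · rw [Finset.sum_mul]
    refine Finset.sum_le_sum fun l _ => (T34 l).trans ?_
    have h3 := p3 l
    have h4 := p4 l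
    have : 0 ≤ c3 l * (1 + ℓ) := by positivity
    have : 0 ≤ c4 l * ℓ := by positivity
    nlinarith

lemma absorb {S : Set (ℝ × E3)} {m : ℝ × E3 → ℝ} {C l B : ℝ} (hC : 0 ≤ C) (hl : 0 ≤ l)
    (hS : ∀ p ∈ S, 0 ≤ p.1) (hm : ∀ p ∈ S, 0 ≤ m p) (hB : ∀ p ∈ S, m p ≤ B)
    (H : ∀ N, 0 ≤ N → (∀ p ∈ S, m p ≤ N * exp (l * p.1)) → ∀ p ∈ S, m p ≤ C + N / 2 * exp (l * p.1)) :
    ∀ p ∈ S, m p ≤ 2 * C * exp (l * p.1) := by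
  rcases S.eq_empty_or_nonempty with rfl | hne
  · simp
  have hE : ∀ p ∈ S, 1 ≤ exp (l * p.1) := fun p hp => one_le_exp (mul_nonneg hl (hS p hp))
  set A := (fun p => m p * exp (-(l * p.1))) '' S
  have hbd : BddAbove A := by
    refine ⟨B, ?_⟩
    rintro _ ⟨p, hp, rfl⟩
    refine le_trans ?_ (hB p hp)
    have : exp (-(l * p.1)) ≤ 1 := exp_le_one_iff.2 (by have := mul_nonneg hl (hS p hp); linarith)
    exact mul_le_of_le_one_right (hm p hp) this
  have hN : ∀ p ∈ S, m p ≤ sSup A * exp (l * p.1) := fun p hp => by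
    have := le_csSup hbd ⟨p, hp, rfl⟩
    have h2 := mul_le_mul_of_nonneg_right this (exp_pos (l * p.1)).le
    rwa [mul_assoc, ← exp_add, neg_add_cancel, exp_zero, mul_one] at h2
  have hN0 : 0 ≤ sSup A := by
    obtain ⟨p, hp⟩ := hne
    exact le_trans (mul_nonneg (hm p hp) (exp_pos _).le) (le_csSup hbd ⟨p, hp, rfl⟩)
  have h1 := H _ hN0 hN
  have h2 : sSup A ≤ C + sSup A / 2 := by
    refine csSup_le (hne.image _) ?_
    rintro _ ⟨p, hp, rfl⟩
    have h3 := mul_le_mul_of_nonneg_right (h1 p hp) (exp_pos (-(l * p.1))).le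
    rw [add_mul, mul_assoc, ← exp_add, add_neg_cancel, exp_zero, mul_one] at h3
    refine h3.trans ?_
    have : exp (-(l * p.1)) ≤ 1 := exp_le_one_iff.2 (by have := mul_nonneg hl (hS p hp); linarith)
    have := mul_le_of_le_one_right hC this
    linarith
  intro p hp
  refine (hN p hp).trans ?_
  gcongr; linarith

def nd (z z' : Z3) : ℝ := ‖z.1 - z'.1‖ ^ 2 + ‖z.2 - z'.2‖ ^ 2

lemma line_norm (a b : E3) : HasDerivAt (fun θ : ℝ => ‖a - θ • b‖ ^ 2) (-2 * ⟪a, b⟫) 0 := by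
  have h : HasDerivAt (fun θ : ℝ => a - θ • b) (-b) 0 := by
    have := ((hasDerivAt_id (0 : ℝ)).smul_const b).const_sub a
    simpa using this
  refine h.norm_sq.congr_deriv ?_
  simp

lemma dbl {τ t1 R : ℝ} (ht : t1 < τ) {g : ℝ × E3 × E3 → ℝ}
    (hgc : ContinuousOn g (Ico 0 τ ×ˢ univ)) (hg : ContDiffOn ℝ 1 g (UU τ))
    {KK : ℝ × E3 × E3 → E3} (htr : ∀ p ∈ UU τ, fderiv ℝ g p (1, vrel p.2.2, KK p) = 0)
    (hKs : ∀ p ∈ UU τ, R < ‖p.2.2‖ → KK p = 0) {P P' : ℝ → ℝ} (hP : ∀ s, HasDerivAt P (P' s) s)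
    {x1 : E3} {η α β M : ℝ} (h0 : ∀ z z', α * g (0, z) - β * g (0, z') - P 0 * nd z z' ≤ M)
    (hL : ∀ s ∈ Ioc 0 t1, ∀ z z' : Z3, ‖z.1 - x1‖ ≤ η + t1 - s → ‖z'.1 - x1‖ ≤ η + t1 - s →
      -(2 * P s * (⟪z.1 - z'.1, vrel z.2 - vrel z'.2⟫ + ⟪z.2 - z'.2, KK (s, z) - KK (s, z')⟫))
        ≤ P' s * nd z z') (t0 : 0 ≤ t1) (z z' : Z3) (hz : ‖z.1 - x1‖ ≤ η) (hz' : ‖z'.1 - x1‖ ≤ η)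
    (hx : ‖z.2‖ ≤ R + 1) (hx' : ‖z'.2‖ ≤ R + 1) :
    α * g (t1, z) - β * g (t1, z') - P t1 * nd z z' ≤ M := by
  set S : Set (ℝ × Z3 × Z3) := {q | q.1 ∈ Icc 0 t1 ∧ (‖q.2.1.1 - x1‖ ≤ η + t1 - q.1 ∧
    ‖q.2.2.1 - x1‖ ≤ η + t1 - q.1) ∧ ‖q.2.1.2‖ ≤ R + 1 ∧ ‖q.2.2.2‖ ≤ R + 1} with hS
  have hSc : IsCompact S := by
    have hK : IsCompact (closedBall x1 (η + t1) ×ˢ closedBall (0 : E3) (R + 1)) :=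
      (isCompact_closedBall _ _).prod (isCompact_closedBall _ _)
    refine ((isCompact_Icc (a := (0 : ℝ)) (b := t1)).prod (hK.prod hK)).of_isClosed_subset ?_ ?_
    · simp only [hS, mem_Icc, ofPred_and]
      refine IsClosed.inter (IsClosed.inter ?_ ?_) (IsClosed.inter (IsClosed.inter ?_ ?_)
        (IsClosed.inter ?_ ?_)) <;> apply isClosed_le <;> fun_prop
    · rintro q ⟨h1, ⟨h2, h3⟩, h4, h5⟩
      simp only [mem_prod, mem_closedBall, dist_eq_norm, sub_zero]
      exact ⟨h1, ⟨by linarith [h1.1], h4⟩, by linarith [h1.1], h5⟩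
  suffices H : ∀ σ > 0, α * g (t1, z) - β * g (t1, z') - P t1 * nd z z' ≤ M + σ * t1 by
    refine le_of_forall_pos_le_add fun ε hε => (H (ε / (t1 + 1)) (by positivity)).trans ?_
    have : ε / (t1 + 1) * t1 ≤ ε := by
      rw [div_mul_eq_mul_div, div_le_iff₀ (by linarith)]; nlinarith
    linarith
  intro σ hσ
  set Φ : ℝ × Z3 × Z3 → ℝ := fun q => α * g (q.1, q.2.1) - β * g (q.1, q.2.2) - P q.1 * nd q.2.1 q.2.2
    - σ * q.1 with hΦ
  have hPc : Continuous P := continuous_iff_continuousAt.2 fun s => (hP s).continuousAt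
  have hΦc : ContinuousOn Φ S := by
    have m1 : ∀ q ∈ S, (q.1, q.2.1) ∈ Ico 0 τ ×ˢ (univ : Set Z3) := fun q hq =>
      ⟨⟨hq.1.1, hq.1.2.trans_lt ht⟩, trivial⟩
    have m2 : ∀ q ∈ S, (q.1, q.2.2) ∈ Ico 0 τ ×ˢ (univ : Set Z3) := fun q hq =>
      ⟨⟨hq.1.1, hq.1.2.trans_lt ht⟩, trivial⟩
    have c1 := hgc.comp (f := fun q : ℝ × Z3 × Z3 => (q.1, q.2.1)) (by fun_prop) m1
    have c2 := hgc.comp (f := fun q : ℝ × Z3 × Z3 => (q.1, q.2.2)) (by fun_prop) m2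
    refine (((continuousOn_const.mul c1).sub (continuousOn_const.mul c2)).sub ?_).sub ?_
    · simp only [nd]; exact Continuous.continuousOn (by fun_prop)
    · exact Continuous.continuousOn (by fun_prop)
  have hzS : (t1, z, z') ∈ S := ⟨⟨t0, le_rfl⟩, ⟨by simpa using hz, by simpa using hz'⟩, hx, hx'⟩
  obtain ⟨⟨s, w, w'⟩, hq, hmax⟩ := hSc.exists_isMaxOn ⟨_, hzS⟩ hΦc
  have hmz : α * g (t1, z) - β * g (t1, z') - P t1 * nd z z' - σ * t1 ≤ Φ (s, w, w') := hmax hzS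
  suffices hs : s = 0 by
    subst hs
    have := h0 w w'
    simp only [hΦ, mul_zero, sub_zero] at hmz
    linarith
  by_contra hs
  obtain ⟨⟨hs0, hs1⟩, ⟨hw, hw'⟩, hv, hv'⟩ := hq
  simp only at hs0 hs1 hw hw' hv hv'
  have hsp : 0 < s := lt_of_le_of_ne hs0 (Ne.symm hs)
  have mU : ∀ u : Z3, (s, u) ∈ UU τ := fun u => ⟨⟨hsp, by linarith⟩, trivial⟩
  have dg : ∀ u : Z3, HasDerivAt (fun θ : ℝ => g (s - θ, u.1 - θ • vrel u.2, u.2 - θ • KK (s, u))) 0 0 := by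
    intro u
    have := (cd_diff (UU_open τ) hg (mU u)).hasLineDerivAt (-(1, vrel u.2, KK (s, u)))
    rw [map_neg, htr _ (mU u), neg_zero] at this
    refine HasDerivAt.congr_of_eventuallyEq this (Eventually.of_forall fun θ => ?_)
    obtain ⟨u, v⟩ := u
    simp [sub_eq_add_neg]
  have d1 : HasDerivAt (fun θ : ℝ => P (s - θ)) (-P' s) 0 := by
    have h := (hasDerivAt_id (0 : ℝ)).const_sub s
    have := HasDerivAt.comp (0 : ℝ) (by simpa using hP s) h
    simpa [Function.comp_def] using this
  have d2 : HasDerivAt (fun θ : ℝ => σ * (s - θ)) (-σ) 0 := by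
    have h := ((hasDerivAt_id (0 : ℝ)).const_sub s).const_mul σ
    simpa using h
  have d3 := (line_norm (w.1 - w'.1) (vrel w.2 - vrel w'.2)).add
    (line_norm (w.2 - w'.2) (KK (s, w) - KK (s, w')))
  have dd := ((((dg w).const_mul α).sub ((dg w').const_mul β)).sub (d1.mul d3)).sub d2
  have key := hL s ⟨hsp, hs1⟩ w w' hw hw'
  have hn : nd w w' = ‖w.1 - w'.1‖ ^ 2 + ‖w.2 - w'.2‖ ^ 2 := rfl
  have dpos := dd.congr_deriv (g' := σ + (P' s * nd w w' + 2 * P s * (⟪w.1 - w'.1, vrel w.2 - vrel w'.2⟫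
    + ⟪w.2 - w'.2, KK (s, w) - KK (s, w')⟫))) (by simp [hn]; ring)
  have ev1 := (hasDerivAt_iff_tendsto_slope.1 dpos).eventually (lt_mem_nhds (by linarith : (0 : ℝ) < _))
  have ev1' : ∀ᶠ θ in 𝓝[>] (0 : ℝ), _ := ev1.filter_mono (nhdsWithin_mono _ fun x hx => ne_of_gt hx)
  have evx : ∀ u : Z3, ‖u.2‖ ≤ R + 1 → ∀ᶠ θ in 𝓝[>] (0 : ℝ), ‖u.2 - θ • KK (s, u)‖ ≤ R + 1 := by
    intro u hu
    by_cases h : R < ‖u.2‖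
    · simp [hKs _ (mU u) h, hu]
    · have : ContinuousAt (fun θ : ℝ => ‖u.2 - θ • KK (s, u)‖) 0 := by fun_prop
      have := this.eventually_lt (continuousAt_const (y := R + 1)) (by rw [zero_smul, sub_zero]; linarith)
      exact (this.filter_mono nhdsWithin_le_nhds).mono fun θ h => le_of_lt h
  have evy : ∀ u : Z3, ‖u.1 - x1‖ ≤ η + t1 - s → ∀ θ > 0, ‖u.1 - θ • vrel u.2 - x1‖ ≤ η + t1 - (s - θ) := by
    intro u hu θ hθ
    have h1 : ‖θ • vrel u.2‖ ≤ θ := by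
      rw [norm_smul, Real.norm_eq_abs, abs_of_pos hθ]
      exact mul_le_of_le_one_right hθ.le (vrel_lt _).le
    have h2 := norm_sub_le (u.1 - x1) (θ • vrel u.2)
    rw [sub_right_comm]; linarith
  have ev2 : ∀ᶠ θ in 𝓝[>] (0 : ℝ), θ ∈ Ioo 0 s := Ioo_mem_nhdsGT hsp
  obtain ⟨θ, h1, h2, h3, h4⟩ := (ev1'.and (ev2.and ((evx w hv).and (evx w' hv')))).exists
  have hin : (s - θ, (w.1 - θ • vrel w.2, w.2 - θ • KK (s, w)),
      (w'.1 - θ • vrel w'.2, w'.2 - θ • KK (s, w'))) ∈ S :=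
    ⟨⟨by linarith [h2.2], by linarith [h2.1]⟩, ⟨evy w hw θ h2.1, evy w' hw' θ h2.1⟩, h3, h4⟩
  have hle := hmax hin
  simp only [hΦ, mem_ofPred_eq, nd] at hle
  rw [slope_pos_iff_of_le h2.1.le] at h1
  simp only [Pi.sub_apply, Pi.mul_apply, Pi.add_apply, zero_smul, sub_zero] at h1
  have a1 : w.1 - θ • vrel w.2 - (w'.1 - θ • vrel w'.2) = w.1 - w'.1 - θ • (vrel w.2 - vrel w'.2) := by
    module
  have a2 : w.2 - θ • KK (s, w) - (w'.2 - θ • KK (s, w')) = w.2 - w'.2 - θ • (KK (s, w) - KK (s, w')) := by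
    module
  rw [a1, a2] at hle
  linarith

section lay
variable {X : Type*} [NormedAddCommGroup X]

/-- bounded Lipschitz data -/
def LD (φ : X → ℝ) : Prop := ∃ L, 0 ≤ L ∧ ∀ x, |φ x| ≤ L ∧ ∀ h, |φ (x + h) - φ x| ≤ L * ‖h‖

def LY (u : ℝ × X → ℝ) : Prop := ∃ L, 0 ≤ L ∧ Lay L u

lemma Lay.mono {L L' : ℝ} {u : ℝ × X → ℝ} (h : Lay L u) (hL : L ≤ L') : Lay L' u := by
  intro ρ k ε hε
  filter_upwards [h ρ k ε hε] with s hs x hx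
  obtain ⟨h1, h2⟩ := hs x hx
  exact ⟨by linarith, h2.trans (by gcongr)⟩

lemma LY.add {u v : ℝ × X → ℝ} (h : LY u) (h' : LY v) : LY (fun p => u p + v p) := by
  obtain ⟨L, hL, h⟩ := h
  obtain ⟨M, hM, h'⟩ := h'
  refine ⟨L + M, by positivity, fun ρ k ε hε => ?_⟩
  filter_upwards [h ρ k (ε / 2) (by positivity), h' ρ k (ε / 2) (by positivity)] with s hs hs' x hx
  obtain ⟨h1, h2⟩ := hs x hx
  obtain ⟨h3, h4⟩ := hs' x hx
  simp only [abs_le] at *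
  constructor <;> constructor <;> linarith

lemma LY.const_mul {u : ℝ × X → ℝ} (h : LY u) (c : ℝ) : LY (fun p => c * u p) := by
  obtain ⟨L, hL, h⟩ := h
  refine ⟨|c| * L, by positivity, fun ρ k ε hε => ?_⟩
  have hc : |c| * (ε / (|c| + 1)) ≤ ε := by
    rw [mul_div_assoc', div_le_iff₀ (by positivity)]; nlinarith [abs_nonneg c]
  filter_upwards [h ρ k (ε / (|c| + 1)) (by positivity)] with s hs x hx
  obtain ⟨h1, h2⟩ := hs x hx
  rw [← mul_sub, abs_mul, abs_mul]
  constructor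
  · nlinarith [mul_le_mul_of_nonneg_left h1 (abs_nonneg c)]
  · nlinarith [mul_le_mul_of_nonneg_left h2 (abs_nonneg c)]

lemma LY.sum {ι : Type*} (S : Finset ι) {u : ι → ℝ × X → ℝ} (h : ∀ i, LY (u i)) :
    LY (fun p => ∑ i ∈ S, u i p) := by
  classical
  induction S using Finset.induction_on with
  | empty =>
    refine ⟨0, le_rfl, fun ρ k ε hε => Eventually.of_forall fun s x _ => ?_⟩
    simp [hε.le]
  | insert a S ha ih =>
    simp only [Finset.sum_insert ha]
    exact (h a).add ih

lemma LY.congr {u v : ℝ × X → ℝ} {τ : ℝ} (hτ : 0 < τ) (h : LY u) (e : ∀ s ∈ Ioo 0 τ, ∀ x, v (s, x) = u (s, x)) :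
    LY v := by
  obtain ⟨L, hL, h⟩ := h
  refine ⟨L, hL, fun ρ k ε hε => ?_⟩
  filter_upwards [h ρ k ε hε, Ioo_mem_nhdsGT hτ] with s hs h' x hx
  rw [e s h', e s h']
  exact hs x hx

lemma LY_of [ProperSpace X] {u : ℝ × X → ℝ} {τ : ℝ} (hτ : 0 < τ) (hu : ContinuousOn u (Ico 0 τ ×ˢ univ))
    (h : LD (fun x => u (0, x))) : LY u := by
  obtain ⟨L, hL, h⟩ := h
  refine ⟨L, hL, fun ρ k ε hε => ?_⟩
  have hc : IsCompact (Icc 0 (τ / 2) ×ˢ closedBall (0 : X) (ρ + ‖k‖)) :=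
    isCompact_Icc.prod (isCompact_closedBall _ _)
  have hU := hc.uniformContinuousOn_of_continuous (hu.mono (prod_mono (fun s hs => ⟨hs.1, by linarith [hs.2]⟩)
    (subset_univ _)))
  obtain ⟨δ, hδ, H⟩ := Metric.uniformContinuousOn_iff.1 hU (ε / 2) (by positivity)
  filter_upwards [Ioo_mem_nhdsGT hδ, Ioo_mem_nhdsGT (half_pos hτ)] with s h1 h2 x hx
  have key : ∀ y : X, ‖y‖ ≤ ρ + ‖k‖ → |u (s, y) - u (0, y)| < ε / 2 := fun y hy => by
    have := H (s, y) ⟨⟨h2.1.le, h2.2.le⟩, by simpa using hy⟩ (0, y) ⟨⟨le_rfl, (half_pos hτ).le⟩, by simpa using hy⟩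
      (by simp [Prod.dist_eq, abs_of_pos h1.1, h1.2, hδ])
    rwa [Real.dist_eq] at this
  have k1 := key x (by linarith [norm_nonneg k])
  have k2 := key (x + k) (by linarith [norm_add_le x k])
  have k3 := (h x).1
  have k4 := (h x).2 k
  simp only [abs_le, abs_lt] at *
  constructor <;> constructor <;> linarith

variable [NormedSpace ℝ X]

lemma ext_f {u : ℝ × X → ℝ} {τ : ℝ} (hτ : 0 < τ) (hu : ContDiffOn ℝ 1 u (Ico 0 τ ×ˢ univ)) :
    ∃ D : ℝ × X → ℝ × X →L[ℝ] ℝ, ContinuousOn D (Ico 0 τ ×ˢ univ) ∧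
      (∀ s ∈ Ioo 0 τ, ∀ x, fderiv ℝ u (s, x) = D (s, x)) ∧
      ∀ x, HasFDerivAt (fun y => u (0, y)) ((D (0, x)).comp (ContinuousLinearMap.inr ℝ ℝ X)) x := by
  have hU : UniqueDiffOn ℝ (Ico 0 τ ×ˢ (univ : Set X)) := (uniqueDiffOn_Ico 0 τ).prod uniqueDiffOn_univ
  refine ⟨fderivWithin ℝ u (Ico 0 τ ×ˢ univ), hu.continuousOn_fderivWithin hU le_rfl, fun s hs x => ?_,
    fun x => ?_⟩
  · rw [fderivWithin_of_mem_nhds]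
    exact prod_mem_nhds (Ico_mem_nhds hs.1 hs.2) univ_mem
  · have h1 := (hu.differentiableOn one_ne_zero (0, x) ⟨⟨le_rfl, hτ⟩, trivial⟩).hasFDerivWithinAt
    have h2 : HasFDerivWithinAt (fun y : X => ((0 : ℝ), y)) (ContinuousLinearMap.inr ℝ ℝ X) univ x :=
      (hasFDerivAt_prodMk_right (0 : ℝ) x).hasFDerivWithinAt
    exact hasFDerivWithinAt_univ.1 (h1.comp x h2 fun y _ => ⟨⟨le_rfl, hτ⟩, trivial⟩)

lemma bdd_f [ProperSpace X] {u : ℝ × X → ℝ} {τ T : ℝ} (hτ : 0 < τ) (hu : ContDiffOn ℝ 1 u (Ico 0 τ ×ˢ univ))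
    (hT : T < τ) (ρ : ℝ) :
    ∃ B, ∀ s ∈ Ioc 0 T, ∀ x, ‖x‖ ≤ ρ → |u (s, x)| ≤ B ∧ ‖fderiv ℝ u (s, x)‖ ≤ B := by
  obtain ⟨D, hD, e, -⟩ := ext_f hτ hu
  have hc : IsCompact (Icc 0 T ×ˢ closedBall (0 : X) ρ) := isCompact_Icc.prod (isCompact_closedBall _ _)
  have hs : Icc 0 T ×ˢ closedBall (0 : X) ρ ⊆ Ico 0 τ ×ˢ univ :=
    prod_mono (fun s hs => ⟨hs.1, by linarith [hs.2]⟩) (subset_univ _)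
  obtain ⟨B, hB⟩ := hc.exists_bound_of_continuousOn (hu.continuousOn.mono hs)
  obtain ⟨B', hB'⟩ := hc.exists_bound_of_continuousOn (hD.mono hs)
  refine ⟨max B B', fun s h x hx => ?_⟩
  have hm : (s, x) ∈ Icc 0 T ×ˢ closedBall (0 : X) ρ := ⟨⟨h.1.le, h.2⟩, by simpa using hx⟩
  rw [e s ⟨h.1, by linarith [h.2]⟩]
  exact ⟨(hB _ hm).trans (le_max_left _ _), (hB' _ hm).trans (le_max_right _ _)⟩

lemma LD_data {φ : X → ℝ} (h : ContDiff ℝ 1 φ) (hc : HasCompactSupport φ) : LD φ := by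
  obtain ⟨C, hC⟩ := hc.exists_bound_of_continuous h.continuous
  obtain ⟨C', hC'⟩ := ContDiff.lipschitzWith_of_hasCompactSupport hc h one_ne_zero
  refine ⟨max C C', le_max_of_le_right C'.2, fun x => ⟨(hC x).trans (le_max_left _ _), fun k => ?_⟩⟩
  have := hC'.dist_le_mul (x + k) x
  rw [Real.dist_eq, dist_eq_norm, add_sub_cancel_left] at this
  exact this.trans (by gcongr; exact le_max_right _ _)

end lay

lemma LY_d1 {w : ℝ × E3 → ℝ} {τ : ℝ} (hτ : 0 < τ) (hu : ContDiffOn ℝ 1 w (Ico 0 τ ×ˢ univ)) (k : Fin 3)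
    (h : LD (fun x => fderiv ℝ (fun y => w (0, y)) x (e3 k))) : LY (d1 k w) := by
  obtain ⟨D, hD, e, e0⟩ := ext_f hτ hu
  refine (LY_of hτ (u := fun p => D p (0, e3 k)) (hD.clm_apply continuousOn_const) ?_).congr hτ
    fun s hs x => by rw [d1, e s hs]
  refine cast ?_ h
  congr 1; ext x
  rw [(e0 x).fderiv]; simp

lemma LY_mom {g : ℝ × E3 × E3 → ℝ} {τ R : ℝ} (hτ : 0 < τ) (hg : ContDiffOn ℝ 1 g (UU τ)) (hl : LY g)
    {c : E3 → ℝ} (hc : Continuous c) (hs : ∀ ξ, R < ‖ξ‖ → c ξ = 0) : LY (mom c g) := by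
  obtain ⟨L, hL, h⟩ := hl
  have hcs : HasCompactSupport c := HasCompactSupport.intro (isCompact_closedBall 0 R)
    fun ξ hξ => hs ξ (by simpa using hξ)
  set I := ∫ ξ, |c ξ|
  have hI : 0 ≤ I := integral_nonneg fun _ => abs_nonneg _
  have hci : Integrable fun ξ => |c ξ| := (hc.integrable_of_hasCompactSupport hcs).abs
  refine ⟨I * L, by positivity, fun ρ k ε hε => ?_⟩
  have hr : I * (ε / (I + 1)) ≤ ε := by
    rw [mul_div_assoc', div_le_iff₀ (by positivity)]; nlinarith
  filter_upwards [h (max ρ R) (k, 0) (ε / (I + 1)) (by positivity), Ioo_mem_nhdsGT hτ] with s hs1 h2 x hx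
  have gi : ∀ y, Integrable fun ξ => c ξ * g (s, y, ξ) := fun y => by
    have hgc : Continuous fun ξ => g (s, y, ξ) := continuousOn_univ.1
      (hg.continuousOn.comp (f := fun ξ => (s, y, ξ)) (by fun_prop) fun ξ _ => ⟨h2, trivial⟩)
    exact (hc.mul hgc).integrable_of_hasCompactSupport hcs.mul_right
  have bd : ∀ φ : E3 → ℝ, ∀ B, (∀ ξ, ‖ξ‖ ≤ R → |φ ξ| ≤ B) → |∫ ξ, c ξ * φ ξ| ≤ I * B := by
    intro φ B hφ
    rw [← Real.norm_eq_abs, ← integral_mul_const]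
    refine norm_integral_le_of_norm_le (hci.mul_const B) (Eventually.of_forall fun ξ => ?_)
    rw [Real.norm_eq_abs, abs_mul]
    by_cases hξ : R < ‖ξ‖
    · simp [hs ξ hξ]
    · gcongr; exact hφ ξ (not_lt.1 hξ)
  have nm : ∀ ξ : E3, ‖ξ‖ ≤ R → ‖(x, ξ)‖ ≤ max ρ R := fun ξ hξ => by
    rw [Prod.norm_def]; exact max_le_max hx hξ
  constructor
  · have := bd (fun ξ => g (s, x, ξ)) _ fun ξ hξ => (hs1 (x, ξ) (nm ξ hξ)).1
    simp only [mom]; nlinarith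
  · have := bd (fun ξ => g (s, x + k, ξ) - g (s, x, ξ)) (L * ‖k‖ + ε / (I + 1)) fun ξ hξ => by
      have := (hs1 (x, ξ) (nm ξ hξ)).2
      simpa using this
    simp only [mul_sub] at this
    rw [integral_sub (gi _) (gi _)] at this
    simp only [mom]; nlinarith

section sys
variable {ι : Type} [Fintype ι]

/-- force field with cut off -/
def KF (c : Fin 3 → ι → E3 → ℝ) (w : ι → ℝ × E3 → ℝ) (l : Fin 3) (p : ℝ × E3 × E3) : ℝ :=
  ∑ j, c l j p.2.2 * w j (p.1, p.2.1)

def KK (c : Fin 3 → ι → E3 → ℝ) (w : ι → ℝ × E3 → ℝ) (p : ℝ × E3 × E3) : E3 :=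
  WithLp.toLp 2 fun l => KF c w l p

structure Sys (τ R : ℝ) (g : ℝ × E3 × E3 → ℝ) (w : ι → ℝ × E3 → ℝ) (c : Fin 3 → ι → E3 → ℝ)
    (m : ι → Fin 3 → ι → ℝ) (cm : ι → E3 → ℝ) : Prop where
  hτ : 0 < τ
  cg : ContDiffOn ℝ 1 g (Ico 0 τ ×ˢ univ)
  cw : ∀ j, ContDiffOn ℝ 1 (w j) (Ico 0 τ ×ˢ univ)
  g0 : ∀ p ∈ UU τ, R < ‖p.2.2‖ → g p = 0
  cc : ∀ l j, ContDiff ℝ 1 (c l j)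
  cs : ∀ l j ξ, R < ‖ξ‖ → c l j ξ = 0
  cmc : ∀ j, Continuous (cm j)
  cms : ∀ j ξ, R < ‖ξ‖ → cm j ξ = 0
  tr : ∀ p ∈ UU τ, fderiv ℝ g p (1, vrel p.2.2, KK c w p) = 0
  hV : ∀ p ∈ UU τ, dT g p + ∑ k : Fin 3, (vrel p.2.2).ofLp k * dX k g p =
            -∑ l : Fin 3, dV l (fun q => KF c w l q * g q) p
  mx : ∀ j, ∀ p ∈ U1 τ, d0 (w j) p = (∑ k, ∑ i, m j k i * d1 k (w i) p) + mom (cm j) g p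
  ldg : LD (fun z => g (0, z))
  ldw : ∀ j, LD (fun x => w j (0, x))
  ldd : ∀ j k, LD (fun x => fderiv ℝ (fun y => w j (0, y)) x (e3 k))
  rp : ∀ j, ∃ A1 A2 W, Ker 1 R A1 ∧ Ker 2 R A2 ∧ (∀ l, Ker 1 R (W l)) ∧ FRep τ g (KF c w) (w j) R A1 A2 W

variable {τ R : ℝ} {g : ℝ × E3 × E3 → ℝ} {w : ι → ℝ × E3 → ℝ} {c : Fin 3 → ι → E3 → ℝ}
    {m : ι → Fin 3 → ι → ℝ} {cm : ι → E3 → ℝ}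

lemma Sys.cgU (h : Sys τ R g w c m cm) : ContDiffOn ℝ 1 g (UU τ) :=
  h.cg.mono (prod_mono Ioo_subset_Ico_self le_rfl)

lemma Sys.cwU (h : Sys τ R g w c m cm) (j : ι) : ContDiffOn ℝ 1 (w j) (U1 τ) :=
  (h.cw j).mono (prod_mono Ioo_subset_Ico_self le_rfl)

lemma Sys.KFd (h : Sys τ R g w c m cm) (l : Fin 3) {p : ℝ × E3 × E3} (hp : p ∈ UU τ) (a : ℝ) (b v : E3) :
    fderiv ℝ (KF c w l) p (a, b, v) = ∑ j, (c l j p.2.2 * fderiv ℝ (w j) (p.1, p.2.1) (a, b)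
      + fderiv ℝ (c l j) p.2.2 v * w j (p.1, p.2.1)) := by
  have h1 : ∀ j, HasFDerivAt (fun p : ℝ × E3 × E3 => c l j p.2.2 * w j (p.1, p.2.1)) _ p := fun j =>
    HasFDerivAt.fun_mul
      (HasFDerivAt.comp p (((h.cc l j).differentiable one_ne_zero) p.2.2).hasFDerivAt
        ((hasFDerivAt_snd (𝕜 := ℝ) (p := p.2)).comp p hasFDerivAt_snd))
      (HasFDerivAt.comp p (f := fun p : ℝ × E3 × E3 => (p.1, p.2.1))
        (cd_diff (U1_open τ) (h.cwU j) (p := (p.1, p.2.1)) ⟨hp.1, trivial⟩)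
        ((hasFDerivAt_fst (𝕜 := ℝ)).prodMk ((hasFDerivAt_fst (𝕜 := ℝ) (p := p.2)).comp p hasFDerivAt_snd)))
  have h2 := HasFDerivAt.fun_sum (u := Finset.univ) fun j _ => h1 j
  have : HasFDerivAt (KF c w l) _ p := h2
  rw [this.fderiv, sum_apply]
  refine Finset.sum_congr rfl fun j _ => ?_
  simp [mul_comm]

lemma Sys.KFc (h : Sys τ R g w c m cm) (l : Fin 3) : ContDiffOn ℝ 1 (KF c w l) (UU τ) := by
  refine ContDiffOn.sum fun j _ => ContDiffOn.mul ?_ ?_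
  · exact ((h.cc l j).comp (contDiff_snd.comp contDiff_snd)).contDiffOn
  · exact (h.cwU j).comp (f := fun p : ℝ × E3 × E3 => (p.1, p.2.1))
      (contDiff_fst.prodMk (contDiff_fst.comp contDiff_snd)).contDiffOn fun p hp => ⟨hp.1, trivial⟩

lemma Sys.cbd (h : Sys τ R g w c m cm) : ∃ C, 0 ≤ C ∧ ∀ l j ξ, |c l j ξ| ≤ C ∧ ∀ k, |fderiv ℝ (c l j) ξ (e3 k)| ≤ C := by
  have : ∀ q : Fin 3 × ι, ∃ C, ∀ ξ, |c q.1 q.2 ξ| ≤ C ∧ ∀ k, |fderiv ℝ (c q.1 q.2) ξ (e3 k)| ≤ C := by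
    rintro ⟨l, j⟩
    have hcs : HasCompactSupport (c l j) := HasCompactSupport.intro (isCompact_closedBall 0 R)
      fun ξ hξ => h.cs l j ξ (by simpa using hξ)
    obtain ⟨C, hC⟩ := hcs.exists_bound_of_continuous (h.cc l j).continuous
    obtain ⟨C', hC'⟩ := (hcs.fderiv ℝ).exists_bound_of_continuous ((h.cc l j).continuous_fderiv one_ne_zero)
    refine ⟨max C C', fun ξ => ⟨(hC ξ).trans (le_max_left _ _), fun k => le_trans ?_ (le_max_right _ _)⟩⟩
    have := (fderiv ℝ (c l j) ξ).le_opNorm (e3 k)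
    rw [norm_e3, mul_one] at this
    exact this.trans (hC' ξ)
  choose C hC using this
  refine ⟨∑ q, |C q|, by positivity, fun l j ξ => ?_⟩
  have h1 : C (l, j) ≤ ∑ q, |C q| := (le_abs_self _).trans
    (Finset.single_le_sum (f := fun q => |C q|) (fun _ _ => abs_nonneg _) (Finset.mem_univ _))
  exact ⟨((hC (l, j) ξ).1).trans h1, fun k => ((hC (l, j) ξ).2 k).trans h1⟩

lemma sum_bd {C : ℝ} {a b : ι → ℝ} (h : ∀ j, |a j| ≤ C) : |∑ j, a j * b j| ≤ C * ∑ j, |b j| := by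
  refine (Finset.abs_sum_le_sum_abs _ _).trans ?_
  rw [Finset.mul_sum]
  refine Finset.sum_le_sum fun j _ => ?_
  rw [abs_mul]; gcongr; exact h j

/-- pointwise bounds for the force -/
lemma Sys.Kbd (h : Sys τ R g w c m cm) : ∃ C, 0 ≤ C ∧ ∀ p ∈ UU τ, ∀ l,
    |KF c w l p| ≤ C * ∑ j, |w j (p.1, p.2.1)| ∧ |dT (KF c w l) p| ≤ C * ∑ j, |d0 (w j) (p.1, p.2.1)| ∧
    ∀ k, |dX k (KF c w l) p| ≤ C * ∑ j, |d1 k (w j) (p.1, p.2.1)| ∧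
      |dV k (KF c w l) p| ≤ C * ∑ j, |w j (p.1, p.2.1)| := by
  obtain ⟨C, hC, H⟩ := h.cbd
  refine ⟨C, hC, fun p hp l => ⟨sum_bd fun j => (H l j _).1, ?_, fun k => ⟨?_, ?_⟩⟩⟩
  · rw [dT, h.KFd l hp]; simp only [map_zero, zero_mul, add_zero]; exact sum_bd fun j => (H l j _).1
  · rw [dX, h.KFd l hp]; simp only [map_zero, zero_mul, add_zero]; exact sum_bd fun j => (H l j _).1
  · rw [dV, h.KFd l hp]
    simp only [Prod.mk_zero_zero, map_zero, mul_zero, zero_add]; exact sum_bd fun j => (H l j _).2 k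

lemma Sys.KKs (h : Sys τ R g w c m cm) (p : ℝ × E3 × E3) (hp : R < ‖p.2.2‖) : KK c w p = 0 := by
  ext l; simp [KK, KF, h.cs _ _ _ hp]

lemma Sys.lev0 (h : Sys τ R g w c m cm) : ∃ M, 0 ≤ M ∧ ∀ p ∈ UU τ, |g p| ≤ M := by
  obtain ⟨L, hL, H⟩ := h.ldg
  refine ⟨L, hL, fun p hp => ?_⟩
  obtain ⟨t, y, ξ⟩ := p
  by_cases hξ : R < ‖ξ‖
  · rw [h.g0 _ hp hξ]; simpa using hL
  have key : ∀ α : ℝ, |α| = 1 → α * g (t, y, ξ) ≤ L := fun α hα => by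
    have := dbl (x1 := y) (η := 0) (α := α) (β := 0) (M := L) (P := fun _ => 0) (P' := fun _ => 0) hp.1.2
      h.cg.continuousOn h.cgU h.tr (fun p _ => h.KKs p)
      (fun s => hasDerivAt_const s (0 : ℝ)) (fun z z' => ?_) (fun s _ z z' _ _ => by simp) hp.1.1.le
      (y, ξ) (y, ξ) (by simp) (by simp) (by simp; linarith) (by simp; linarith)
    · simpa using this
    · simp only [zero_mul, sub_zero]
      refine (le_abs_self _).trans ?_
      rw [abs_mul, hα, one_mul]; exact (H z).1
  rw [abs_le]
  have k1 := key 1 (by simp)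
  have k2 := key (-1) (by simp)
  constructor <;> linarith

/-- backward cone -/
def Cn (T : ℝ) (x0 : E3) : Set (ℝ × E3) := {p | p.1 ∈ Ioc 0 T ∧ ‖p.2 - x0‖ < T + 1 - p.1}

lemma Cn_ret {T t : ℝ} {x0 x : E3} (h : (t, x) ∈ Cn T x0) {z : Z3} (hz : z ∈ Om t) :
    (t - ‖z.1‖, x + z.1) ∈ Cn T x0 := by
  obtain ⟨⟨h1, h2⟩, h3⟩ := h
  have := norm_nonneg z.1
  have h5 := hz.2
  simp only at h1 h2 h3
  refine ⟨⟨by simp only; linarith, by simp only; linarith⟩, ?_⟩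
  have h4 := norm_add_le (x - x0) z.1
  have : x + z.1 - x0 = x - x0 + z.1 := by abel
  simp only [this]; linarith

lemma Cn_bdd {T : ℝ} (hT : T < τ) (h : Sys τ R g w c m cm) (x0 : E3) :
    ∃ B, ∀ p ∈ Cn T x0, ∑ j, |w j p| ≤ B ∧ ∑ j, ∑ k, |d1 k (w j) p| ≤ B := by
  choose B hB using fun j => bdd_f h.hτ (h.cw j) hT (T + 1 + ‖x0‖)
  refine ⟨max (∑ j, B j) (∑ j, ∑ k : Fin 3, B j), fun p hp => ?_⟩
  have h1 : ‖p.2‖ ≤ T + 1 + ‖x0‖ := by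
    have := norm_add_le (p.2 - x0) x0
    rw [sub_add_cancel] at this
    linarith [hp.2, hp.1.1]
  have h2 := fun j => hB j p.1 hp.1 p.2 h1
  refine ⟨le_trans ?_ (le_max_left _ _), le_trans ?_ (le_max_right _ _)⟩
  · exact Finset.sum_le_sum fun j _ => (h2 j).1
  · refine Finset.sum_le_sum fun j _ => Finset.sum_le_sum fun k _ => ?_
    have := (fderiv ℝ (w j) p).le_opNorm (0, e3 k)
    have e : ‖((0 : ℝ), e3 k)‖ = 1 := by simp [Prod.norm_def, norm_e3]
    rw [e, mul_one] at this
    exact this.trans (h2 j).2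

lemma Sys.lay (h : Sys τ R g w c m cm) : ∃ L, 0 ≤ L ∧ Lay L g ∧ ∀ j, Lay L (w j) ∧ Lay L (d0 (w j)) ∧
    ∀ k, Lay L (d1 k (w j)) := by
  have a0 : LY g := LY_of h.hτ h.cg.continuousOn h.ldg
  have a1 : ∀ j, LY (w j) := fun j => LY_of h.hτ (h.cw j).continuousOn (h.ldw j)
  have a2 : ∀ j k, LY (d1 k (w j)) := fun j k => LY_d1 h.hτ (h.cw j) k (h.ldd j k)
  have a3 : ∀ j, LY (d0 (w j)) := fun j => LY.congr h.hτ
    ((LY.sum Finset.univ fun k => LY.sum Finset.univ fun i => (a2 i k).const_mul (m j k i)).add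
      (LY_mom h.hτ h.cgU a0 (h.cmc j) (h.cms j))) fun s hs x => h.mx j _ ⟨hs, trivial⟩
  obtain ⟨L, hL, l0⟩ := a0
  choose L1 hL1 l1 using a1
  choose L2 hL2 l2 using a2
  choose L3 hL3 l3 using a3
  have s1 := fun j => Finset.single_le_sum (f := fun j => L1 j) (fun i _ => hL1 i) (Finset.mem_univ j)
  have s3 := fun j => Finset.single_le_sum (f := fun j => L3 j) (fun i _ => hL3 i) (Finset.mem_univ j)
  have s2 := fun q => Finset.single_le_sum (f := fun q : ι × Fin 3 => L2 q.1 q.2) (fun i _ => hL2 i.1 i.2)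
    (Finset.mem_univ q)
  have p1 : 0 ≤ ∑ j, L1 j := Finset.sum_nonneg fun i _ => hL1 i
  have p3 : 0 ≤ ∑ j, L3 j := Finset.sum_nonneg fun i _ => hL3 i
  have p2 : 0 ≤ ∑ q : ι × Fin 3, L2 q.1 q.2 := Finset.sum_nonneg fun i _ => hL2 i.1 i.2
  refine ⟨L + (∑ j, L1 j) + (∑ j, L3 j) + ∑ q : ι × Fin 3, L2 q.1 q.2, by positivity, l0.mono (by linarith),
    fun j => ⟨(l1 j).mono ?_, (l3 j).mono ?_, fun k => (l2 j k).mono ?_⟩⟩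
  · linarith [s1 j]
  · linarith [s3 j]
  · have := s2 (j, k); simp only at this; linarith

lemma Sys.lev1 (h : Sys τ R g w c m cm) : ∃ N, 0 ≤ N ∧ ∀ p ∈ U1 τ, ∑ j, |w j p| ≤ N := by
  obtain ⟨M, hM, gM⟩ := h.lev0
  obtain ⟨Cc, hCc, hK⟩ := h.Kbd
  obtain ⟨L, hL, lg, lw⟩ := h.lay
  choose A1 A2 W k1 k2 kW hF using h.rp
  choose C0 hC0 H0 using fun j => L1 hL h.cgU (h.cwU j) (hF j) (k1 j) lg (lw j).1 (lw j).2.1 (lw j).2.2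
  choose C1 hC1 H1 using fun j => SS0 (g := g) (K := KF c w) (k2 j) (kW j) h.hτ hM
  have hs := s3_pos
  set a := ∑ j, s3⁻¹ * (C0 j + 1 + C1 j) with ha
  set b := ∑ j, s3⁻¹ * (C1 j * Cc) with hb
  have ha0 : 0 ≤ a := Finset.sum_nonneg fun j _ => by have := hC0 j; have := hC1 j; positivity
  have hb0 : 0 ≤ b := Finset.sum_nonneg fun j _ => by have := hC1 j; positivity
  set l := 2 * b + 1 with hl
  have hl0 : 0 < l := by positivity
  refine ⟨2 * a * exp (l * τ), by positivity, fun p hp => ?_⟩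
  obtain ⟨T, x0⟩ := p
  have hT : T ∈ Ioo 0 τ := hp.1
  obtain ⟨B, hB⟩ := Cn_bdd hT.2 h x0
  have key := absorb (S := Cn T x0) (m := fun p => ∑ j, |w j p|) ha0 hl0.le (fun p hp => hp.1.1.le)
    (fun p _ => Finset.sum_nonneg fun _ _ => abs_nonneg _) (fun p hp => (hB p hp).1) ?_ (T, x0)
    ⟨⟨hT.1, le_rfl⟩, by simp⟩
  · refine key.trans ?_
    gcongr
    exact hT.2.le
  rintro N hN HN ⟨t, x⟩ htx
  have ht : t ∈ Ioo 0 τ := ⟨htx.1.1, htx.1.2.trans_lt hT.2⟩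
  obtain ⟨i1, i2⟩ := i_exp ht.1.le hl0
  have bj : ∀ j, |w j (t, x)| ≤ s3⁻¹ * (C0 j + 1 + C1 j) + s3⁻¹ * (C1 j * Cc) * (N * (exp (l * t) / l)) := by
    intro j
    obtain ⟨χ, hχ, h1, -⟩ := H0 j t ht x 0 1 one_pos
    have h2 := H1 j t ht x χ (fun r => Cc * N * exp (l * (t - r))) hχ (i1.const_mul (Cc * N)) fun z hz =>
      ⟨gM _ (ret_mem ht.2.le x hz), fun i => by
        refine ((hK _ (ret_mem ht.2.le x hz) i).1).trans ?_
        rw [mul_assoc]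
        gcongr
        exact HN _ (Cn_ret htx hz)⟩
    rw [integral_const_mul] at h2
    have h3 : s3 * |w j (t, x)| ≤ C0 j + 1 + C1 j * (1 + Cc * N * (exp (l * t) / l)) := by
      have e : s3 * |w j (t, x)| = |s3 * w j (t, x)| := by rw [abs_mul, abs_of_pos hs]
      have h4 : C1 j * (1 + Cc * N * ∫ r in Ioo 0 t, exp (l * (t - r))) ≤
        C1 j * (1 + Cc * N * (exp (l * t) / l)) := by have := hC1 j; gcongr
      rw [e]
      have := abs_sub_abs_le_abs_add (s3 * w j (t, x)) (SS g (KF c w) (A2 j) (W j) χ t x)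
      linarith
    rw [← inv_mul_cancel_left₀ hs.ne' |w j (t, x)|]
    calc _ ≤ s3⁻¹ * (C0 j + 1 + C1 j * (1 + Cc * N * (exp (l * t) / l))) := by gcongr
      _ = _ := by ring
  refine (Finset.sum_le_sum fun j _ => bj j).trans ?_
  rw [Finset.sum_add_distrib, ← Finset.sum_mul, ← ha, ← hb]
  have : b * (N * (exp (l * t) / l)) ≤ N / 2 * exp (l * t) := by
    have e : b * (N * (exp (l * t) / l)) = N * exp (l * t) * (b / l) := by ring
    have : b / l ≤ 1 / 2 := by rw [div_le_div_iff₀ hl0 two_pos]; linarith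
    have h5 : 0 ≤ N * exp (l * t) := by positivity
    rw [e]; nlinarith [mul_le_mul_of_nonneg_left this h5]
  linarith

end sys

lemma der_le {φ : ℝ → ℝ} {d A : ℝ} (h : HasDerivAt φ d 0) (H : ∀ᶠ θ in 𝓝[>] (0 : ℝ), φ θ - φ 0 ≤ A * θ) :
    d ≤ A := by
  have h1 : Tendsto (slope φ 0) (𝓝[>] 0) (𝓝 d) :=
    (hasDerivAt_iff_tendsto_slope.1 h).mono_left (nhdsWithin_mono _ fun x hx => ne_of_gt hx)
  refine le_of_tendsto h1 ?_
  filter_upwards [H, self_mem_nhdsWithin] with θ h2 (h3 : 0 < θ)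
  rw [slope_def_field, sub_zero, div_le_iff₀ h3]; exact h2

lemma lin_bd (L : E3 →L[ℝ] ℝ) (a : E3) : |L a| ≤ ‖a‖ * ∑ k, |L (e3 k)| := by
  conv_lhs => rw [← sum_coord_e3 a]
  rw [map_sum, Finset.mul_sum]
  refine (Finset.abs_sum_le_sum_abs _ _).trans (Finset.sum_le_sum fun k _ => ?_)
  rw [map_smul, smul_eq_mul, abs_mul]
  gcongr; exact abs_coord_le _ _

lemma vrel_lip (a b : E3) : ‖vrel a - vrel b‖ ≤ 2 * ‖a - b‖ := by
  set α := √(1 + ‖a‖ ^ 2) with hα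
  set β := √(1 + ‖b‖ ^ 2) with hβ
  have a2 : α ^ 2 = 1 + ‖a‖ ^ 2 := sq_sqrt (by positivity)
  have b2 : β ^ 2 = 1 + ‖b‖ ^ 2 := sq_sqrt (by positivity)
  have a0 : 0 < α := sqrt_pos.2 (by positivity)
  have b0 : 0 < β := sqrt_pos.2 (by positivity)
  have a1 : 1 ≤ α := by nlinarith [sq_nonneg ‖a‖]
  have na := norm_nonneg a
  have nb := norm_nonneg b
  have bb : ‖b‖ ≤ β := (sq_le_sq₀ nb b0.le).1 (by linarith)
  have aa : ‖a‖ ≤ α := (sq_le_sq₀ na a0.le).1 (by linarith)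
  have hd : |β - α| ≤ ‖a - b‖ := by
    have h1 : |‖b‖ - ‖a‖| ≤ ‖a - b‖ := by rw [abs_sub_comm]; exact abs_norm_sub_norm_le a b
    have h2 : (β - α) * (β + α) = (‖b‖ - ‖a‖) * (‖b‖ + ‖a‖) := by nlinarith
    have h3 : |β - α| * (β + α) = |‖b‖ - ‖a‖| * (‖b‖ + ‖a‖) := by
      rw [← abs_of_pos (by positivity : 0 < β + α), ← abs_mul, h2, abs_mul, abs_of_nonneg (by positivity : 0 ≤ ‖b‖ + ‖a‖)]
    have h4 : |β - α| * (β + α) ≤ ‖a - b‖ * (β + α) := by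
      rw [h3]; gcongr
    exact le_of_mul_le_mul_right h4 (by positivity)
  have e : vrel a - vrel b = α⁻¹ • (a - b) + (α⁻¹ * β⁻¹ * (β - α)) • b := by
    have : α⁻¹ * β⁻¹ * (β - α) = α⁻¹ - β⁻¹ := by field_simp
    rw [this, vrel, vrel, ← hα, ← hβ]; module
  have i1 : α⁻¹ ≤ 1 := inv_le_one_of_one_le₀ a1
  rw [e]
  refine (norm_add_le _ _).trans ?_
  rw [norm_smul, norm_smul, Real.norm_eq_abs, Real.norm_eq_abs, abs_mul, abs_of_pos (by positivity : 0 < α⁻¹ * β⁻¹),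
    abs_of_pos (by positivity : 0 < α⁻¹)]
  have h5 : β⁻¹ * ‖b‖ ≤ 1 := by rw [inv_mul_le_iff₀ b0]; linarith
  calc _ = α⁻¹ * ‖a - b‖ + α⁻¹ * (β⁻¹ * ‖b‖) * |β - α| := by ring
    _ ≤ 1 * ‖a - b‖ + 1 * 1 * ‖a - b‖ := by gcongr
    _ = _ := by ring

section sys
variable {ι : Type} [Fintype ι] {τ R : ℝ} {g : ℝ × E3 × E3 → ℝ} {w : ι → ℝ × E3 → ℝ} {c : Fin 3 → ι → E3 → ℝ}
    {m : ι → Fin 3 → ι → ℝ} {cm : ι → E3 → ℝ}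

lemma Sys.Klip (h : Sys τ R g w c m cm) {Cc N0 s γ : ℝ} (hCc : 0 ≤ Cc) (hK : ∀ p ∈ UU τ, ∀ l, ∀ k,
    |dX k (KF c w l) p| ≤ Cc * ∑ j, |d1 k (w j) (p.1, p.2.1)| ∧
      |dV k (KF c w l) p| ≤ Cc * ∑ j, |w j (p.1, p.2.1)|) (hw : ∀ p ∈ U1 τ, ∑ j, |w j p| ≤ N0) (hN0 : 0 ≤ N0)
    (hγ : 0 ≤ γ) {X : Set E3} (hX : Convex ℝ X) (hs : s ∈ Ioo 0 τ)
    (H : ∀ y ∈ X, ∑ j, ∑ k, |d1 k (w j) (s, y)| ≤ γ) (z z' : Z3) (hz : z.1 ∈ X) (hz' : z'.1 ∈ X) :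
    ‖KK c w (s, z) - KK c w (s, z')‖ ≤ 3 * (Cc * (γ + 3 * N0)) * (‖z.1 - z'.1‖ + ‖z.2 - z'.2‖) := by
  have n1 := norm_nonneg (z.1 - z'.1)
  have n2 := norm_nonneg (z.2 - z'.2)
  have hlt : ∀ i, |KF c w i (s, z) - KF c w i (s, z')| ≤ Cc * (γ + 3 * N0) * (‖z.1 - z'.1‖ + ‖z.2 - z'.2‖) := by
    intro i
    have hS : Convex ℝ (({s} : Set ℝ) ×ˢ (X ×ˢ (univ : Set E3))) := (convex_singleton s).prod (hX.prod convex_univ)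
    have hSU : ∀ p ∈ ({s} : Set ℝ) ×ˢ (X ×ˢ (univ : Set E3)), p ∈ UU τ := by
      rintro ⟨a, b⟩ ⟨rfl, -⟩; exact ⟨hs, trivial⟩
    have m1 : ∀ z : Z3, z.1 ∈ X → (s, z) ∈ ({s} : Set ℝ) ×ˢ (X ×ˢ (univ : Set E3)) := fun z hz => ⟨rfl, hz, trivial⟩
    obtain ⟨p, hp, e⟩ := domain_mvt (fun p hp => (cd_diff (UU_open τ) (h.KFc i) (hSU p hp)).hasFDerivWithinAt)
      hS (m1 z' hz') (m1 z hz)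
    have hpS := hS.segment_subset (m1 z' hz') (m1 z hz) hp
    have hpU := hSU p hpS
    have k1 := hK p hpU i
    have hwp := hw (p.1, p.2.1) ⟨hpU.1, trivial⟩
    have hps : p.1 = s := hpS.1
    have hH := H p.2.1 hpS.2.1
    rw [hps] at hwp k1
    have l1 := lin_bd ((fderiv ℝ (KF c w i) p).comp ((ContinuousLinearMap.inr ℝ ℝ Z3).comp
      (ContinuousLinearMap.inl ℝ E3 E3))) (z.1 - z'.1)
    have l2 := lin_bd ((fderiv ℝ (KF c w i) p).comp ((ContinuousLinearMap.inr ℝ ℝ Z3).comp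
      (ContinuousLinearMap.inr ℝ E3 E3))) (z.2 - z'.2)
    have s1 : ∑ k, |dX k (KF c w i) p| ≤ Cc * γ := by
      refine (Finset.sum_le_sum fun k _ => (k1 k).1).trans ?_
      rw [← Finset.mul_sum, Finset.sum_comm]; gcongr
    have s2 : ∑ k, |dV k (KF c w i) p| ≤ Cc * (3 * N0) := by
      refine (Finset.sum_le_sum fun k _ => ((k1 k).2).trans (mul_le_mul_of_nonneg_left hwp hCc)).trans ?_
      simp; linarith
    have e2 : (s, z) - (s, z') = ((0 : ℝ), z.1 - z'.1, (0 : E3)) + ((0 : ℝ), (0 : E3), z.2 - z'.2) := by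
      ext <;> simp
    rw [e, e2, map_add]
    refine (abs_add_le _ _).trans ((add_le_add l1 l2).trans ?_)
    have p1 := mul_le_mul_of_nonneg_left s1 n1
    have p2 := mul_le_mul_of_nonneg_left s2 n2
    have p3 : 0 ≤ ‖z.1 - z'.1‖ * (Cc * (3 * N0)) := by positivity
    have p4 : 0 ≤ ‖z.2 - z'.2‖ * (Cc * γ) := by positivity
    refine (add_le_add p1 p2).trans ?_
    nlinarith
  rw [← sum_coord_e3 (KK c w (s, z) - KK c w (s, z'))]
  refine (norm_sum_le _ _).trans ?_
  refine (Finset.sum_le_sum fun i _ => (?_ : _ ≤ Cc * (γ + 3 * N0) * (‖z.1 - z'.1‖ + ‖z.2 - z'.2‖))).trans ?_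
  · rw [norm_smul, norm_e3, mul_one]; exact hlt i
  · simp; linarith

lemma alg1 {a b C Cc N0 γ I1 I2 v k P : ℝ} (hC : C = 2 + 6 * Cc + 18 * Cc * N0) (a0 : 0 ≤ a) (b0 : 0 ≤ b)
    (hCc : 0 ≤ Cc) (hN0 : 0 ≤ N0) (hγ : 0 ≤ γ) (e1 : |I1| ≤ a * v) (e2 : |I2| ≤ b * k) (k2 : v ≤ 2 * b)
    (k1 : k ≤ 3 * (Cc * (γ + 3 * N0)) * (a + b)) (hP : 0 ≤ P) :
    -(2 * P * (I1 + I2)) ≤ P * (2 * C * (1 + γ)) * (a ^ 2 + b ^ 2) := by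
  have f1 : |I1| ≤ a ^ 2 + b ^ 2 := by nlinarith [sq_nonneg (a - b), mul_le_mul_of_nonneg_left k2 a0]
  have f2 : |I2| ≤ 6 * (Cc * (γ + 3 * N0)) * (a ^ 2 + b ^ 2) := by
    have := mul_le_mul_of_nonneg_left k1 b0
    have f3 : b * (a + b) ≤ 2 * (a ^ 2 + b ^ 2) := by nlinarith [sq_nonneg (a - b)]
    have f4 := mul_le_mul_of_nonneg_left f3 (by positivity : 0 ≤ 3 * (Cc * (γ + 3 * N0)))
    linarith
  have f5 : 1 + 6 * (Cc * (γ + 3 * N0)) ≤ C * (1 + γ) := by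
    rw [hC]
    have : 0 ≤ Cc * N0 * γ := by positivity
    have : 0 ≤ Cc * γ := by positivity
    nlinarith
  have f6 := mul_le_mul_of_nonneg_right f5 (by positivity : 0 ≤ a ^ 2 + b ^ 2)
  have := neg_abs_le I1
  have := neg_abs_le I2
  have e3 : -(I1 + I2) ≤ C * (1 + γ) * (a ^ 2 + b ^ 2) := by linarith
  have := mul_le_mul_of_nonneg_left e3 (by positivity : 0 ≤ 2 * P)
  linarith

lemma alg2 {L κ n nn P0 e d : ℝ} (hκ : 0 < κ) (hL : 0 ≤ L) (hP0 : P0 = (L + 1) ^ 2 / (4 * κ)) (n1 : n ^ 2 ≤ nn)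
    (n0 : 0 ≤ n) (he : 1 ≤ e) (hd : d ≤ L * n) : d - P0 * e * nn ≤ κ := by
  have hP00 : 0 < P0 := by rw [hP0]; positivity
  have k1 : (L + 1) * n ≤ κ + P0 * n ^ 2 := by
    have : κ + P0 * n ^ 2 - (L + 1) * n = (2 * κ - (L + 1) * n) ^ 2 / (4 * κ) := by
      rw [hP0]; field_simp; ring
    have : 0 ≤ (2 * κ - (L + 1) * n) ^ 2 / (4 * κ) := by positivity
    linarith
  have k3 := mul_le_mul_of_nonneg_left n1 hP00.le
  have nn0 : 0 ≤ nn := (sq_nonneg n).trans n1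
  have k4 := mul_le_mul_of_nonneg_left he (by positivity : 0 ≤ P0 * nn)
  linarith

lemma Sys.gradm (h : Sys τ R g w c m cm) {L Cc N0 N l C t η κ : ℝ} {x : E3} (hL : 0 ≤ L)
    (gL : ∀ z' y : Z3, |g (0, z' + y) - g (0, z')| ≤ L * ‖y‖)
    (hC : C = 2 + 6 * Cc + 18 * Cc * N0) (hCc : 0 ≤ Cc) (hN0 : 0 ≤ N0) (hN : 0 ≤ N) (hl : 0 < l) (ht : t ∈ Ioo 0 τ)
    (Klip : ∀ s ∈ Ioc 0 t, ∀ z z' : Z3, ‖z.1 - x‖ ≤ η + t - s → ‖z'.1 - x‖ ≤ η + t - s →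
      ‖KK c w (s, z) - KK c w (s, z')‖ ≤ 3 * (Cc * (N * exp (l * s) + 3 * N0)) * (‖z.1 - z'.1‖ + ‖z.2 - z'.2‖))
    (hκ : 0 < κ) (z z' : Z3) (hz : ‖z.1 - x‖ ≤ η) (hz' : ‖z'.1 - x‖ ≤ η) (h1 : ‖z.2‖ ≤ R + 1) (h2 : ‖z'.2‖ ≤ R + 1) :
    g (t, z) - g (t, z') ≤ κ + (L + 1) ^ 2 / (4 * κ) * exp (C * (t + N * (exp (l * t) / l))) ^ 2 * nd z z' := by
  have hC0 : 0 ≤ C := by rw [hC]; positivity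
  obtain ⟨P0, hP0⟩ : ∃ P0, P0 = (L + 1) ^ 2 / (4 * κ) := ⟨_, rfl⟩
  have hP00 : 0 < P0 := by rw [hP0]; positivity
  have := dbl (x1 := x) (η := η) (α := 1) (β := 1) (M := κ)
    (P := fun s => P0 * exp (2 * C * (s + N * (exp (l * s) / l))))
    (P' := fun s => P0 * (exp (2 * C * (s + N * (exp (l * s) / l))) * (2 * C * (1 + N * exp (l * s))))) ht.2
    h.cg.continuousOn h.cgU h.tr (fun p _ => h.KKs p) ?_ ?_ ?_ ht.1.le z z' hz hz' h1 h2
  · have e : exp (2 * C * (t + N * (exp (l * t) / l))) = exp (C * (t + N * (exp (l * t) / l))) ^ 2 := by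
      rw [sq, ← exp_add]; congr 1; ring
    simp only [e] at this
    rw [← hP0]
    linarith
  · intro s
    have d1 : HasDerivAt (fun s => exp (l * s)) (exp (l * s) * l) s := by
      simpa using ((hasDerivAt_id s).const_mul l).exp
    have d2 := ((((hasDerivAt_id s).add ((d1.div_const l).const_mul N)).const_mul (2 * C)).exp).const_mul P0
    refine d2.congr_deriv ?_
    rw [mul_div_cancel_right₀ _ hl.ne']; simp
  · intro z z'
    have g1 := gL z' (z - z')
    rw [add_sub_cancel] at g1
    simp only [one_mul]
    refine alg2 hκ hL hP0 ?_ (norm_nonneg (z - z')) (one_le_exp (by positivity)) ((le_abs_self _).trans g1)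
    rw [nd, Prod.norm_def]
    rcases max_choice ‖(z - z').1‖ ‖(z - z').2‖ with h | h <;> rw [h] <;> simp
  · intro s hs z z' hz hz'
    have := alg1 hC (norm_nonneg _) (norm_nonneg _) hCc hN0 (by positivity : 0 ≤ N * exp (l * s))
      (abs_real_inner_le_norm (z.1 - z'.1) (vrel z.2 - vrel z'.2))
      (abs_real_inner_le_norm (z.2 - z'.2) (KK c w (s, z) - KK c w (s, z'))) (vrel_lip z.2 z'.2)
      (Klip s hs z z' hz hz') (by positivity : 0 ≤ P0 * exp (2 * C * (s + N * (exp (l * s) / l))))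
    refine this.trans (le_of_eq ?_)
    simp only [nd]; ring

lemma Sys.gradf (h : Sys τ R g w c m cm) : ∃ C F, 0 ≤ C ∧ 0 ≤ F ∧ ∀ T < τ, ∀ x0 N l, 0 ≤ N → 0 < l →
    (∀ p ∈ Cn T x0, ∑ j, ∑ k, |d1 k (w j) p| ≤ N * exp (l * p.1)) → ∀ t x, (t, x) ∈ Cn T x0 → ∀ ξ v : E3, ∀ u,
    ‖u‖ ^ 2 + ‖v‖ ^ 2 ≤ 1 → fderiv ℝ g (t, x, ξ) (0, u, v) ≤ F * exp (C * (t + N * (exp (l * t) / l))) := by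
  obtain ⟨Cc, hCc, hK⟩ := h.Kbd
  obtain ⟨N0, hN0, hw⟩ := h.lev1
  obtain ⟨L, hL, gL⟩ := h.ldg
  refine ⟨2 + 6 * Cc + 18 * Cc * N0, L + 1, by positivity, by positivity, fun T hT x0 N l hN hl H t x htx ξ v u huv => ?_⟩
  have ht : t ∈ Ioo 0 τ := ⟨htx.1.1, htx.1.2.trans_lt hT⟩
  have mU : ∀ z : Z3, (t, z) ∈ UU τ := fun z => ⟨ht, trivial⟩
  by_cases hξ : R < ‖ξ‖
  · rw [fderiv_zero_xi h.g0 (mU (x, ξ)) hξ, zero_apply]; positivity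
  have hη' : 0 < T + 1 - t - ‖x - x0‖ := by have := htx.2; simp only at this; linarith
  obtain ⟨η, hη0, hη⟩ := exists_between hη'
  have main := fun κ hκ => h.gradm (x := x) (η := η) (κ := κ) hL (fun z' => (gL z').2) rfl hCc hN0 hN hl ht
    (fun s hs z z' hz hz' => h.Klip hCc (fun p hp i => (hK p hp i).2.2) hw hN0 (by positivity)
      (convex_closedBall x (η + t - s)) ⟨hs.1, hs.2.trans_lt ht.2⟩ (fun y hy => H (s, y) (by
        refine ⟨⟨hs.1, hs.2.trans htx.1.2⟩, ?_⟩
        have := norm_add_le (y - x) (x - x0)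
        rw [sub_add_sub_cancel] at this
        rw [mem_closedBall, dist_eq_norm] at hy
        simp only; linarith)) z z' (by rwa [mem_closedBall, dist_eq_norm]) (by rwa [mem_closedBall, dist_eq_norm])) hκ
  obtain ⟨ex, hex⟩ : ∃ ex, ex = exp ((2 + 6 * Cc + 18 * Cc * N0) * (t + N * (exp (l * t) / l))) := ⟨_, rfl⟩
  rw [← hex] at main ⊢
  have hex0 : 0 < ex := by rw [hex]; exact exp_pos _
  have hd := (cd_diff (UU_open τ) h.cgU (mU (x, ξ))).hasLineDerivAt (0, u, v)
  refine der_le hd ?_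
  filter_upwards [Ioo_mem_nhdsGT hη0, Ioo_mem_nhdsGT one_pos] with θ h1 h2
  have nu : ‖u‖ ≤ 1 := by nlinarith [sq_nonneg ‖v‖, norm_nonneg u]
  have nv : ‖v‖ ≤ 1 := by nlinarith [sq_nonneg ‖u‖, norm_nonneg v]
  have n3 : ∀ y : E3, ‖y‖ ≤ 1 → ‖θ • y‖ ≤ θ := fun y hy => by
    rw [norm_smul, Real.norm_eq_abs, abs_of_pos h1.1]
    exact mul_le_of_le_one_right h1.1.le hy
  have := main (θ * ((L + 1) * ex / 2)) (by have := h1.1; positivity) (x + θ • u, ξ + θ • v) (x, ξ)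
    (by simpa using (n3 u nu).trans h1.2.le) (by simpa using hη0.le)
    ((norm_add_le _ _).trans (by linarith [n3 v nv, h2.2])) (by simp; linarith)
  have e : nd (x + θ • u, ξ + θ • v) (x, ξ) = θ ^ 2 * (‖u‖ ^ 2 + ‖v‖ ^ 2) := by
    simp [nd, norm_smul, abs_of_pos h1.1]; ring
  rw [e] at this
  have e2 : (L + 1) ^ 2 / (4 * (θ * ((L + 1) * ex / 2))) * ex ^ 2 * (θ ^ 2 * (‖u‖ ^ 2 + ‖v‖ ^ 2))
      = (θ * ((L + 1) * ex / 2)) * (‖u‖ ^ 2 + ‖v‖ ^ 2) := by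
    have := h1.1
    field_simp; ring
  rw [e2] at this
  have h5 := mul_le_mul_of_nonneg_left huv (by have := h1.1; positivity : 0 ≤ θ * ((L + 1) * ex / 2))
  have e3 : (t, x, ξ) + θ • ((0 : ℝ), u, v) = (t, x + θ • u, ξ + θ • v) := by simp
  simp only [e3, zero_smul, add_zero]
  linarith

end sys

lemma mvstep {β : Type} {w : ℝ × E3 → ℝ} {t ρ Q C0 : ℝ} {x : E3} {i : Fin 3}
    (hw : HasFDerivAt w (fderiv ℝ w (t, x)) (t, x)) (hρ : 0 < ρ) {S : β → E3 → ℝ} {P : β → Prop}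
    (H0 : ∀ h : E3, ∀ ε > 0, ∃ χ, P χ ∧ |s3 * (w (t, x + h) - w (t, x)) + (S χ (x + h) - S χ x)| ≤ C0 * ‖h‖ + ε)
    (H1 : ∀ χ, P χ → ∀ y, ‖y - x‖ < ρ → DifferentiableAt ℝ (S χ) y ∧ |fderiv ℝ (S χ) y (e3 i)| ≤ Q) :
    |d1 i w (t, x)| ≤ s3⁻¹ * (C0 + Q) := by
  have hs := s3_pos
  have hd : HasDerivAt (fun θ : ℝ => w ((t, x) + θ • ((0 : ℝ), e3 i))) (d1 i w (t, x)) 0 := hw.hasLineDerivAt _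
  have key : ∀ θ ∈ Ioo 0 ρ, |w (t, x + θ • e3 i) - w (t, x)| ≤ s3⁻¹ * (C0 + Q) * θ := by
    intro θ hθ
    have nθ : ‖θ • e3 i‖ = θ := by rw [norm_smul, norm_e3, mul_one, Real.norm_eq_abs, abs_of_pos hθ.1]
    have k1 : s3 * |w (t, x + θ • e3 i) - w (t, x)| ≤ (C0 + Q) * θ := by
      refine le_of_forall_pos_le_add fun ε hε => ?_
      obtain ⟨χ, hχ, h1⟩ := H0 (θ • e3 i) ε hε
      have hin : ∀ y ∈ ball x ρ, ‖y - x‖ < ρ := fun y hy => by rwa [mem_ball, dist_eq_norm] at hy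
      have mx : x ∈ ball x ρ := mem_ball_self hρ
      have my : x + θ • e3 i ∈ ball x ρ := by rw [mem_ball, dist_eq_norm, add_sub_cancel_left, nθ]; exact hθ.2
      obtain ⟨p, hp, e⟩ := domain_mvt (f := S χ) (f' := fderiv ℝ (S χ)) (fun p hp =>
        ((H1 χ hχ p (hin p hp)).1).hasFDerivAt.hasFDerivWithinAt) (convex_ball x ρ) mx my
      have hp2 := (H1 χ hχ p (hin p ((convex_ball x ρ).segment_subset mx my hp))).2
      rw [add_sub_cancel_left, map_smul, smul_eq_mul] at e
      have h2 : |S χ (x + θ • e3 i) - S χ x| ≤ θ * Q := by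
        rw [e, abs_mul, abs_of_pos hθ.1]
        exact mul_le_mul_of_nonneg_left hp2 hθ.1.le
      rw [nθ] at h1
      have h3 := abs_sub_abs_le_abs_add (s3 * (w (t, x + θ • e3 i) - w (t, x))) (S χ (x + θ • e3 i) - S χ x)
      rw [abs_mul s3, abs_of_pos hs] at h3
      linarith
    rw [← inv_mul_cancel_left₀ hs.ne' |w (t, x + θ • e3 i) - w (t, x)|, mul_assoc]
    gcongr
  have ev : ∀ᶠ θ in 𝓝[>] (0 : ℝ), θ ∈ Ioo 0 ρ := Ioo_mem_nhdsGT hρ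
  rw [abs_le']
  constructor
  · refine der_le hd ?_
    filter_upwards [ev] with θ hθ
    have := (abs_le'.1 (key θ hθ)).1
    simpa using this
  · refine der_le hd.neg ?_
    filter_upwards [ev] with θ hθ
    have := (abs_le'.1 (key θ hθ)).2
    simp only [Pi.neg_apply, zero_smul, add_zero]
    simp; linarith

section sys
variable {ι : Type} [Fintype ι] {τ R : ℝ} {g : ℝ × E3 × E3 → ℝ} {w : ι → ℝ × E3 → ℝ} {c : Fin 3 → ι → E3 → ℝ}
    {m : ι → Fin 3 → ι → ℝ} {cm : ι → E3 → ℝ}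

lemma Sys.d0b (h : Sys τ R g w c m cm) : ∃ C, 0 ≤ C ∧ ∀ p ∈ U1 τ,
    ∑ j, |d0 (w j) p| ≤ C * (1 + ∑ j, ∑ k, |d1 k (w j) p|) := by
  obtain ⟨M, hM, gM⟩ := h.lev0
  have b1 : ∀ j, ∀ p ∈ U1 τ, |mom (cm j) g p| ≤ (∫ ξ, |cm j ξ|) * M := fun j p hp => by
    have hcs : HasCompactSupport (cm j) := HasCompactSupport.intro (isCompact_closedBall 0 R)
      fun ξ hξ => h.cms j ξ (by simpa using hξ)
    rw [← integral_mul_const, ← Real.norm_eq_abs]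
    refine norm_integral_le_of_norm_le (((h.cmc j).integrable_of_hasCompactSupport hcs).norm.mul_const M)
      (ae_of_all _ fun ξ => ?_)
    rw [norm_mul]
    exact mul_le_mul_of_nonneg_left (gM _ ⟨hp.1, trivial⟩) (norm_nonneg _)
  have i0 : ∀ j, 0 ≤ ∫ ξ, |cm j ξ| := fun j => integral_nonneg fun _ => abs_nonneg _
  refine ⟨∑ j, ((∑ k, ∑ i, |m j k i|) + (∫ ξ, |cm j ξ|) * M), Finset.sum_nonneg fun j _ => by
    have := i0 j; positivity, fun p hp => ?_⟩
  rw [Finset.sum_mul]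
  refine Finset.sum_le_sum fun j _ => ?_
  have hS : 0 ≤ ∑ j, ∑ k, |d1 k (w j) p| := by positivity
  have t1 : |∑ k, ∑ i, m j k i * d1 k (w i) p| ≤ (∑ k, ∑ i, |m j k i|) * ∑ j, ∑ k, |d1 k (w j) p| := by
    rw [Finset.sum_mul]
    refine (Finset.abs_sum_le_sum_abs _ _).trans (Finset.sum_le_sum fun k _ => ?_)
    rw [Finset.sum_mul]
    refine (Finset.abs_sum_le_sum_abs _ _).trans (Finset.sum_le_sum fun i _ => ?_)
    rw [abs_mul]
    refine mul_le_mul_of_nonneg_left ?_ (abs_nonneg _)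
    exact (Finset.single_le_sum (f := fun k => |d1 k (w i) p|) (fun _ _ => abs_nonneg _) (Finset.mem_univ k)).trans
      (Finset.single_le_sum (f := fun j => ∑ k, |d1 k (w j) p|) (fun _ _ => by positivity) (Finset.mem_univ i))
  rw [h.mx j p hp]
  have t2 := abs_add_le (∑ k, ∑ i, m j k i * d1 k (w i) p) (mom (cm j) g p)
  have t3 := b1 j p hp
  have t4 : 0 ≤ (∫ ξ, |cm j ξ|) * M * ∑ j, ∑ k, |d1 k (w j) p| := by have := i0 j; positivity
  have t5 : 0 ≤ ∑ k, ∑ i, |m j k i| := by positivity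
  linarith

lemma log_aux {F q : ℝ} (hF : 0 ≤ F) (hq : 0 ≤ q) : Real.log (1 + F * exp q) ≤ Real.log (1 + F) + q := by
  have h1 : 1 + F * exp q ≤ (1 + F) * exp q := by have := one_le_exp hq; linarith
  have := Real.log_le_log (by positivity) h1
  rwa [Real.log_mul (by positivity) (exp_pos _).ne', Real.log_exp] at this

lemma Sys.lev2 (h : Sys τ R g w c m cm) : ∃ N, 0 ≤ N ∧ ∀ p ∈ U1 τ, ∑ j, ∑ k, |d1 k (w j) p| ≤ N := by
  obtain ⟨M, hM, gM⟩ := h.lev0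
  obtain ⟨N0, hN0, wN⟩ := h.lev1
  obtain ⟨Cc, hCc, hK⟩ := h.Kbd
  obtain ⟨Cd, hCd, hd0⟩ := h.d0b
  obtain ⟨Cg, F0, hCg, hF0, hgr⟩ := h.gradf
  obtain ⟨L, hL, lg, lw⟩ := h.lay
  choose A1 A2 W k1 k2 kW hF using h.rp
  choose C0 hC0 H0 using fun j => L1 hL h.cgU (h.cwU j) (hF j) (k1 j) lg (lw j).1 (lw j).2.1 (lw j).2.2
  choose C1 hC1 H1 using fun j i => SS1 (k2 j) (kW j) h.hτ h.cgU h.KFc h.hV hM (by positivity : 0 ≤ Cc * N0) i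
  have hs := s3_pos
  have hτ := h.hτ
  obtain ⟨C2, hC2⟩ : ∃ C2, C2 = Cc * (Cd + 1) := ⟨_, rfl⟩
  have hC20 : 0 ≤ C2 := by rw [hC2]; positivity
  obtain ⟨q0, hq0⟩ : ∃ q0, q0 = 1 + Real.log (1 + F0) + (Cg + C2) * τ := ⟨_, rfl⟩
  have hq00 : 0 ≤ q0 := by have := Real.log_nonneg (by linarith : 1 ≤ 1 + F0); rw [hq0]; positivity
  obtain ⟨a, ha⟩ : ∃ a, a = ∑ j, ∑ i, s3⁻¹ * (C0 j + C1 j i * q0) := ⟨_, rfl⟩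
  obtain ⟨b, hb⟩ : ∃ b, b = ∑ j, ∑ i, s3⁻¹ * (C1 j i * (Cg + C2)) := ⟨_, rfl⟩
  have ha0 : 0 ≤ a := by
    rw [ha]; exact Finset.sum_nonneg fun j _ => Finset.sum_nonneg fun i _ => by
      have := hC0 j; have := hC1 j i; positivity
  have hb0 : 0 ≤ b := by
    rw [hb]; exact Finset.sum_nonneg fun j _ => Finset.sum_nonneg fun i _ => by have := hC1 j i; positivity
  obtain ⟨l, hl⟩ : ∃ l, l = 2 * b + 1 := ⟨_, rfl⟩
  have hl0 : 0 < l := by rw [hl]; positivity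
  refine ⟨2 * a * exp (l * τ), by positivity, fun p hp => ?_⟩
  obtain ⟨T, x0⟩ := p
  have hT : T ∈ Ioo 0 τ := hp.1
  obtain ⟨B, hB⟩ := Cn_bdd hT.2 h x0
  have key := absorb (S := Cn T x0) (m := fun p => ∑ j, ∑ k, |d1 k (w j) p|) ha0 hl0.le (fun p hp => hp.1.1.le)
    (fun p _ => Finset.sum_nonneg fun _ _ => Finset.sum_nonneg fun _ _ => abs_nonneg _) (fun p hp => (hB p hp).2) ?_ (T, x0)
    ⟨⟨hT.1, le_rfl⟩, by simp⟩
  · refine key.trans ?_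
    gcongr
    exact hT.2.le
  rintro N hN HN ⟨t, x⟩ htx
  have ht : t ∈ Ioo 0 τ := ⟨htx.1.1, htx.1.2.trans_lt hT.2⟩
  obtain ⟨i1, i2⟩ := i_exp ht.1.le hl0
  obtain ⟨i3, i4⟩ := i_const t 1 ht.1.le
  obtain ⟨X, hX⟩ : ∃ X, X = N * (exp (l * t) / l) := ⟨_, rfl⟩
  have hX0 : 0 ≤ X := by rw [hX]; positivity
  have bj : ∀ j i, |d1 i (w j) (t, x)| ≤ s3⁻¹ * (C0 j + (C1 j i * q0 + C1 j i * (Cg + C2) * X)) := by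
    intro j i
    have hρ : 0 < T + 1 - t - ‖x - x0‖ := by have := htx.2; simp only at this; linarith
    refine mvstep (P := Gd t 2) (S := fun χ => SS g (KF c w) (A2 j) (W j) χ t)
      (cd_diff (U1_open τ) (h.cwU j) ⟨ht, trivial⟩) hρ (fun y ε hε => ?_) (fun χ hχ y hy => ?_)
    · obtain ⟨χ, hχ, -, h1⟩ := H0 j t ht x y ε hε
      exact ⟨χ, hχ, h1⟩
    have hty : (t, y) ∈ Cn T x0 := by
      refine ⟨htx.1, ?_⟩
      have := norm_add_le (y - x) (x - x0)
      rw [sub_add_sub_cancel] at this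
      simp only; linarith
    have h2 := H1 j i t ht y χ (fun r => C2 * (1 + N * exp (l * (t - r)))) (F0 * exp (Cg * (t + X))) hχ
      ((i3.add (i1.const_mul N)).const_mul C2) (fun r _ => by positivity) (by positivity) fun z hz => by
        have mz := ret_mem ht.2.le y hz
        have mc := Cn_ret hty hz
        have hk := hK _ mz
        have hm := HN _ mc
        have hw := wN (t - ‖z.1‖, y + z.1) ⟨mz.1, trivial⟩
        have hd := hd0 (t - ‖z.1‖, y + z.1) ⟨mz.1, trivial⟩
        have hz0 := norm_nonneg z.1
        have hE : 0 ≤ N * exp (l * (t - ‖z.1‖)) := by positivity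
        simp only at hm
        refine ⟨gM _ mz, ?_, fun n => ⟨((hk n).1).trans (mul_le_mul_of_nonneg_left hw hCc),
          ((hk n).2.1).trans ?_, fun k => ⟨((hk n).2.2 k).1.trans ?_,
          ((hk n).2.2 k).2.trans (mul_le_mul_of_nonneg_left hw hCc)⟩⟩⟩
        · have q1 : ∀ u : E3, ‖u‖ = 1 → fderiv ℝ g (t - ‖z.1‖, y + z.1, z.2) (0, u, 0) ≤ F0 * exp (Cg * (t + X)) := by
            intro u hu
            refine (hgr T hT.2 x0 N l hN hl0 HN _ _ mc z.2 0 u (by simp [hu])).trans ?_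
            rw [hX]; gcongr <;> linarith
          rw [ret, dX, abs_le']
          refine ⟨q1 _ (norm_e3 i), ?_⟩
          have := q1 (-e3 i) (by rw [norm_neg, norm_e3])
          have e : ((0 : ℝ), -e3 i, (0 : E3)) = -((0 : ℝ), e3 i, (0 : E3)) := by simp
          rwa [e, map_neg] at this
        · rw [hC2, mul_assoc]
          refine mul_le_mul_of_nonneg_left (hd.trans ?_) hCc
          gcongr; linarith
        · rw [hC2, mul_assoc]
          refine mul_le_mul_of_nonneg_left ?_ hCc
          have q2 : ∑ j, |d1 k (w j) (t - ‖z.1‖, y + z.1)| ≤ ∑ j, ∑ k, |d1 k (w j) (t - ‖z.1‖, y + z.1)| :=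
            Finset.sum_le_sum fun j _ => Finset.single_le_sum (f := fun k => |d1 k (w j) (t - ‖z.1‖, y + z.1)|)
              (fun _ _ => abs_nonneg _) (Finset.mem_univ k)
          nlinarith [mul_nonneg hCd hE]
    refine ⟨h2.1, h2.2.trans ?_⟩
    rw [integral_const_mul, integral_add i3 (i1.const_mul N), integral_const_mul, i4]
    have q3 := log_aux hF0 (by have := ht.1; positivity : 0 ≤ Cg * (t + X))
    have q4 : N * ∫ r in Ioo 0 t, exp (l * (t - r)) ≤ X := by rw [hX]; gcongr
    have q5 : C2 * (1 * t + N * ∫ r in Ioo 0 t, exp (l * (t - r))) ≤ C2 * (τ + X) := by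
      gcongr; linarith [ht.2]
    have q6 : Cg * (t + X) ≤ Cg * (τ + X) := by gcongr; exact ht.2.le
    have q7 : 1 + Real.log (1 + F0 * exp (Cg * (t + X))) + C2 * (1 * t + N * ∫ r in Ioo 0 t, exp (l * (t - r)))
        ≤ q0 + (Cg + C2) * X := by rw [hq0]; linarith
    refine (mul_le_mul_of_nonneg_left q7 (hC1 j i)).trans (le_of_eq (by ring))
  refine (Finset.sum_le_sum fun j _ => Finset.sum_le_sum fun i _ => bj j i).trans ?_
  have e : ∑ j, ∑ i, s3⁻¹ * (C0 j + (C1 j i * q0 + C1 j i * (Cg + C2) * X)) = a + b * X := by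
    rw [ha, hb, Finset.sum_mul, ← Finset.sum_add_distrib]
    refine Finset.sum_congr rfl fun j _ => ?_
    rw [Finset.sum_mul, ← Finset.sum_add_distrib]
    exact Finset.sum_congr rfl fun i _ => by ring
  rw [e, hX]
  have : b * (N * (exp (l * t) / l)) ≤ N / 2 * exp (l * t) := by
    have e : b * (N * (exp (l * t) / l)) = N * exp (l * t) * (b / l) := by ring
    have : b / l ≤ 1 / 2 := by rw [div_le_div_iff₀ hl0 two_pos]; linarith
    have h5 : 0 ≤ N * exp (l * t) := by positivity
    rw [e]; nlinarith [mul_le_mul_of_nonneg_left this h5]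
  simp only; linarith

/-- final bounds -/
lemma Sys.final (h : Sys τ R g w c m cm) : ∃ N, 0 ≤ N ∧ (∀ p ∈ U1 τ, ∀ j, |w j p| ≤ N ∧ ∀ k, |d1 k (w j) p| ≤ N) ∧
    ∀ p ∈ UU τ, |g p| ≤ N ∧ ∀ u v : E3, ‖u‖ ^ 2 + ‖v‖ ^ 2 ≤ 1 → fderiv ℝ g p (0, u, v) ≤ N := by
  obtain ⟨M, hM, gM⟩ := h.lev0
  obtain ⟨N0, hN0, wN⟩ := h.lev1
  obtain ⟨N2, hN2, dN⟩ := h.lev2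
  obtain ⟨Cg, F0, hCg, hF0, hgr⟩ := h.gradf
  have hτ := h.hτ
  obtain ⟨Y, hY⟩ : ∃ Y, Y = F0 * exp (Cg * (τ + N2 * (exp (1 * τ) / 1))) := ⟨_, rfl⟩
  have hY0 : 0 ≤ Y := by rw [hY]; positivity
  refine ⟨M + N0 + N2 + Y, by positivity, fun p hp j => ⟨?_, fun k => ?_⟩, fun p hp => ⟨by linarith [gM p hp], ?_⟩⟩
  · have := Finset.single_le_sum (f := fun j => |w j p|) (fun _ _ => abs_nonneg _) (Finset.mem_univ j)
    have := wN p hp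
    linarith
  · have := Finset.single_le_sum (f := fun k => |d1 k (w j) p|) (fun _ _ => abs_nonneg _) (Finset.mem_univ k)
    have := Finset.single_le_sum (f := fun j => ∑ k, |d1 k (w j) p|) (fun _ _ => by positivity) (Finset.mem_univ j)
    have := dN p hp
    linarith
  · intro u v huv
    have := hgr p.1 hp.1.2 p.2.1 N2 1 hN2 one_pos (fun q hq => (dN q ⟨⟨hq.1.1, hq.1.2.trans_lt hp.1.2⟩, trivial⟩).trans
      (le_mul_of_one_le_right hN2 (one_le_exp (by have := hq.1.1.le; positivity)))) p.1 p.2.1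
      ⟨⟨hp.1.1, le_rfl⟩, by simp⟩ p.2.2 v u huv
    have h3 : F0 * exp (Cg * (p.1 + N2 * (exp (1 * p.1) / 1))) ≤ Y := by
      rw [hY]; gcongr <;> exact hp.1.2.le
    refine (this.trans h3).trans (by linarith)

end sys

def eps (i k l : Fin 3) : ℝ := ((k.val : ℝ) - i.val) * ((l.val : ℝ) - i.val) * ((l.val : ℝ) - k.val) / 2

lemma mom_int {τ R : ℝ} {g : ℝ × E3 × E3 → ℝ} (hg : ContDiffOn ℝ 1 g (UU τ)) {c : E3 → ℝ} (hc : Continuous c)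
    (hR : ∀ ξ, R < ‖ξ‖ → c ξ = 0) {p : ℝ × E3} (hp : p ∈ U1 τ) : Integrable fun ξ => c ξ * g (p.1, p.2, ξ) := by
  refine Continuous.integrable_of_hasCompactSupport (hc.mul ?_) (HasCompactSupport.intro (isCompact_closedBall 0 R)
    fun ξ hξ => by rw [hR ξ (by simpa using hξ), zero_mul])
  exact hg.continuousOn.comp_continuous (by fun_prop) fun ξ => ⟨hp.1, trivial⟩

lemma fieldrep {τ R σ : ℝ} (hσ : σ * σ = 1) {g : ℝ × E3 × E3 → ℝ}
    {K : Fin 3 → ℝ × E3 × E3 → ℝ} (hg : ContDiffOn ℝ 1 g (UU τ))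
    (hK : ∀ l, ContDiffOn ℝ 1 (K l) (UU τ))
    (hV : ∀ p ∈ UU τ, dT g p + ∑ k, vrel p.2.2 k * dX k g p
      = - ∑ l, dV l (fun q => K l q * g q) p)
    (hg0 : ∀ p ∈ UU τ, R < ‖p.2.2‖ → g p = 0)
    {e b : Fin 3 → ℝ × E3 → ℝ} {je jb : Fin 3 → E3 → ℝ} {ρ : E3 → ℝ}
    (he : ∀ k, ContDiffOn ℝ 1 (e k) (U1 τ)) (hb : ∀ k, ContDiffOn ℝ 1 (b k) (U1 τ))
    (se : ∀ k, ContDiff ℝ ∞ (je k)) (sb : ∀ k, ContDiff ℝ ∞ (jb k)) (sρ : ContDiff ℝ ∞ ρ)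
    (ze : ∀ k ξ, R < ‖ξ‖ → je k ξ = 0) (zb : ∀ k ξ, R < ‖ξ‖ → jb k ξ = 0) (zρ : ∀ ξ, R < ‖ξ‖ → ρ ξ = 0)
    (q1 : ∀ i, ∀ p ∈ U1 τ, mom (je i) g p = d0 (e i) p - σ * ∑ k, ∑ l, eps i k l * d1 k (b l) p)
    (q2 : ∀ i, ∀ p ∈ U1 τ, mom (jb i) g p = d0 (b i) p + σ * ∑ k, ∑ l, eps i k l * d1 k (e l) p)
    (q3 : ∀ p ∈ U1 τ, mom ρ g p = ∑ k, d1 k (e k) p) (i : Fin 3) :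
    ∃ A1 A2 W, Ker 1 R A1 ∧ Ker 2 R A2 ∧ (∀ l, Ker 1 R (W l)) ∧ FRep τ g K (e i) R A1 A2 W := by
  have hda : ∀ k, ∀ p ∈ U1 τ, ∀ v, fderiv ℝ (fun p => ∑ l, σ * eps i k l * b l p) p v
      = ∑ l, σ * eps i k l * fderiv ℝ (b l) p v := fun k p hp v => by
    have := HasFDerivAt.fun_sum (u := Finset.univ) fun l _ =>
      (cd_diff (U1_open τ) (hb l) hp).const_mul (σ * eps i k l)
    rw [this.fderiv]; simp
  refine rep hg hK hV hg0 (a := fun k p => ∑ l, σ * eps i k l * b l p) (c := e) (cb := je i) (cρ := ρ)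
    (cd := fun k ξ => ∑ l, σ * eps i k l * jb l ξ) i (he i)
    (fun k => ContDiffOn.sum fun l _ => contDiffOn_const.mul (hb l)) he (se i) sρ
    (fun k => ContDiff.sum fun l _ => contDiff_const.mul (sb l)) (ze i) zρ
    (fun k ξ h => by simp [zb _ ξ h]) (fun p hp => ?_) (fun k p hp => ?_) q3
  · rw [q1 i p hp, Finset.mul_sum]
    congr 1
    refine Finset.sum_congr rfl fun k _ => ?_
    rw [d1, hda k p hp, Finset.mul_sum]
    exact Finset.sum_congr rfl fun l _ => by rw [d1]; ring
  · rw [d0, hda k p hp]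
    have h1 : mom (fun ξ => ∑ l, σ * eps i k l * jb l ξ) g p = ∑ l, σ * eps i k l * mom (jb l) g p := by
      simp only [mom, Finset.sum_mul, mul_assoc]
      rw [integral_finsetSum _ fun l _ => ?_]
      · exact Finset.sum_congr rfl fun l _ => by rw [integral_const_mul, integral_const_mul]
      · exact ((mom_int hg (sb l).continuous (zb l) hp).const_mul _).const_mul _
    rw [h1]
    simp only [q2 _ p hp]
    have h2 : ∀ l, fderiv ℝ (b l) p (1, 0) = d0 (b l) p := fun l => rfl
    simp only [h2]
    have h3 : ∀ l, σ * eps i k l * (d0 (b l) p + σ * ∑ k, ∑ n, eps l k n * d1 k (e n) p)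
        = σ * eps i k l * d0 (b l) p + eps i k l * ∑ k, ∑ n, eps l k n * d1 k (e n) p := fun l => by
      linear_combination (eps i k l * ∑ k, ∑ n, eps l k n * d1 k (e n) p) * hσ
    simp only [h3, Finset.sum_add_distrib]
    have h4 : ∑ l, eps i k l * ∑ k, ∑ n, eps l k n * d1 k (e n) p = d1 i (e k) p - d1 k (e i) p := by
      clear h3 h2 h1 hda q1 q2 q3
      fin_cases i <;> fin_cases k <;> simp [Fin.sum_univ_three, eps] <;> ring
    linarith

lemma vrel_symm (ξ : E3) (k l : Fin 3) :
    fderiv ℝ (fun η => vrel η k) ξ (e3 l) = fderiv ℝ (fun η => vrel η l) ξ (e3 k) := by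
  have hp : (0 : ℝ) < 1 + ‖ξ‖ ^ 2 := by positivity
  obtain ⟨s, h1⟩ : ∃ s : ℝ, HasFDerivAt (fun η : E3 => (√(1 + ‖η‖ ^ 2))⁻¹) (s • innerSL ℝ ξ) ξ := by
    have := (hasDerivAt_inv (sqrt_pos.2 hp).ne').comp_hasFDerivAt ξ
      (((hasStrictFDerivAt_norm_sq ξ).hasFDerivAt.const_add 1).sqrt hp.ne')
    refine ⟨-(√(1 + ‖ξ‖ ^ 2) ^ 2)⁻¹ * (1 / (2 * √(1 + ‖ξ‖ ^ 2)) * 2), this.congr_fderiv ?_⟩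
    rw [two_nsmul, ← two_smul ℝ, smul_smul, smul_smul, mul_assoc]
  have h2 : ∀ k l, fderiv ℝ (fun η : E3 => vrel η k) ξ (e3 l) =
      (√(1 + ‖ξ‖ ^ 2))⁻¹ * (e3 l) k + ξ k * (s * ξ l) := fun k l => by
    have h3 := h1.fun_mul (EuclideanSpace.proj (𝕜 := ℝ) k : E3 →L[ℝ] ℝ).hasFDerivAt (x := ξ)
    have h4 : HasFDerivAt (fun η : E3 => vrel η k) _ ξ := h3.congr_of_eventuallyEq
      (Eventually.of_forall fun η => vrel_apply η k)
    have e : ⟪ξ, e3 l⟫ = ξ l := by rw [e3, EuclideanSpace.inner_single_right]; simp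
    rw [h4.fderiv, add_apply, smul_apply, smul_apply, smul_apply, innerSL_apply_apply, e]
    rfl
  rw [h2, h2, coord_e3, coord_e3]
  simp only [eq_comm (a := k)]; ring

def Phi (E B : Fin 3 → ℝ) (l : Fin 3) (ξ : E3) : ℝ := E l + ∑ k, ∑ n, eps l k n * vrel ξ k * B n

lemma divF (E B : Fin 3 → ℝ) {u : E3 → ℝ} {ξ : E3} (hu : DifferentiableAt ℝ u ξ) :
    ∑ l, fderiv ℝ (fun η => Phi E B l η * u η) ξ (e3 l) = ∑ l, Phi E B l ξ * fderiv ℝ u ξ (e3 l) := by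
  have hv : ∀ k, HasFDerivAt (fun η => vrel η k) (fderiv ℝ (fun η => vrel η k) ξ) ξ := fun k =>
    ((vrel_cd (n := 1) k).differentiable one_ne_zero ξ).hasFDerivAt
  have h1 : ∀ l, HasFDerivAt (Phi E B l) (∑ k, ∑ n, (eps l k n * B n) • fderiv ℝ (fun η => vrel η k) ξ) ξ := fun l => by
    have := (HasFDerivAt.fun_sum (u := Finset.univ) fun k _ => HasFDerivAt.fun_sum (u := Finset.univ)
      fun n _ => ((hv k).const_mul (eps l k n * B n))).const_add (E l)
    refine this.congr_of_eventuallyEq (Eventually.of_forall fun η => ?_)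
    simp only [Phi]
    congr 1
    exact Finset.sum_congr rfl fun k _ => Finset.sum_congr rfl fun n _ => by ring
  have h2 : ∀ l, fderiv ℝ (fun η => Phi E B l η * u η) ξ (e3 l) = Phi E B l ξ * fderiv ℝ u ξ (e3 l)
      + u ξ * ∑ k, ∑ n, (eps l k n * B n) * fderiv ℝ (fun η => vrel η k) ξ (e3 l) := fun l => by
    rw [((h1 l).fun_mul hu.hasFDerivAt).fderiv]; simp
  simp only [h2, Finset.sum_add_distrib]
  have s01 := vrel_symm ξ 0 1
  have s02 := vrel_symm ξ 0 2
  have s12 := vrel_symm ξ 1 2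
  rw [add_eq_left, ← Finset.mul_sum]
  refine mul_eq_zero_of_right _ ?_
  simp [Fin.sum_univ_three, eps, s01, s02, s12]
  ring

def wF (E B : Fin 3 → ℝ × E3 → ℝ) (j : Bool × Fin 3) : ℝ × E3 → ℝ := bif j.1 then B j.2 else E j.2

def cF (ζ : E3 → ℝ) (l : Fin 3) (j : Bool × Fin 3) (ξ : E3) : ℝ :=
  ζ ξ * (bif j.1 then ∑ k, eps l k j.2 * vrel ξ k else if l = j.2 then 1 else 0)

lemma KF_Phi (ζ : E3 → ℝ) (E B : Fin 3 → ℝ × E3 → ℝ) (l : Fin 3) (p : ℝ × E3 × E3) :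
    KF (cF ζ) (wF E B) l p = ζ p.2.2 * Phi (fun n => E n (p.1, p.2.1)) (fun n => B n (p.1, p.2.1)) l p.2.2 := by
  simp only [KF, cF, wF, Fintype.sum_prod_type, Fintype.sum_bool, cond_true, cond_false, Phi]
  fin_cases l <;> simp [Fin.sum_univ_three] <;> ring

def mF (j : Bool × Fin 3) (k : Fin 3) (i : Bool × Fin 3) : ℝ :=
  if j.1 = i.1 then 0 else bif j.1 then -eps j.2 k i.2 else eps j.2 k i.2

def jF (ζ : E3 → ℝ) (j : Bool × Fin 3) (ξ : E3) : ℝ := bif j.1 then 0 else -(ζ ξ * vrel ξ j.2)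

lemma mkSys {τ r : ℝ} (hτ : 0 < τ) (hr : 0 < r) {g : ℝ × E3 × E3 → ℝ} {E B : Fin 3 → ℝ × E3 → ℝ}
    (cg : ContDiffOn ℝ 1 g (Ico 0 τ ×ˢ univ)) (cE : ∀ j, ContDiffOn ℝ 1 (E j) (Ico 0 τ ×ˢ univ))
    (cB : ∀ j, ContDiffOn ℝ 1 (B j) (Ico 0 τ ×ˢ univ)) (g0 : ∀ p ∈ UU τ, r < ‖p.2.2‖ → g p = 0)
    (hVl : ∀ p ∈ UU τ, dT g p + ∑ k, vrel p.2.2 k * dX k g p = -∑ l, fderiv ℝ (fun η =>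
      Phi (fun n => E n (p.1, p.2.1)) (fun n => B n (p.1, p.2.1)) l η * g (p.1, p.2.1, η)) p.2.2 (e3 l))
    (hA : ∀ i, ∀ p ∈ U1 τ, d0 (E i) p - ∑ k, ∑ l, eps i k l * d1 k (B l) p = -∫ ξ, g (p.1, p.2, ξ) * vrel ξ i)
    (hF : ∀ i, ∀ p ∈ U1 τ, d0 (B i) p + ∑ k, ∑ l, eps i k l * d1 k (E l) p = 0)
    (hGE : ∀ p ∈ U1 τ, ∑ k, d1 k (E k) p = ∫ ξ, g (p.1, p.2, ξ))
    (hGB : ∀ p ∈ U1 τ, ∑ k, d1 k (B k) p = 0)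
    (ldg : LD (fun z => g (0, z))) (ldE : ∀ j, LD (fun x => E j (0, x))) (ldB : ∀ j, LD (fun x => B j (0, x)))
    (lddE : ∀ j k, LD (fun x => fderiv ℝ (fun y => E j (0, y)) x (e3 k)))
    (lddB : ∀ j k, LD (fun x => fderiv ℝ (fun y => B j (0, y)) x (e3 k))) :
    ∃ ζ : E3 → ℝ, Sys τ (r + 1) g (wF E B) (cF ζ) mF (jF ζ) := by
  let β : ContDiffBump (0 : E3) := ⟨r, r + 1, hr, by linarith⟩
  obtain ⟨ζ, hζ⟩ : ∃ ζ : E3 → ℝ, ζ = β := ⟨_, rfl⟩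
  have zc : ∀ {n : ℕ∞}, ContDiff ℝ n ζ := by intro n; rw [hζ]; exact β.contDiff
  have z1 : ∀ ξ, ‖ξ‖ ≤ r → ζ ξ = 1 := fun ξ h => by
    rw [hζ]; exact β.one_of_mem_closedBall (by simpa using h)
  have z0 : ∀ ξ, r + 1 < ‖ξ‖ → ζ ξ = 0 := fun ξ h => by
    rw [hζ]; exact β.zero_of_le_dist (by simpa using h.le)
  clear_value β
  have zg : ∀ p ∈ UU τ, ζ p.2.2 * g p = g p := fun p hp => by
    rcases le_or_gt ‖p.2.2‖ r with h | h
    · rw [z1 _ h, one_mul]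
    · rw [g0 p hp h, mul_zero]
  have cgU : ContDiffOn ℝ 1 g (UU τ) := cg.mono (prod_mono Ioo_subset_Ico_self le_rfl)
  have cEU : ∀ j, ContDiffOn ℝ 1 (E j) (U1 τ) := fun j => (cE j).mono (prod_mono Ioo_subset_Ico_self le_rfl)
  have cBU : ∀ j, ContDiffOn ℝ 1 (B j) (U1 τ) := fun j => (cB j).mono (prod_mono Ioo_subset_Ico_self le_rfl)
  have cwU : ∀ j, ContDiffOn ℝ 1 (wF E B j) (U1 τ) := by rintro ⟨_ | _, j⟩; exacts [cEU j, cBU j]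
  have g0' : ∀ p ∈ UU τ, r + 1 < ‖p.2.2‖ → g p = 0 := fun p hp h => g0 p hp (by linarith)
  have cc : ∀ l j, ContDiff ℝ 1 (cF ζ l j) := by
    rintro l ⟨_ | _, j⟩
    · exact zc.mul contDiff_const
    · exact zc.mul (ContDiff.sum fun k _ => contDiff_const.mul (vrel_cd k))
  have KFc : ∀ l, ContDiffOn ℝ 1 (KF (cF ζ) (wF E B) l) (UU τ) := fun l => by
    refine ContDiffOn.sum fun j _ => ContDiffOn.mul ?_ ?_
    · exact ((cc l j).comp (contDiff_snd.comp contDiff_snd)).contDiffOn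
    · exact (cwU j).comp (f := fun p : ℝ × E3 × E3 => (p.1, p.2.1))
        (contDiff_fst.prodMk (contDiff_fst.comp contDiff_snd)).contDiffOn fun p hp => ⟨hp.1, trivial⟩
  have sl : ∀ {u : ℝ × E3 × E3 → ℝ}, ContDiffOn ℝ 1 u (UU τ) → ∀ p ∈ UU τ, HasFDerivAt (fun η => u (p.1, p.2.1, η))
      ((fderiv ℝ u p).comp ((ContinuousLinearMap.inr ℝ ℝ Z3).comp (ContinuousLinearMap.inr ℝ E3 E3))) p.2.2 := by
    intro u hu p hp
    exact HasFDerivAt.comp p.2.2 (f := fun η => (p.1, p.2.1, η)) (cd_diff (UU_open τ) hu hp)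
      (HasFDerivAt.comp p.2.2 (f := fun η => (p.2.1, η)) (hasFDerivAt_prodMk_right _ _) (hasFDerivAt_prodMk_right _ _))
  have hV : ∀ p ∈ UU τ, dT g p + ∑ k : Fin 3, (vrel p.2.2).ofLp k * dX k g p =
      -∑ l : Fin 3, dV l (fun q => KF (cF ζ) (wF E B) l q * g q) p := by
    intro p hp
    rw [hVl p hp]
    congr 1
    refine Finset.sum_congr rfl fun l _ => ?_
    have h1 := sl ((KFc l).mul cgU) p hp
    rw [dV]
    have h2 : (fun η => Phi (fun n => E n (p.1, p.2.1)) (fun n => B n (p.1, p.2.1)) l η * g (p.1, p.2.1, η)) =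
        fun η => KF (cF ζ) (wF E B) l (p.1, p.2.1, η) * g (p.1, p.2.1, η) := by
      ext η
      rw [KF_Phi, mul_comm (ζ _), mul_assoc]
      congr 1
      exact (zg (p.1, p.2.1, η) ⟨hp.1, trivial⟩).symm
    rw [h2]
    exact congrArg (fun L : E3 →L[ℝ] ℝ => L (e3 l)) h1.fderiv
  have sj : ∀ i, ContDiff ℝ ∞ fun ξ => -(ζ ξ * vrel ξ i) := fun i => (zc.mul (vrel_cd i)).neg
  have zj : ∀ i ξ, r + 1 < ‖ξ‖ → -(ζ ξ * vrel ξ i) = 0 := fun i ξ h => by rw [z0 ξ h]; simp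
  have mj : ∀ i, ∀ p ∈ U1 τ, mom (fun ξ => -(ζ ξ * vrel ξ i)) g p = -∫ ξ, g (p.1, p.2, ξ) * vrel ξ i := fun i p hp => by
    rw [mom, ← integral_neg]
    refine integral_congr_ae (ae_of_all _ fun ξ => ?_)
    have := zg (p.1, p.2, ξ) ⟨hp.1, trivial⟩
    simp only at this ⊢
    linear_combination -vrel ξ i * this
  have mρ : ∀ p ∈ U1 τ, mom ζ g p = ∫ ξ, g (p.1, p.2, ξ) := fun p hp =>
    integral_congr_ae (ae_of_all _ fun ξ => zg (p.1, p.2, ξ) ⟨hp.1, trivial⟩)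
  have m0 : ∀ p, mom (fun _ => 0) g p = 0 := fun p => by simp [mom]
  refine ⟨ζ, hτ, cg, ?_, g0', cc, fun l j ξ h => by rw [cF, z0 ξ h, zero_mul], ?_, ?_, ?_, hV, ?_, ldg, ?_, ?_, ?_⟩
  · rintro ⟨_ | _, j⟩; exacts [cE j, cB j]
  · rintro ⟨_ | _, j⟩; exacts [(sj j).continuous, continuous_const]
  · rintro ⟨_ | _, j⟩ ξ h; exacts [zj j ξ h, rfl]
  · intro p hp
    rcases le_or_gt ‖p.2.2‖ r with h | h
    swap
    · rw [fderiv_zero_xi g0 hp h, zero_apply]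
    have h1 := hVl p hp
    rw [divF _ _ (sl cgU p hp).differentiableAt] at h1
    have e : ((1 : ℝ), vrel p.2.2, KK (cF ζ) (wF E B) p) = ((1 : ℝ), (0 : E3), (0 : E3))
        + ∑ k, vrel p.2.2 k • ((0 : ℝ), e3 k, (0 : E3)) + ∑ l, KF (cF ζ) (wF E B) l p • ((0 : ℝ), (0 : E3), e3 l) := by
      have h2 := sum_coord_e3 (vrel p.2.2)
      have h3 := sum_coord_e3 (KK (cF ζ) (wF E B) p)
      refine Prod.ext ?_ (Prod.ext ?_ ?_)
      · simp [Prod.fst_sum]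
      · simp [Prod.fst_sum, Prod.snd_sum, h2]
      · simp only [Prod.snd_add, Prod.snd_sum, Prod.smul_snd, smul_zero, Finset.sum_const_zero, zero_add]
        exact h3.symm
    rw [e]
    simp only [map_add, map_sum, map_smul, smul_eq_mul]
    have h4 : ∀ l, KF (cF ζ) (wF E B) l p = Phi (fun n => E n (p.1, p.2.1)) (fun n => B n (p.1, p.2.1)) l p.2.2 :=
      fun l => by rw [KF_Phi, z1 _ h, one_mul]
    have h5 : ∀ l, fderiv ℝ (fun η => g (p.1, p.2.1, η)) p.2.2 (e3 l) = fderiv ℝ g p ((0 : ℝ), (0 : E3), e3 l) :=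
      fun l => congrArg (fun L : E3 →L[ℝ] ℝ => L (e3 l)) (sl cgU p hp).fderiv
    simp only [h5, dT, dX] at h1
    simp only [h4]
    linarith
  · rintro ⟨_ | _, j⟩ p hp
    · have h1 := hA j p hp
      rw [← mj j p hp] at h1
      have e0 : mom (jF ζ (false, j)) g p = mom (fun ξ => -(ζ ξ * vrel ξ j)) g p := rfl
      rw [e0]
      simp only [wF, mF, Fintype.sum_prod_type, Fintype.sum_bool, cond_true, cond_false]
      simp
      linarith
    · have h1 := hF j p hp
      have e0 : mom (jF ζ (true, j)) g p = 0 := m0 p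
      rw [e0]
      simp only [wF, mF, Fintype.sum_prod_type, Fintype.sum_bool, cond_true, cond_false]
      simp
      linarith
  · rintro ⟨_ | _, j⟩; exacts [ldE j, ldB j]
  · rintro ⟨_ | _, j⟩ k; exacts [lddE j k, lddB j k]
  · rintro ⟨_ | _, j⟩
    · exact fieldrep (σ := 1) (by norm_num) cgU KFc hV g0' cEU cBU sj (jb := fun _ _ => 0) (fun _ => contDiff_const) (zc (n := ⊤))
        zj (fun _ _ _ => rfl) z0 (fun i p hp => by rw [mj i p hp, one_mul, hA i p hp])
        (fun i p hp => by rw [m0, one_mul, hF i p hp]) (fun p hp => by rw [mρ p hp, hGE p hp]) j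
    · exact fieldrep (σ := -1) (by norm_num) cgU KFc hV g0' cBU cEU (je := fun _ _ => 0) (fun _ => contDiff_const) sj
        (ρ := fun _ => 0) contDiff_const (fun _ _ _ => rfl) zj (fun _ _ => rfl)
        (fun i p hp => by rw [m0, ← hF i p hp]; ring) (fun i p hp => by rw [mj i p hp, ← hA i p hp]; ring)
        (fun p hp => by rw [m0, hGB p hp]) j

def cp (F : ℝ → E3 → E3) (n : Fin 3) (p : ℝ × E3) : ℝ := F p.1 p.2 n

lemma cp_reg {τ : ℝ} {F : ℝ → E3 → E3} (h : ContDiffOn ℝ 1 (fun p : ℝ × E3 => F p.1 p.2) (Ico 0 τ ×ˢ univ))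
    (n : Fin 3) : ContDiffOn ℝ 1 (cp F n) (Ico 0 τ ×ˢ univ) :=
  (EuclideanSpace.proj (𝕜 := ℝ) n).contDiff.comp_contDiffOn h

lemma cp_der {τ : ℝ} {F : ℝ → E3 → E3} (h : ContDiffOn ℝ 1 (fun p : ℝ × E3 => F p.1 p.2) (Ico 0 τ ×ˢ univ))
    {t : ℝ} (ht : t ∈ Ioo 0 τ) (x : E3) : (∀ n, deriv (fun s => F s x) t n = d0 (cp F n) (t, x)) ∧
      (∀ n k, pd3 (fun y => F t y n) k x = d1 k (cp F n) (t, x)) ∧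
      ∀ n u, fderiv ℝ (F t) x u n = fderiv ℝ (cp F n) (t, x) (0, u) := by
  have h1 : HasFDerivAt (fun p : ℝ × E3 => F p.1 p.2) (fderiv ℝ (fun p : ℝ × E3 => F p.1 p.2) (t, x)) (t, x) :=
    (((h.mono (prod_mono Ioo_subset_Ico_self le_rfl)).contDiffAt ((U1_open τ).mem_nhds ⟨ht, trivial⟩)).differentiableAt
      (by simp)).hasFDerivAt
  generalize fderiv ℝ (fun p : ℝ × E3 => F p.1 p.2) (t, x) = D at h1
  have h2 : ∀ n, fderiv ℝ (cp F n) (t, x) = (EuclideanSpace.proj (𝕜 := ℝ) n).comp D := fun n =>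
    ((EuclideanSpace.proj (𝕜 := ℝ) n).hasFDerivAt.comp (t, x) h1).fderiv
  have h3 : HasFDerivAt (F t) (D.comp (ContinuousLinearMap.inr ℝ ℝ E3)) x :=
    HasFDerivAt.comp x (f := fun y => (t, y)) h1 (hasFDerivAt_prodMk_right _ _)
  have h4 : HasDerivAt (fun s => F s x) (D (1, 0)) t :=
    h1.comp_hasDerivAt t (f := fun s => (s, x)) ((hasDerivAt_id t).prodMk (hasDerivAt_const t x))
  refine ⟨fun n => ?_, fun n k => ?_, fun n u => ?_⟩
  · rw [h4.deriv, d0, h2]; rfl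
  · have := ((EuclideanSpace.proj (𝕜 := ℝ) n).hasFDerivAt.comp x h3).fderiv
    rw [pd3, d1, h2]
    exact congrArg (fun L : E3 →L[ℝ] ℝ => L (e3 k)) this
  · rw [h3.fderiv, h2]; rfl

lemma vec_le (a : E3) {N : ℝ} (h : ∀ n, |a n| ≤ N) : ‖a‖ ≤ 3 * N := by
  rw [← sum_coord_e3 a]
  refine (norm_sum_le _ _).trans ((Finset.sum_le_sum (g := fun _ => N) fun k _ => ?_).trans (by simp))
  rw [norm_smul, norm_e3, mul_one]; exact h k

lemma op_le (L : E3 →L[ℝ] E3) {N : ℝ} (h : ∀ n k, |L (e3 k) n| ≤ N) : ‖L‖ ≤ 9 * N := by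
  have hN : 0 ≤ N := (abs_nonneg _).trans (h 0 0)
  refine L.opNorm_le_bound (by positivity) fun u => ?_
  have : ∀ n, |L u n| ≤ 3 * N * ‖u‖ := fun n => by
    refine (lin_bd ((EuclideanSpace.proj (𝕜 := ℝ) n).comp L) u).trans ?_
    have : ∑ k, |((EuclideanSpace.proj (𝕜 := ℝ) n).comp L) (e3 k)| ≤ ∑ _k : Fin 3, N := Finset.sum_le_sum fun k _ => h n k
    rw [mul_comm]
    refine mul_le_mul_of_nonneg_right (this.trans (by simp)) (norm_nonneg _)
  exact (vec_le _ this).trans (by linarith)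

lemma op_leZ (L : Z3 →L[ℝ] ℝ) {N : ℝ} (hN : 0 ≤ N) (h : ∀ u v : E3, ‖u‖ ^ 2 + ‖v‖ ^ 2 ≤ 1 → L (u, v) ≤ N) :
    ‖L‖ ≤ 2 * N := by
  refine L.opNorm_le_bound (by positivity) fun z => ?_
  have key : ∀ z, L z ≤ 2 * N * ‖z‖ := fun z => by
    rcases (norm_nonneg z).eq_or_lt with h0 | h0
    · rw [norm_eq_zero.1 h0.symm]; simp
    have h1 := norm_fst_le z
    have h2 := norm_snd_le z
    have h3 := h ((2 * ‖z‖)⁻¹ • z.1) ((2 * ‖z‖)⁻¹ • z.2) (by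
      rw [norm_smul, norm_smul, norm_inv, Real.norm_of_nonneg (by positivity)]
      have e : ∀ a : ℝ, ((2 * ‖z‖)⁻¹ * a) ^ 2 = a ^ 2 / (4 * ‖z‖ ^ 2) := fun a => by field_simp; ring
      rw [e, e, ← add_div, div_le_one (by positivity)]
      nlinarith [norm_nonneg z.1, norm_nonneg z.2])
    have h4 : ((2 * ‖z‖)⁻¹ • z.1, (2 * ‖z‖)⁻¹ • z.2) = (2 * ‖z‖)⁻¹ • z := rfl
    rw [h4, map_smul, smul_eq_mul, inv_mul_le_iff₀ (by positivity)] at h3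
    linarith
  rw [Real.norm_eq_abs, abs_le]
  have := key (-z)
  rw [map_neg, norm_neg] at this
  exact ⟨by linarith, key z⟩

lemma curl_eq (F : E3 → E3) (x : E3) (i : Fin 3) : curl3 F x i = ∑ k, ∑ l, eps i k l * pd3 (fun y => F y l) k x := by
  fin_cases i <;> simp [curl3, eps, Fin.sum_univ_three] <;> ring

lemma Phi_eq (a b η : E3) (i : Fin 3) : (a + cross3 (vrel η) b) i = Phi (fun n => a n) (fun n => b n) i η := by
  fin_cases i <;> simp [cross3, Phi, eps, Fin.sum_univ_three] <;> ring

lemma cur_int {u : E3 → ℝ} (hu : Integrable u) (i : Fin 3) :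
    (∫ ξ, u ξ • vrel ξ) i = ∫ ξ, u ξ * vrel ξ i := by
  have h1 : Continuous fun ξ : E3 => (√(1 + ‖ξ‖ ^ 2))⁻¹ :=
    Continuous.inv₀ (f := fun ξ : E3 => √(1 + ‖ξ‖ ^ 2)) (by fun_prop) fun x => by positivity
  have hc : Continuous vrel := h1.smul continuous_id
  have hI : Integrable fun ξ => u ξ • vrel ξ := by
    refine hu.norm.mono' (hu.aestronglyMeasurable.smul hc.aestronglyMeasurable) (ae_of_all _ fun ξ => ?_)
    rw [norm_smul]
    exact mul_le_of_le_one_right (norm_nonneg _) (vrel_lt ξ).le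
  exact ((EuclideanSpace.proj (𝕜 := ℝ) i).integral_comp_comm hI).symm

lemma fld_data {F : E3 → E3} (h : ContDiff ℝ 2 F) (hc : HasCompactSupport F) (n : Fin 3) :
    LD (fun x => F x n) ∧ ∀ k, LD (fun x => fderiv ℝ (fun y => F y n) x (e3 k)) := by
  have h1 : ContDiff ℝ 2 fun x => F x n := (EuclideanSpace.proj (𝕜 := ℝ) n).contDiff.comp h
  have h2 : HasCompactSupport fun x => F x n := hc.comp_left (g := fun a : E3 => a n) rfl
  refine ⟨LD_data (h1.of_le (by norm_num)) h2, fun k => LD_data ?_ ?_⟩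
  · exact (h1.fderiv_right (m := 1) (by norm_num)).clm_apply contDiff_const
  · exact (h2.fderiv (𝕜 := ℝ)).comp_left (g := fun L : E3 →L[ℝ] ℝ => L (e3 k)) rfl

lemma init_bd {X Y : Type*} [NormedAddCommGroup X] [NormedSpace ℝ X] [NormedAddCommGroup Y] [NormedSpace ℝ Y]
    {F : X → Y} (h : ContDiff ℝ 1 F) (hc : HasCompactSupport F) : ∃ C, ∀ x, ‖F x‖ + ‖fderiv ℝ F x‖ ≤ C := by
  obtain ⟨a, ha⟩ := hc.exists_bound_of_continuous h.continuous
  obtain ⟨b, hb⟩ := (hc.fderiv (𝕜 := ℝ)).exists_bound_of_continuous (h.continuous_fderiv one_ne_zero)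
  exact ⟨a + b, fun x => add_le_add (ha x) (hb x)⟩

lemma f_der {τ : ℝ} {f : ℝ → E3 → E3 → ℝ} {g : ℝ × E3 × E3 → ℝ} (hg : ∀ t x ξ, g (t, x, ξ) = f t x ξ)
    (h : ContDiffOn ℝ 1 g (Ico 0 τ ×ˢ univ)) {t : ℝ} (ht : t ∈ Ioo 0 τ) (x ξ : E3) :
    deriv (fun s => f s x ξ) t = dT g (t, x, ξ) ∧
    ⟪vrel ξ, gradient (fun y => f t y ξ) x⟫ = ∑ k, vrel ξ k * dX k g (t, x, ξ) ∧
    ∀ z, fderiv ℝ (fun q : E3 × E3 => f t q.1 q.2) (x, ξ) z = fderiv ℝ g (t, x, ξ) (0, z) := by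
  have h1 := cd_diff (UU_open τ) (h.mono (prod_mono Ioo_subset_Ico_self le_rfl)) (p := (t, x, ξ)) ⟨ht, trivial⟩
  simp only [dT, dX]
  generalize fderiv ℝ g (t, x, ξ) = D at h1
  have e1 : (fun s => f s x ξ) = fun s => g (s, x, ξ) := by ext; rw [hg]
  have e2 : (fun y => f t y ξ) = fun y => g (t, y, ξ) := by ext; rw [hg]
  have e3 : (fun q : E3 × E3 => f t q.1 q.2) = fun q => g (t, q) := by ext; rw [← hg]
  rw [e1, e2, e3]
  have h2 : HasDerivAt (fun s => g (s, x, ξ)) (D (1, 0)) t :=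
    h1.comp_hasDerivAt t (f := fun s => (s, x, ξ)) ((hasDerivAt_id t).prodMk (hasDerivAt_const t (x, ξ)))
  have h3 : HasFDerivAt (fun q => g (t, q)) (D.comp (ContinuousLinearMap.inr ℝ ℝ (E3 × E3))) (x, ξ) :=
    HasFDerivAt.comp (x, ξ) (f := fun q => (t, q)) h1 (hasFDerivAt_prodMk_right _ _)
  have h4 := HasFDerivAt.comp x (f := fun y => (y, ξ)) h3 (hasFDerivAt_prodMk_left _ _)
  have h5 : fderiv ℝ (fun y => g (t, y, ξ)) x = _ := h4.fderiv
  refine ⟨h2.deriv, ?_, fun z => by rw [h3.fderiv]; rfl⟩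
  rw [real_inner_comm, gradient, InnerProductSpace.toDual_symm_apply, h5]
  conv_lhs => rw [← sum_coord_e3 (vrel ξ)]
  rw [map_sum]
  refine Finset.sum_congr rfl fun k _ => ?_
  rw [map_smul]; rfl

/-- **Glassey–Strauss theorem, equivalent form.** If the momentum support radius of a
`C¹` solution of the relativistic Vlasov–Maxwell system remains bounded on `[0,τ)`,
then the `W^{1,∞}` norms of `f`, `E` and `B` remain bounded on `[0,τ)`. -/
theorem glassey_strauss_equivalent_form
    (τ : ℝ) (hτ : 0 < τ)
    (f : ℝ → E3 → E3 → ℝ) (Efld Bfld : ℝ → E3 → E3)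
    (fin : E3 → E3 → ℝ) (Ein Bin : E3 → E3)
    -- regularity of the solution on `[0,τ)`
    (hfreg : ContDiffOn ℝ 1 (fun p : ℝ × E3 × E3 => f p.1 p.2.1 p.2.2)
      (Set.Ico 0 τ ×ˢ (Set.univ : Set (E3 × E3))))
    (hEreg : ContDiffOn ℝ 1 (fun p : ℝ × E3 => Efld p.1 p.2)
      (Set.Ico 0 τ ×ˢ (Set.univ : Set E3)))
    (hBreg : ContDiffOn ℝ 1 (fun p : ℝ × E3 => Bfld p.1 p.2)
      (Set.Ico 0 τ ×ˢ (Set.univ : Set E3)))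
    -- regularity, positivity and support of the initial data
    (hfinreg : ContDiff ℝ 1 (fun p : E3 × E3 => fin p.1 p.2))
    (hfinpos : ∀ x ξ : E3, 0 ≤ fin x ξ)
    (hfinsupp : HasCompactSupport (fun p : E3 × E3 => fin p.1 p.2))
    (hEinreg : ContDiff ℝ 2 Ein) (hBinreg : ContDiff ℝ 2 Bin)
    (hEinsupp : HasCompactSupport Ein) (hBinsupp : HasCompactSupport Bin)
    -- initial conditions
    (hf0 : ∀ x ξ : E3, f 0 x ξ = fin x ξ)
    (hE0 : ∀ x : E3, Efld 0 x = Ein x) (hB0 : ∀ x : E3, Bfld 0 x = Bin x)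
    -- integrability in the momentum variable
    (hintf : ∀ t ∈ Set.Ico 0 τ, ∀ x : E3, Integrable fun ξ : E3 => f t x ξ)
    -- compatibility conditions on the initial data
    (hcompatE : ∀ x : E3, divg Ein x = ∫ ξ : E3, fin x ξ)
    (hcompatB : ∀ x : E3, divg Bin x = 0)
    -- the Vlasov equation
    (hVlasov : ∀ t ∈ Set.Ioo 0 τ, ∀ x ξ : E3,
      deriv (fun s => f s x ξ) t + ⟪vrel ξ, gradient (fun y => f t y ξ) x⟫
        = -∑ i : Fin 3,
            fderiv ℝ (fun η => (Efld t x + cross3 (vrel η) (Bfld t x)) i * f t x η) ξ (e3 i))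
    -- the Maxwell equations
    (hAmpere : ∀ t ∈ Set.Ioo 0 τ, ∀ x : E3,
      deriv (fun s => Efld s x) t - curl3 (Bfld t) x = -∫ ξ : E3, f t x ξ • vrel ξ)
    (hGaussE : ∀ t ∈ Set.Ioo 0 τ, ∀ x : E3, divg (Efld t) x = ∫ ξ : E3, f t x ξ)
    (hFaraday : ∀ t ∈ Set.Ioo 0 τ, ∀ x : E3,
      deriv (fun s => Bfld s x) t + curl3 (Efld t) x = 0)
    (hGaussB : ∀ t ∈ Set.Ioo 0 τ, ∀ x : E3, divg (Bfld t) x = 0)    -- bounded momentum support radius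
    (hR : ∃ r : ℝ, 0 < r ∧ ∀ t ∈ Set.Ico 0 τ, ∀ x ξ : E3, r < ‖ξ‖ → f t x ξ = 0) :
    ∃ C : ℝ, ∀ t ∈ Set.Ico 0 τ, ∀ x ξ : E3,
      |f t x ξ| + ‖fderiv ℝ (fun q : E3 × E3 => f t q.1 q.2) (x, ξ)‖
        + ‖Efld t x‖ + ‖fderiv ℝ (Efld t) x‖
        + ‖Bfld t x‖ + ‖fderiv ℝ (Bfld t) x‖ ≤ C := by
  obtain ⟨r, hr, hR⟩ := hR
  obtain ⟨g, hg⟩ : ∃ g : ℝ × E3 × E3 → ℝ, g = fun p => f p.1 p.2.1 p.2.2 := ⟨_, rfl⟩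
  have hg' : ∀ t x ξ, g (t, x, ξ) = f t x ξ := fun t x ξ => by rw [hg]
  rw [← hg] at hfreg
  have fE : (fun x => Efld 0 x) = Ein := funext hE0
  have fB : (fun x => Bfld 0 x) = Bin := funext hB0
  have cE : ∀ n, (fun x => cp Efld n (0, x)) = fun x => Ein x n := fun n => by ext x; simp only [cp, hE0]
  have cB : ∀ n, (fun x => cp Bfld n (0, x)) = fun x => Bin x n := fun n => by ext x; simp only [cp, hB0]
  obtain ⟨ζ, hS⟩ := mkSys (E := cp Efld) (B := cp Bfld) hτ hr hfreg (cp_reg hEreg) (cp_reg hBreg)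
    (fun p hp h => by rw [hg]; exact hR _ (Ioo_subset_Ico_self hp.1) _ _ h)
    (fun p hp => by
      obtain ⟨t, x, ξ⟩ := p
      obtain ⟨h1, h2, -⟩ := f_der hg' hfreg hp.1 x ξ
      have h3 := hVlasov t hp.1 x ξ
      rw [h1, h2] at h3
      simp only [Phi_eq] at h3
      simp only [hg']
      exact h3)
    (fun i p hp => by
      obtain ⟨t, x⟩ := p
      obtain ⟨h1, -⟩ := cp_der hEreg hp.1 x
      obtain ⟨-, h2, -⟩ := cp_der hBreg hp.1 x
      have h3 := congrArg (fun a : E3 => a i) (hAmpere t hp.1 x)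
      simp only [PiLp.sub_apply, PiLp.neg_apply, curl_eq, h1, h2, cur_int (hintf t (Ioo_subset_Ico_self hp.1) x)] at h3
      simp only [hg']
      exact h3)
    (fun i p hp => by
      obtain ⟨t, x⟩ := p
      obtain ⟨h1, -⟩ := cp_der hBreg hp.1 x
      obtain ⟨-, h2, -⟩ := cp_der hEreg hp.1 x
      have h3 := congrArg (fun a : E3 => a i) (hFaraday t hp.1 x)
      simp only [PiLp.add_apply, PiLp.zero_apply, curl_eq, h1, h2] at h3
      exact h3)
    (fun p hp => by
      obtain ⟨t, x⟩ := p
      obtain ⟨-, h2, -⟩ := cp_der hEreg hp.1 x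
      have h3 := hGaussE t hp.1 x
      simp only [divg, h2] at h3
      simp only [hg']
      exact h3)
    (fun p hp => by
      obtain ⟨t, x⟩ := p
      obtain ⟨-, h2, -⟩ := cp_der hBreg hp.1 x
      have h3 := hGaussB t hp.1 x
      simp only [divg, h2] at h3
      exact h3)
    (by
      have e : (fun z => g (0, z)) = fun z : E3 × E3 => fin z.1 z.2 := by ext z; rw [← hf0, ← hg']
      rw [e]; exact LD_data hfinreg hfinsupp)
    (fun n => by rw [cE]; exact (fld_data hEinreg hEinsupp n).1)
    (fun n => by rw [cB]; exact (fld_data hBinreg hBinsupp n).1)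
    (fun n k => by rw [cE]; exact (fld_data hEinreg hEinsupp n).2 k)
    (fun n k => by rw [cB]; exact (fld_data hBinreg hBinsupp n).2 k)
  obtain ⟨N, hN, hw, hgb⟩ := hS.final
  obtain ⟨C1, h1⟩ := init_bd hfinreg hfinsupp
  obtain ⟨C2, h2⟩ := init_bd (hEinreg.of_le (by norm_num)) hEinsupp
  obtain ⟨C3, h3⟩ := init_bd (hBinreg.of_le (by norm_num)) hBinsupp
  refine ⟨max (27 * N) (C1 + C2 + C3), fun t ht x ξ => ?_⟩
  rcases ht.1.eq_or_lt with h0 | h0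
  · refine le_max_of_le_right ?_
    subst h0
    have e : (fun q : E3 × E3 => f 0 q.1 q.2) = fun q => fin q.1 q.2 := by ext q; exact hf0 _ _
    have k1 := h1 (x, ξ)
    have k2 := h2 x
    have k3 := h3 x
    rw [Real.norm_eq_abs] at k1
    rw [e, show Efld 0 = Ein from fE, show Bfld 0 = Bin from fB, hf0]
    linarith
  · refine le_max_of_le_left ?_
    have ht' : t ∈ Ioo 0 τ := ⟨h0, ht.2⟩
    obtain ⟨b1, b2⟩ := hgb (t, x, ξ) ⟨ht', trivial⟩
    rw [hg'] at b1
    have k1 := op_leZ (fderiv ℝ (fun q : E3 × E3 => f t q.1 q.2) (x, ξ)) hN fun u v huv => by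
      rw [(f_der hg' hfreg ht' x ξ).2.2]; exact b2 u v huv
    have k2 : ‖Efld t x‖ ≤ 3 * N := vec_le _ fun n => (hw (t, x) ⟨ht', trivial⟩ (false, n)).1
    have k3 : ‖Bfld t x‖ ≤ 3 * N := vec_le _ fun n => (hw (t, x) ⟨ht', trivial⟩ (true, n)).1
    have k4 : ‖fderiv ℝ (Efld t) x‖ ≤ 9 * N := op_le _ fun n k => by
      rw [(cp_der hEreg ht' x).2.2]; exact (hw (t, x) ⟨ht', trivial⟩ (false, n)).2 k
    have k5 : ‖fderiv ℝ (Bfld t) x‖ ≤ 9 * N := op_le _ fun n k => by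
      rw [(cp_der hBreg ht' x).2.2]; exact (hw (t, x) ⟨ht', trivial⟩ (true, n)).2 k
    linarith
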